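/- arXiv:2006.12942 — 8 statements merged into one kernel-verified Lean document; each statement's English description precedes it below -/
import Mathlib

section
/- For every (x,y) ∈ Ω(g), the subspace V′_{x,y} of g spanned by the centralizers g^{ax+by}, (a,b) ∈ k²∖{(0,0)}, has dimension b(g) = (dim g + rk(g))/2. -/
open LinearMap (BilinForm)

open Polynomial in
/-- If the alternating forms `S + t T` have constant corank, then `ker S` lies in every hyperplane
containing `ker (S + t T)` for all `t ≠ 0`. -/
theorem LinearMap.BilinForm.apply_eq_zero_of_forall_ker_add_smul {k V : Type*} [Field k]
    [Infinite k] [AddCommGroup V] [Module k V] [Module.Finite k V] {S T : BilinForm k V}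
    (hS : S.IsAlt) (hT : T.IsAlt)
    (hrank : ∀ t : k, Module.finrank k (LinearMap.ker (S + t • T)) =
      Module.finrank k (LinearMap.ker S))
    (f : Module.Dual k V) (hf : ∀ t : k, t ≠ 0 → ∀ v ∈ LinearMap.ker (S + t • T), f v = 0)
    {u : V} (hu : u ∈ LinearMap.ker S) : f u = 0 := by
  obtain ⟨C, hC⟩ := Submodule.exists_isCompl (LinearMap.ker S)
  let b := Module.finBasis k C
  let M₀ := Matrix.of fun i j ↦ S (b i) (b j)
  let N := Matrix.of fun i j ↦ T (b i) (b j)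
  let w := fun i ↦ T (b i) u
  have hb (R : BilinForm k V) {v : V} (h : ∀ i, R (b i) v = 0) : v ∈ R.orthogonal C := by
    intro c hc
    have : (R.flip v) ∘ₗ C.subtype = 0 := b.ext fun i ↦ by simpa using h i
    simpa using LinearMap.congr_fun this ⟨c, hc⟩
  have hdet₀ : M₀.det ≠ 0 := by
    intro h
    obtain ⟨c, hc, hc'⟩ := Matrix.exists_mulVec_eq_zero_iff.mpr h
    apply hc
    have h₁ : ∀ i, S (b i) (∑ j, c j • (b j : V)) = 0 := fun i ↦ by
      simpa [Matrix.mulVec, dotProduct, M₀, mul_comm] using congrFun hc' i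
    have h₂ := hb S h₁
    have h₃ : (∑ j, c j • (b j : V)) ∈ LinearMap.ker S := by
      ext v
      obtain ⟨p, hp, q, hq, rfl⟩ := Submodule.mem_sup.mp
        (hC.sup_eq_top ▸ Submodule.mem_top : v ∈ LinearMap.ker S ⊔ C)
      apply hS.isRefl
      have : S p = 0 := hp
      have h' : S q _ = 0 := h₂ q hq
      rw [map_add, LinearMap.add_apply, this, h']
      simp
    have h₄ : (∑ j, c j • b j : C) = 0 := by
      have := Submodule.disjoint_def.mp hC.disjoint _ h₃
        (Submodule.sum_mem _ fun j _ ↦ C.smul_mem _ (b j).2)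
      apply Subtype.ext
      simpa using this
    ext j
    exact Fintype.linearIndependent_iff.mp b.linearIndependent c h₄ j
  let M : Matrix _ _ k[X] := M₀.map Polynomial.C + (X : k[X]) • N.map Polynomial.C
  let Q : k[X] := M.det * Polynomial.C (f u) -
    X * ∑ j, (M.adjugate.mulVec (Polynomial.C ∘ w)) j * Polynomial.C (f (b j))
  have hM (t : k) : M.map (evalRingHom t) = M₀ + t • N := by
    ext i j
    simp [M, mul_comm t]
  have hMdet (t : k) : M.det.eval t = (M₀ + t • N).det := by
    rw [← hM, ← coe_evalRingHom, RingHom.map_det]; rfl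
  have hMadj (t : k) (j) : ((M.adjugate.mulVec (Polynomial.C ∘ w)) j).eval t =
      ((M₀ + t • N).adjugate.mulVec w) j := by
    rw [← hM, ← coe_evalRingHom, RingHom.map_mulVec]
    have := RingHom.map_adjugate (evalRingHom t) M
    simp only [RingHom.mapMatrix_apply] at this
    rw [this]
    congr 2
    ext i; simp
  have hQ (t : k) : Q.eval t = (M₀ + t • N).det * f u -
      t * ∑ j, ((M₀ + t • N).adjugate.mulVec w) j * f (b j) := by
    simp only [Q, eval_sub, eval_mul, eval_X, eval_C, eval_finsetSum, hMadj, hMdet]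
  have hker (t : k) (ht : (M₀ + t • N).det ≠ 0) :
      (S + t • T).orthogonal C = LinearMap.ker (S + t • T) := by
    have hrefl : (S + t • T).IsRefl := (hS.add (hT.smul t)).isRefl
    symm
    apply Submodule.eq_of_le_of_finrank_eq
    · intro v hv c _
      exact hrefl _ _ (by rw [LinearMap.mem_ker.mp hv]; rfl)
    · have h₁ := LinearMap.BilinForm.finrank_add_finrank_orthogonal' (B := S + t • T) C
      have h₂ : C ⊓ LinearMap.ker (S + t • T) = ⊥ := by
        rw [eq_bot_iff]
        rintro c ⟨hc, hc'⟩
        have hc₀ : (⟨c, hc⟩ : C) = 0 := by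
          apply b.repr.map_eq_zero_iff.mp
          ext i
          refine congrFun (Matrix.eq_zero_of_mulVec_eq_zero ht (v := b.repr ⟨c, hc⟩) ?_) i
          ext i
          have h₃ : (∑ j, b.repr ⟨c, hc⟩ j • (b j : V)) = c := by
            have h := congrArg C.subtype (b.sum_repr ⟨c, hc⟩)
            rwa [map_sum] at h
          have h₄ : (S + t • T) (b i) c = 0 :=
            hrefl _ _ (by rw [LinearMap.mem_ker.mp hc']; rfl)
          rw [← h₃, map_sum] at h₄
          simp only [map_smul, smul_eq_mul] at h₄
          simp only [Matrix.mulVec, dotProduct, Pi.zero_apply]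
          rw [← h₄]
          exact Finset.sum_congr rfl fun j _ ↦ by simp [M₀, N, mul_comm]
        simpa using hc₀
      rw [h₂, finrank_bot] at h₁
      have h₃ := Submodule.finrank_add_eq_of_isCompl hC
      have h₄ := hrank t
      omega
  have hvan (t : k) (ht₀ : t ≠ 0) (ht : (M₀ + t • N).det ≠ 0) : Q.eval t = 0 := by
    let p : V := (M₀ + t • N).det • u -
      t • ∑ j, ((M₀ + t • N).adjugate.mulVec w) j • (b j : V)
    have hp : p ∈ (S + t • T).orthogonal C := by
      apply hb
      intro i
      have h₁ : (M₀ + t • N).mulVec ((M₀ + t • N).adjugate.mulVec w) i =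
          (M₀ + t • N).det * w i := by
        rw [Matrix.mulVec_mulVec, Matrix.mul_adjugate]
        simp [Matrix.smul_mulVec]
      have h₂ : S (b i) u = 0 := hS.isRefl _ _ (by rw [LinearMap.mem_ker.mp hu]; rfl)
      have h₃ : (S + t • T) (b i) (∑ j, ((M₀ + t • N).adjugate.mulVec w) j • (b j : V)) =
          (M₀ + t • N).det * w i := by
        rw [← h₁, map_sum]
        conv_rhs => rw [Matrix.mulVec, dotProduct]
        exact Finset.sum_congr rfl fun j _ ↦ by simp [M₀, N, mul_comm]
      have h₄ : (S + t • T) (b i) u = t * w i := by simp [h₂, w]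
      simp only [p, map_sub, map_smul, h₃, h₄, smul_eq_mul]
      ring
    rw [hker t ht] at hp
    have := hf t ht₀ p hp
    simpa [p, hQ] using this
  have hzero : Q * (M.det * X) = 0 := by
    apply Polynomial.funext
    intro t
    rw [eval_mul, eval_mul, eval_X, eval_zero, hMdet]
    by_cases ht₀ : t = 0
    · simp [ht₀]
    by_cases ht : (M₀ + t • N).det = 0
    · simp [ht]
    · simp [hvan t ht₀ ht]
  have hMdet₀ : M.det ≠ 0 := fun h ↦ hdet₀ (by simpa [h] using (hMdet 0).symm)
  have hQ₀ : Q = 0 := (mul_eq_zero.mp hzero).resolve_right (mul_ne_zero hMdet₀ X_ne_zero)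
  have := hQ 0
  rw [hQ₀] at this
  simpa [hdet₀] using this

/-- For a two-dimensional space `Φ` of alternating forms whose nonzero members all have corank `r`,
the sum of the kernels of the nonzero members has dimension `(dim V + r) / 2`. -/
theorem LinearMap.BilinForm.two_mul_finrank_iSup_ker {k V E : Type*} [Field k]
    [IsAlgClosed k] [AddCommGroup V] [Module k V] [Module.Finite k V]
    [AddCommGroup E] [Module k E] (hE : Module.finrank k E = 2)
    (Φ : E →ₗ[k] BilinForm k V) (halt : ∀ c, (Φ c).IsAlt) (r : ℕ)
    (hr : ∀ c, c ≠ 0 → Module.finrank k (LinearMap.ker (Φ c)) = r) :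
    2 * Module.finrank k ↥(⨆ (c : E) (_ : c ≠ 0), LinearMap.ker (Φ c)) =
      Module.finrank k V + r := by
  have : Module.Finite k E := Module.finite_of_finrank_pos (by omega)
  have : Infinite k := IsAlgClosed.instInfinite
  set W := ⨆ (c : E) (_ : c ≠ 0), LinearMap.ker (Φ c)
  have hKW {c : E} (hc : c ≠ 0) : LinearMap.ker (Φ c) ≤ W :=
    le_iSup₂ (f := fun (c : E) (_ : c ≠ 0) ↦ LinearMap.ker (Φ c)) c hc
  have hrefl (c : E) : (Φ c).IsRefl := (halt c).isRefl
  have hcomb {s c : E} (hs : s ≠ 0) (hc : c ∉ Submodule.span k {s}) (d : E) :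
      ∃ α β : k, α • s + β • c = d := by
    have hli : LinearIndependent k ![s, c] := by
      rw [LinearIndependent.pair_iff' hs]
      exact fun a ha ↦ hc (ha ▸ Submodule.smul_mem _ _ (Submodule.mem_span_singleton_self s))
    have := hli.span_eq_top_of_card_eq_finrank' (by simp [hE])
    rw [Matrix.range_cons_cons_empty] at this
    exact Submodule.mem_span_pair.mp (this ▸ Submodule.mem_top)
  have hindep {s : E} (hs : s ≠ 0) : ∃ e : E, e ∉ Submodule.span k {s} := by
    by_contra! h
    have := finrank_span_singleton (K := k) hs
    rw [Submodule.eq_top_iff'.mpr h, finrank_top] at this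
    omega
  have hvan {s : E} (hs : s ≠ 0) (f : Module.Dual k V)
      (hf : ∀ c, c ∉ Submodule.span k {s} → ∀ v ∈ LinearMap.ker (Φ c), f v = 0) :
      W ≤ LinearMap.ker f := by
    obtain ⟨e, he⟩ := hindep hs
    refine iSup₂_le fun c hc ↦ ?_
    intro v hv
    by_cases hcs : c ∈ Submodule.span k {s}
    · have hec {t : k} (ht : t ≠ 0) : c + t • e ∉ Submodule.span k {s} := fun h ↦ he <| by
        rw [Submodule.add_mem_iff_right _ hcs] at h
        exact (Submodule.smul_mem_iff _ ht).mp h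
      refine apply_eq_zero_of_forall_ker_add_smul (halt c) (halt e) (fun t ↦ ?_) f
        (fun t ht w hw ↦ ?_) hv
      · rw [← map_smul, ← map_add, hr c hc, hr]
        by_cases ht : t = 0
        · simpa [ht]
        · intro h
          exact hec ht (h ▸ Submodule.zero_mem _)
      · rw [← map_smul, ← map_add] at hw
        exact hf _ (hec ht) w hw
    · exact hf c hcs v hv
  have horth {s : E} (hs : s ≠ 0) {u : V} (hu : ∀ w ∈ W, Φ s u w = 0) (d : E) {w : V}
      (hw : w ∈ W) : Φ d u w = 0 := by
    refine hvan hs (Φ d u) (fun c hc v hv ↦ ?_) hw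
    obtain ⟨α, β, rfl⟩ := hcomb hs hc d
    have h₁ : Φ c u v = 0 := hrefl c _ _ (by rw [LinearMap.mem_ker.mp hv]; rfl)
    have h₂ : Φ s u v = 0 := hu v (hKW (ne_of_mem_of_not_mem (Submodule.zero_mem _) hc).symm hv)
    simp [h₁, h₂]
  obtain ⟨s, hs⟩ : ∃ s : E, s ≠ 0 := by
    have : Nontrivial E := Module.nontrivial_of_finrank_pos (R := k) (by omega)
    exact exists_ne 0
  obtain ⟨e, he⟩ := hindep hs
  set U := (Φ s).orthogonal W with hU
  have hUd (d : E) {u w : V} (hu : u ∈ U) (hw : w ∈ W) : Φ d u w = 0 :=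
    horth hs (fun w hw ↦ hrefl s _ _ (hu w hw)) d hw
  have hUorth {d : E} (hd : d ≠ 0) : (Φ d).orthogonal W = U := by
    apply le_antisymm
    · exact fun u hu w hw ↦ hrefl s _ _ (horth hd (fun w hw ↦ hrefl d _ _ (hu w hw)) s hw)
    · exact fun u hu w hw ↦ hrefl d _ _ (hUd d hu hw)
  have hWU : W ≤ U := by
    refine iSup₂_le fun c hc v hv ↦ ?_
    rw [← hUorth hc]
    exact fun w _ ↦ hrefl c _ _ (by rw [LinearMap.mem_ker.mp hv]; rfl)
  have hdim {d : E} (hd : d ≠ 0) {X : Submodule k V} (hX : W ≤ X) :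
      Module.finrank k X + Module.finrank k ((Φ d).orthogonal X) = Module.finrank k V + r := by
    rw [LinearMap.BilinForm.finrank_add_finrank_orthogonal',
      inf_eq_right.mpr ((hKW hd).trans hX), hr d hd]
  have hUU {d : E} (hd : d ≠ 0) : (Φ d).orthogonal U = W := by
    symm
    apply Submodule.eq_of_le_of_finrank_eq
    · exact fun w hw u hu ↦ hUd d hu hw
    · have h₁ := hdim hd hWU
      have h₂ := hdim hd le_rfl
      rw [hUorth hd] at h₂
      omega
  suffices hUW : U ≤ W by
    have h := hdim hs le_rfl
    rw [← hU, le_antisymm hUW hWU] at h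
    omega
  obtain ⟨C', hC'⟩ := Submodule.exists_isCompl W
  let C := C' ⊓ U
  have hsup : W ⊔ C = U := by
    rw [← sup_inf_assoc_of_le _ hWU, hC'.sup_eq_top, top_inf_eq]
  have hinj {d : E} (hd : d ≠ 0) : LinearMap.ker ((Φ d).restrict C) = ⊥ := by
    rw [eq_bot_iff]
    rintro ⟨x, hx⟩ hx'
    have : x ∈ (Φ d).orthogonal U := by
      rw [← hsup]
      intro y hy
      obtain ⟨w, hw, c, hc, rfl⟩ := Submodule.mem_sup.mp hy
      apply hrefl d
      have h₁ : Φ d x c = 0 := LinearMap.congr_fun (LinearMap.mem_ker.mp hx') ⟨c, hc⟩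
      rw [map_add, hUd d hx.2 hw, h₁, add_zero]
    rw [hUU hd] at this
    have := Submodule.disjoint_def.mp hC'.disjoint x this hx.1
    simpa using this
  have hCbot : C = ⊥ := by
    by_contra hne
    have : Nontrivial C := Submodule.nontrivial_iff_ne_bot.mpr hne
    let φ := LinearMap.linearEquivOfInjective ((Φ s).restrict C)
      (LinearMap.ker_eq_bot.mp (hinj hs)) Subspace.dual_finrank_eq.symm
    obtain ⟨μ, hμ⟩ := Module.End.exists_eigenvalue
      (φ.symm.toLinearMap ∘ₗ (Φ e).restrict C : Module.End k C)
    obtain ⟨v, hv⟩ := hμ.exists_hasEigenvector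
    apply hv.2
    have hv₁ : (Φ e).restrict C v = μ • (Φ s).restrict C v := by
      have h := congrArg φ hv.apply_eq_smul
      simpa [φ] using h
    have hne : e - μ • s ≠ 0 := fun h ↦ he <| by
      rw [sub_eq_zero.mp h]
      exact Submodule.smul_mem _ _ (Submodule.mem_span_singleton_self s)
    have : v ∈ LinearMap.ker ((Φ (e - μ • s)).restrict C) := by
      ext c
      have h := LinearMap.congr_fun hv₁ c
      simp only [LinearMap.BilinForm.restrict_apply, LinearMap.domRestrict_apply,
        LinearMap.smul_apply] at h
      simpa [sub_eq_zero] using h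
    rwa [hinj hne] at this
  rw [← hsup, hCbot, sup_bot_eq]

/-- An element of a semisimple derived algebra which is orthogonal to the derived algebra with
respect to the Killing form of the whole Lie algebra vanishes. -/
theorem LieAlgebra.eq_zero_of_killingForm_eq_zero_of_mem {k L : Type*} [Field k] [CharZero k]
    [LieRing L] [LieAlgebra k L] [Module.Finite k L] (I : LieIdeal k L)
    [LieAlgebra.HasTrivialRadical k I] {d : L} (hd : d ∈ I)
    (h : ∀ v ∈ I, killingForm k L d v = 0) : d = 0 := by
  have h₀ : (⟨d, hd⟩ : I) ∈ LinearMap.ker (killingForm k I) := by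
    rw [LinearMap.mem_ker, LieIdeal.killingForm_eq]
    ext ⟨v, hv⟩
    exact h v hv
  rw [LieAlgebra.IsKilling.ker_killingForm_eq_bot] at h₀
  simpa using h₀

/- `g` is a finite-dimensional reductive Lie algebra over an algebraically closed field of
characteristic zero: `g = z(g) ⊕ [g,g]` with `[g,g]` semisimple.  `H` is a Cartan
subalgebra, so `rk(g) = dim H`.  The centralizer of `x` is `ker (ad x)`, and
`V′_{x,y} = ∑_{(a,b) ≠ (0,0)} g^{ax+by}`.  The conclusion `dim V′_{x,y} = (dim g + rk g)/2`
is stated as `2 * dim V′_{x,y} = dim g + rk g`. -/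
theorem stmt3 (k : Type) [Field k] [IsAlgClosed k] [CharZero k]
    (L : Type) [LieRing L] [LieAlgebra k L] [Module.Finite k L]
    (hred : IsCompl (LieAlgebra.center k L).toSubmodule
      (LieAlgebra.derivedSeries k L 1).toSubmodule)
    (hss : LieAlgebra.IsSemisimple k ↥(LieAlgebra.derivedSeries k L 1))
    (H : LieSubalgebra k L) (hH : H.IsCartanSubalgebra)
    (x y : L)
    (hspan : Module.finrank k ↥(Submodule.span k {x, y}) = 2)
    (hreg : ∀ z ∈ Submodule.span k {x, y}, z ≠ 0 →
      Module.finrank k ↥(LinearMap.ker (LieAlgebra.ad k L z)) = Module.finrank k ↥H) :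
    2 * Module.finrank k
        ↥(⨆ (c : k × k) (_ : c ≠ 0),
          LinearMap.ker (LieAlgebra.ad k L (c.1 • x + c.2 • y))) =
      Module.finrank k L + Module.finrank k ↥H := by
  let z : k × k →ₗ[k] L :=
    (LinearMap.fst k k k).smulRight x + (LinearMap.snd k k k).smulRight y
  let Φ : k × k →ₗ[k] BilinForm k L :=
    LinearMap.llcomp k L L (Module.Dual k L) (killingForm k L) ∘ₗ
      (LieAlgebra.ad k L : L →ₗ[k] Module.End k L) ∘ₗ z
  have hz (c : k × k) : z c = c.1 • x + c.2 • y := rfl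
  have hΦ (c : k × k) (u v : L) : Φ c u v = killingForm k L ⁅z c, u⁆ v := rfl
  have hker (c : k × k) : LinearMap.ker (Φ c) = LinearMap.ker (LieAlgebra.ad k L (z c)) := by
    ext u
    simp only [LinearMap.mem_ker, LieAlgebra.ad_apply]
    refine ⟨fun h ↦ ?_, fun h ↦ by ext v; simp [hΦ, h]⟩
    refine LieAlgebra.eq_zero_of_killingForm_eq_zero_of_mem (LieAlgebra.derivedSeries k L 1) ?_
      fun v _ ↦ by rw [← hΦ, h]; rfl
    exact LieSubmodule.lie_mem_lie (LieSubmodule.mem_top _) (LieSubmodule.mem_top _)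
  have hz₀ {c : k × k} (hc : c ≠ 0) : z c ≠ 0 := by
    have hli : LinearIndependent k ![x, y] := by
      rw [linearIndependent_iff_card_eq_finrank_span, Set.finrank,
        Matrix.range_cons_cons_empty, hspan, Fintype.card_fin]
    intro h
    obtain ⟨h₁, h₂⟩ := LinearIndependent.pair_iff.mp hli c.1 c.2 h
    exact hc (Prod.ext h₁ h₂)
  have hmain := LinearMap.BilinForm.two_mul_finrank_iSup_ker (by simp) Φ
    (fun c u ↦ by rw [hΦ, LieModule.traceForm_apply_lie_apply, lie_self, map_zero])
    (Module.finrank k H) fun c hc ↦ by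
      rw [hker]
      exact hreg _ (Submodule.mem_span_pair.mpr ⟨c.1, c.2, rfl⟩) (hz₀ hc)
  have hsup : (⨆ (c : k × k) (_ : c ≠ 0), LinearMap.ker (Φ c)) =
      ⨆ (c : k × k) (_ : c ≠ 0), LinearMap.ker (LieAlgebra.ad k L (c.1 • x + c.2 • y)) :=
    iSup_congr fun c ↦ iSup_congr fun _ ↦ hker c
  rwa [hsup] at hmain
end

section
/- For every (x,y) ∈ Ω(g), the subspace [x, V′_{x,y}] := span{[x,v] : v ∈ V′_{x,y}} is the orthogonal complement of V′_{x,y} in g with respect to ⟨·,·⟩; in particular V′_{x,y} is orthogonal to [x, V′_{x,y}] and dim V′_{x,y} + dim [x, V′_{x,y}] = dim g. -/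
open Module in
/-- If the rank of the pencil `A + t • B` is nowhere larger than at `t = 0`, then a vector lying in
the range of every `A + t • B` with `t ≠ 0` lies in the range of `A`. -/
theorem LinearMap.mem_range_of_forall_mem_range_add_smul {k V W : Type*} [Field k] [Infinite k]
    [AddCommGroup V] [Module k V] [AddCommGroup W] [Module k W] [FiniteDimensional k W]
    (A B : V →ₗ[k] W) (u : W)
    (hr : ∀ t : k, t ≠ 0 → finrank k (range (A + t • B)) ≤ finrank k (range A))
    (hu : ∀ t : k, t ≠ 0 → u ∈ range (A + t • B)) : u ∈ range A := by
  by_contra hmem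
  obtain ⟨σ, hσ⟩ := A.rangeRestrict.exists_rightInverse_of_surjective A.range_rangeRestrict
  have hσA (a : range A) : A (σ a) = a := congrArg Subtype.val (LinearMap.congr_fun hσ a)
  let F₀ : (range A × k) →ₗ[k] W := (range A).subtype.coprod (LinearMap.toSpanSingleton k W u)
  have hF₀ : ker F₀ = ⊥ := by
    rw [ker_eq_bot']
    rintro ⟨a, s⟩ h
    have h' : (a : W) + s • u = 0 := by simpa [F₀] using h
    have hs : s = 0 := by
      by_contra hs
      refine hmem ?_
      have : u = -(s⁻¹ • (a : W)) := by
        rw [eq_neg_of_add_eq_zero_left h', smul_neg, smul_smul, inv_mul_cancel₀ hs, one_smul,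
          neg_neg]
      rw [this]
      exact (range A).neg_mem ((range A).smul_mem _ a.2)
    subst hs
    simpa using h'
  obtain ⟨G, hG⟩ := F₀.exists_leftInverse_of_injective hF₀
  let C : (range A × k) →ₗ[k] W := (B ∘ₗ σ) ∘ₗ LinearMap.fst k _ _
  let N : End k (range A × k) := G ∘ₗ C
  obtain ⟨m, hm⟩ := ((Module.End.finite_hasEigenvalue N).union (Set.finite_singleton 0)).exists_notMem
  simp only [Set.mem_union, Set.mem_singleton_iff, not_or] at hm
  obtain ⟨hmN, hm0⟩ := hm
  have ht : -m⁻¹ ≠ 0 := by simpa using hm0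
  set t := -m⁻¹ with htdef
  have hinj : Function.Injective (F₀ + t • C) := by
    rw [← ker_eq_bot, ker_eq_bot']
    intro p hp
    by_contra hp0
    refine hmN (Module.End.hasEigenvalue_of_hasEigenvector (x := p) ⟨?_, hp0⟩)
    rw [Module.End.mem_eigenspace_iff]
    have h1 : p + t • N p = 0 := by
      have := congrArg G hp
      have h2 : G (F₀ p) = p := LinearMap.congr_fun hG p
      simpa [N, h2] using this
    have h2 : p = m⁻¹ • N p := by
      rwa [htdef, neg_smul, ← sub_eq_add_neg, sub_eq_zero] at h1
    exact (eq_inv_smul_iff₀ hm0).1 h2 |>.symm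
  have hle : range (F₀ + t • C) ≤ range (A + t • B) := by
    rintro _ ⟨⟨a, s⟩, rfl⟩
    have : (F₀ + t • C) (a, s) = (A + t • B) (σ a) + s • u := by
      simp [F₀, C, hσA]; abel
    rw [this]
    exact add_mem ⟨_, rfl⟩ (Submodule.smul_mem _ _ (hu t ht))
  have h1 := Submodule.finrank_mono hle
  rw [finrank_range_of_inj hinj, finrank_prod, finrank_self] at h1
  have := hr t ht
  omega

section SkewPencil

open Module LinearMap

variable {k V : Type*} [Field k] [AddCommGroup V] [Module k V]

/-- The sum of the kernels of all nonzero members of the pencil spanned by `A` and `B`. -/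
def pencilKernel (A B : End k V) : Submodule k V :=
  ⨆ (c : k × k) (_ : c ≠ 0), ker (c.1 • A + c.2 • B)

variable {A B : End k V} {Φ : LinearMap.BilinForm k V}

theorem ker_le_pencilKernel {c : k × k} (hc : c ≠ 0) :
    ker (c.1 • A + c.2 • B) ≤ pencilKernel A B :=
  le_iSup₂_of_le c hc le_rfl

theorem skew_pencil (hA : ∀ u v, Φ (A u) v = -Φ u (A v)) (hB : ∀ u v, Φ (B u) v = -Φ u (B v))
    (c : k × k) (u v : V) :
    Φ ((c.1 • A + c.2 • B) u) v = -Φ u ((c.1 • A + c.2 • B) v) := by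
  simp [hA, hB]; ring

variable [FiniteDimensional k V]

theorem LinearMap.range_eq_orthogonal_ker_of_skew (hΦ : Φ.Nondegenerate)
    (hA : ∀ u v, Φ (A u) v = -Φ u (A v)) : range A = Φ.orthogonal (ker A) := by
  refine Submodule.eq_of_le_of_finrank_eq ?_ ?_
  · rintro _ ⟨w, rfl⟩ v hv
    have := hA v w
    rw [mem_ker.1 hv] at this
    simpa using this.symm
  · rw [LinearMap.BilinForm.finrank_orthogonal hΦ]
    have := A.finrank_range_add_finrank_ker
    omega

/-- For a skew pencil of constant rank, the kernels of the members not proportional to a given one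
already span the sum of all kernels. -/
theorem pencilKernel_le_iSup_of_constant_rank [Infinite k] (hΦ : Φ.Nondegenerate)
    (hs : ∀ u v, Φ u v = Φ v u) (hA : ∀ u v, Φ (A u) v = -Φ u (A v))
    (hB : ∀ u v, Φ (B u) v = -Φ u (B v)) {r : ℕ}
    (hr : ∀ c : k × k, c ≠ 0 → finrank k (ker (c.1 • A + c.2 • B)) = r)
    {c : k × k} (hc : c ≠ 0) :
    pencilKernel A B ≤
      ⨆ (e : k × k) (_ : c.1 * e.2 - c.2 * e.1 ≠ 0), ker (e.1 • A + e.2 • B) := by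
  have hrefl : Φ.IsRefl := fun u v h => by rw [hs, h]
  refine iSup₂_le fun e he => ?_
  by_cases hce : c.1 * e.2 - c.2 * e.1 = 0
  swap
  · exact le_iSup₂_of_le e hce le_rfl
  obtain ⟨d, hd⟩ : ∃ d : k × k, c.1 * d.2 - c.2 * d.1 ≠ 0 := by
    by_cases h : c.1 = 0
    · refine ⟨(1, 0), fun h2 => hc (Prod.ext h (by simpa using h2))⟩
    · exact ⟨(0, 1), by simpa using h⟩
  set W₀ := ⨆ (e : k × k) (_ : c.1 * e.2 - c.2 * e.1 ≠ 0), ker (e.1 • A + e.2 • B)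
  have hW₀ (f : k × k) (hf : c.1 * f.2 - c.2 * f.1 ≠ 0) : ker (f.1 • A + f.2 • B) ≤ W₀ :=
    le_iSup₂_of_le f hf le_rfl
  clear_value W₀
  have hadd (t : k) : e.1 • A + e.2 • B + t • (d.1 • A + d.2 • B) =
      (e + t • d).1 • A + (e + t • d).2 • B := by
    simp only [Prod.fst_add, Prod.snd_add, Prod.smul_fst, Prod.smul_snd, smul_eq_mul]
    module
  have hdet (t : k) (ht : t ≠ 0) : c.1 * (e + t • d).2 - c.2 * (e + t • d).1 ≠ 0 := by
    have : c.1 * (e + t • d).2 - c.2 * (e + t • d).1 = t * (c.1 * d.2 - c.2 * d.1) := by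
      simp only [Prod.fst_add, Prod.snd_add, Prod.smul_fst, Prod.smul_snd, smul_eq_mul]
      linear_combination hce
    rw [this]
    exact mul_ne_zero ht hd
  have hle : Φ.orthogonal W₀ ≤ Φ.orthogonal (ker (e.1 • A + e.2 • B)) := by
    intro u hu
    rw [← range_eq_orthogonal_ker_of_skew hΦ (skew_pencil hA hB e)]
    refine mem_range_of_forall_mem_range_add_smul _ (d.1 • A + d.2 • B) u ?_ ?_
    · intro t ht
      rw [hadd]
      have h1 := hr e he
      have h2 := hr (e + t • d) (fun h => hdet t ht (by rw [h]; simp))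
      have h3 := (e.1 • A + e.2 • B).finrank_range_add_finrank_ker
      have h4 := ((e + t • d).1 • A + (e + t • d).2 • B).finrank_range_add_finrank_ker
      omega
    · intro t ht
      rw [hadd, range_eq_orthogonal_ker_of_skew hΦ (skew_pencil hA hB _)]
      exact LinearMap.BilinForm.orthogonal_le (hW₀ _ (hdet t ht)) hu
  have := LinearMap.BilinForm.orthogonal_le (B := Φ) hle
  rwa [LinearMap.BilinForm.orthogonal_orthogonal hΦ hrefl,
    LinearMap.BilinForm.orthogonal_orthogonal hΦ hrefl] at this

theorem pencilKernel_isotropic [Infinite k] (hΦ : Φ.Nondegenerate)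
    (hs : ∀ u v, Φ u v = Φ v u) (hA : ∀ u v, Φ (A u) v = -Φ u (A v))
    (hB : ∀ u v, Φ (B u) v = -Φ u (B v)) {r : ℕ}
    (hr : ∀ c : k × k, c ≠ 0 → finrank k (ker (c.1 • A + c.2 • B)) = r)
    {v w : V} (hv : v ∈ pencilKernel A B) (hw : w ∈ pencilKernel A B) : Φ v (A w) = 0 := by
  suffices h : pencilKernel A B ≤ ker (Φ.flip (A w)) from h hv
  refine iSup₂_le fun e he v hv => ?_
  suffices h : (⨆ (f : k × k) (_ : e.1 * f.2 - e.2 * f.1 ≠ 0), ker (f.1 • A + f.2 • B)) ≤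
      ker (Φ v ∘ₗ A) from
    h (pencilKernel_le_iSup_of_constant_rank hΦ hs hA hB hr he hw)
  refine iSup₂_le fun f hf w hw => ?_
  have hv' : Φ v (e.1 • A w + e.2 • B w) = 0 := by
    have := skew_pencil hA hB e v w
    rwa [mem_ker.1 hv, map_zero, LinearMap.zero_apply, zero_eq_neg] at this
  have hw' : f.1 • A w + f.2 • B w = 0 := by simpa using hw
  have hw'' : Φ v (f.1 • A w + f.2 • B w) = 0 := by rw [hw', map_zero]
  simp only [map_add, map_smul, smul_eq_mul] at hv' hw''
  refine (mul_eq_zero.1 ?_).resolve_left hf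
  simp only [coe_comp, Function.comp_apply]
  linear_combination f.2 * hv' - e.2 * hw''

theorem map_pencilKernel_le_map [Infinite k] (hΦ : Φ.Nondegenerate)
    (hs : ∀ u v, Φ u v = Φ v u) (hA : ∀ u v, Φ (A u) v = -Φ u (A v))
    (hB : ∀ u v, Φ (B u) v = -Φ u (B v)) {r : ℕ}
    (hr : ∀ c : k × k, c ≠ 0 → finrank k (ker (c.1 • A + c.2 • B)) = r)
    {c : k × k} (hc : c ≠ 0) (d : k × k) :
    (pencilKernel A B).map (d.1 • A + d.2 • B) ≤ (pencilKernel A B).map (c.1 • A + c.2 • B) := by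
  rw [Submodule.map_le_iff_le_comap]
  refine (pencilKernel_le_iSup_of_constant_rank hΦ hs hA hB hr hc).trans
    (iSup₂_le fun e he w hw => ?_)
  have he0 : e ≠ 0 := fun h => he (by simp [h])
  refine ⟨((c.1 * e.2 - c.2 * e.1)⁻¹ * (d.1 * e.2 - d.2 * e.1)) • w,
    Submodule.smul_mem _ _ (ker_le_pencilKernel he0 hw), ?_⟩
  have hw' : e.1 • A w + e.2 • B w = 0 := by simpa using hw
  have key : (d.1 * e.2 - d.2 * e.1) • (c.1 • A w + c.2 • B w) =
      (c.1 * e.2 - c.2 * e.1) • (d.1 • A w + d.2 • B w) := by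
    have : (d.1 * e.2 - d.2 * e.1) • (c.1 • A w + c.2 • B w) -
      (c.1 * e.2 - c.2 * e.1) • (d.1 • A w + d.2 • B w) =
        (d.1 * c.2 - c.1 * d.2) • (e.1 • A w + e.2 • B w) := by module
    rwa [hw', smul_zero, sub_eq_zero] at this
  simp only [map_smul, LinearMap.add_apply, LinearMap.smul_apply, mul_smul]
  rw [key, inv_smul_smul₀ he]

/-- For a skew pencil of constant rank over an algebraically closed field, the sum `W` of the
kernels of its nonzero members satisfies `A W = Wᗮ`. -/
theorem map_pencilKernel_eq_orthogonal [IsAlgClosed k] (hΦ : Φ.Nondegenerate)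
    (hs : ∀ u v, Φ u v = Φ v u) (hA : ∀ u v, Φ (A u) v = -Φ u (A v))
    (hB : ∀ u v, Φ (B u) v = -Φ u (B v)) {r : ℕ}
    (hr : ∀ c : k × k, c ≠ 0 → finrank k (ker (c.1 • A + c.2 • B)) = r) :
    (pencilKernel A B).map A = Φ.orthogonal (pencilKernel A B) := by
  have : Infinite k := IsAlgClosed.instInfinite
  have h10 : ((1, 0) : k × k) ≠ 0 := by simp
  have hmap {c : k × k} (hc : c ≠ 0) (d : k × k) :=
    map_pencilKernel_le_map hΦ hs hA hB hr hc d
  have hBA : (pencilKernel A B).map B ≤ (pencilKernel A B).map A := by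
    simpa using hmap h10 (0, 1)
  have hkerA : ker A ≤ pencilKernel A B := by
    simpa using ker_le_pencilKernel (A := A) (B := B) h10
  set W := pencilKernel A B
  set W' := (Φ.orthogonal W).comap A
  have hrange : Φ.orthogonal W ≤ range A := by
    rw [range_eq_orthogonal_ker_of_skew hΦ hA]
    exact LinearMap.BilinForm.orthogonal_le hkerA
  have hBW' : ∀ w ∈ W', B w ∈ Φ.orthogonal W := by
    intro w hw v hv
    obtain ⟨v', hv', hvv'⟩ := hBA (Submodule.mem_map_of_mem hv)
    have h1 : Φ v' (A w) = 0 := hw v' hv'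
    have h2 := hA v' w
    have h3 := hB v w
    rw [hvv', h3, h1, neg_zero, neg_eq_zero] at h2
    exact h2
  suffices hle : W' ≤ W by
    refine le_antisymm ?_ fun u hu => ?_
    · rintro _ ⟨w, hw, rfl⟩ v hv
      exact pencilKernel_isotropic hΦ hs hA hB hr hv hw
    · obtain ⟨w, rfl⟩ := hrange hu
      exact ⟨w, hle hu, rfl⟩
  let A' : W' →ₗ[k] Φ.orthogonal W := A.restrict fun w hw => hw
  let B' : W' →ₗ[k] Φ.orthogonal W := B.restrict hBW'
  have hA' : Function.Surjective A' := by
    rintro ⟨u, hu⟩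
    obtain ⟨w, rfl⟩ := hrange hu
    exact ⟨⟨w, hu⟩, rfl⟩
  obtain ⟨T, hT⟩ := Module.projective_lifting_property A' B' hA'
  have hAT (w : W') : A (T w) = B w := congrArg Subtype.val (LinearMap.congr_fun hT w)
  have hTW : W.comap W'.subtype ≤ (W.comap W'.subtype).comap T := by
    intro w hw
    obtain ⟨v, hv, hvw⟩ := hBA (Submodule.mem_map_of_mem (p := W) hw)
    rw [Submodule.subtype_apply, ← hAT] at hvw
    have : (T w : V) - v ∈ W := hkerA (by simp [hvw])
    simpa using W.add_mem this hv
  by_contra hle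
  have : Nontrivial (W' ⧸ W.comap W'.subtype) := by
    rw [Submodule.Quotient.nontrivial_iff]
    simpa [Submodule.comap_subtype_eq_top] using hle
  obtain ⟨μ, hμ⟩ := Module.End.exists_eigenvalue ((W.comap W'.subtype).mapQ _ T hTW)
  obtain ⟨q, hq, hq0⟩ := hμ.exists_hasEigenvector
  obtain ⟨w, rfl⟩ := Submodule.Quotient.mk_surjective _ q
  refine hq0 ((Submodule.Quotient.mk_eq_zero _).2 ?_)
  have hmem : (T w : V) - μ • (w : V) ∈ W := by
    rw [Module.End.mem_eigenspace_iff, Submodule.mapQ_apply, ← Submodule.Quotient.mk_smul,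
      Submodule.Quotient.eq] at hq
    exact hq
  have hc : ((-μ, 1) : k × k) ≠ 0 := by simp
  obtain ⟨v, hv, hvw⟩ := hmap hc (1, 0) (Submodule.mem_map_of_mem hmem)
  have hsub : (w : V) - v ∈ W := by
    refine ker_le_pencilKernel hc ?_
    simp only [map_sub, mem_ker, hvw]
    simp [hAT]
    module
  simpa using W.add_mem hsub hv

end SkewPencil


/- `g` is a finite-dimensional reductive Lie algebra over an algebraically closed field of
characteristic zero (`g = z(g) ⊕ [g,g]` with `[g,g]` semisimple), equipped with a
nondegenerate symmetric invariant bilinear form `Φ` extending the Killing form of `[g,g]`.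
`H` is a Cartan subalgebra.  For `(x,y) ∈ Ω(g)` (the span of `x,y` is 2-dimensional and
all its nonzero elements are regular), `V′ = V′_{x,y}` is the sum of the centralizers
`g^{ax+by}`, `(a,b) ≠ (0,0)`, and `[x,V′] = (ad x)(V′)` is its orthogonal complement;
in particular `V′ ⊥ [x,V′]` and `dim V′ + dim [x,V′] = dim g`. -/
theorem stmt4 (k : Type) [Field k] [IsAlgClosed k] [CharZero k]
    (L : Type) [LieRing L] [LieAlgebra k L] [Module.Finite k L]
    (hred : IsCompl (LieAlgebra.center k L).toSubmodule
      (LieAlgebra.derivedSeries k L 1).toSubmodule)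
    (hss : LieAlgebra.IsSemisimple k ↥(LieAlgebra.derivedSeries k L 1))
    (Φ : LinearMap.BilinForm k L)
    (hΦnd : Φ.Nondegenerate)
    (hΦsymm : ∀ u v : L, Φ u v = Φ v u)
    (hΦinv : ∀ u v w : L, Φ ⁅u, v⁆ w = Φ u ⁅v, w⁆)
    (hΦext : ∀ u v : ↥(LieAlgebra.derivedSeries k L 1),
      Φ ↑u ↑v = killingForm k ↥(LieAlgebra.derivedSeries k L 1) u v)
    (H : LieSubalgebra k L) (hH : H.IsCartanSubalgebra)
    (x y : L)
    (hspan : Module.finrank k ↥(Submodule.span k {x, y}) = 2)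
    (hreg : ∀ z ∈ Submodule.span k {x, y}, z ≠ 0 →
      Module.finrank k ↥(LinearMap.ker (LieAlgebra.ad k L z)) = Module.finrank k ↥H)
    (V' : Submodule k L)
    (hV' : V' = ⨆ (c : k × k) (_ : c ≠ 0),
      LinearMap.ker (LieAlgebra.ad k L (c.1 • x + c.2 • y))) :
    Submodule.map (LieAlgebra.ad k L x) V' = LinearMap.BilinForm.orthogonal Φ V' ∧
    (∀ v ∈ V', ∀ w ∈ Submodule.map (LieAlgebra.ad k L x) V', Φ v w = 0) ∧
    Module.finrank k ↥V' + Module.finrank k ↥(Submodule.map (LieAlgebra.ad k L x) V') =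
      Module.finrank k L := by
  have hskew (z u v : L) : Φ (LieAlgebra.ad k L z u) v = -Φ u (LieAlgebra.ad k L z v) := by
    rw [LieAlgebra.ad_apply, LieAlgebra.ad_apply, ← lie_skew, map_neg, LinearMap.neg_apply, hΦinv]
  have hpencil (c : k × k) : LieAlgebra.ad k L (c.1 • x + c.2 • y) =
      c.1 • LieAlgebra.ad k L x + c.2 • LieAlgebra.ad k L y := by simp
  have hind : LinearIndependent k ![x, y] := by
    rw [linearIndependent_iff_card_eq_finrank_span, Set.finrank, Matrix.range_cons,
      Matrix.range_cons, Matrix.range_empty, Set.union_empty, Set.singleton_union, hspan]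
    simp
  have hr (c : k × k) (hc : c ≠ 0) : Module.finrank k
      (LinearMap.ker (c.1 • LieAlgebra.ad k L x + c.2 • LieAlgebra.ad k L y)) =
        Module.finrank k H := by
    rw [← hpencil]
    refine hreg _ (Submodule.mem_span_pair.2 ⟨c.1, c.2, rfl⟩) fun h => hc ?_
    exact Prod.ext_iff.2 (LinearIndependent.pair_iff.1 hind _ _ h)
  have hV : V' = pencilKernel (LieAlgebra.ad k L x) (LieAlgebra.ad k L y) := by
    simp only [hV', hpencil, pencilKernel]
  have hmain : Submodule.map (LieAlgebra.ad k L x) V' = LinearMap.BilinForm.orthogonal Φ V' := by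
    rw [hV]
    exact map_pencilKernel_eq_orthogonal hΦnd hΦsymm (hskew x) (hskew y) hr
  refine ⟨hmain, fun v hv w hw => ?_, ?_⟩
  · rw [hmain] at hw
    exact hw v hv
  · rw [hmain, LinearMap.BilinForm.finrank_orthogonal hΦnd]
    have := Submodule.finrank_le V'
    omega
end

section
/- For every φ in the characteristic module B(g) and for every pair (x,y) ∈ g×g, the vector φ(x,y) is orthogonal to [x,y], i.e. ⟨φ(x,y), [x,y]⟩ = 0. -/
/-- The algebra `k[V]` of polynomial functions on a vector space `V`: the subalgebra of
functions `V → k` generated by the linear forms. -/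
def polyFun (k : Type) [Field k] (V : Type) [AddCommGroup V] [Module k V] :
    Subalgebra k (V → k) :=
  Algebra.adjoin k (Set.range fun φ : Module.Dual k V => ⇑φ)

/-- `k[V] ⊗ W`, the space of polynomial maps `V → W`. -/
def polyMap (k : Type) [Field k] (V : Type) [AddCommGroup V] [Module k V]
    (W : Type) [AddCommGroup W] [Module k W] : Submodule k (V → W) :=
  Submodule.span k {f | ∃ p ∈ polyFun k V, ∃ w : W, f = fun v => p v • w}

/-- A subset `U` of `V` is (Zariski-)dense iff every polynomial function vanishing
on `U` vanishes identically. -/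
def IsPolyDense (k : Type) [Field k] (V : Type) [AddCommGroup V] [Module k V]
    (U : Set V) : Prop :=
  ∀ p ∈ polyFun k V, (∀ v ∈ U, p v = 0) → p = 0

/-- `V′_{x,y}`: the sum of the centralizers `g^{ax+by}`, `(a,b) ∈ k² \ {0}`. -/
def Vprime (k : Type) [Field k] (L : Type) [LieRing L] [LieAlgebra k L]
    (z : L × L) : Submodule k L :=
  ⨆ (c : k × k) (_ : c ≠ 0), LinearMap.ker (LieAlgebra.ad k L (c.1 • z.1 + c.2 • z.2))

/-- The characteristic module `B(g)` of `g`, as a subset of the polynomial maps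
`g × g → g`. -/
def charSet (k : Type) [Field k] (L : Type) [LieRing L] [LieAlgebra k L] :
    Set ((L × L) → L) :=
  {φ | φ ∈ polyMap k (L × L) L ∧
    ∃ U : Set (L × L), IsPolyDense k (L × L) U ∧ ∀ z ∈ U, φ z ∈ Vprime k L z}

theorem linearForm_mem_polyFun {k V : Type} [Field k] [AddCommGroup V] [Module k V]
    (f : Module.Dual k V) : (⇑f : V → k) ∈ polyFun k V :=
  Algebra.subset_adjoin ⟨f, rfl⟩

/-- A bilinear form on a finite-dimensional space is a polynomial function on the square. -/
theorem bilin_mem_polyFun {k V : Type} [Field k] [AddCommGroup V] [Module k V]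
    [Module.Finite k V] (B : LinearMap.BilinForm k V) :
    (fun z : V × V => B z.1 z.2) ∈ polyFun k (V × V) := by
  let b := Module.finBasis k V
  have h : (fun z : V × V => B z.1 z.2) =
      ∑ i, (⇑((B.flip (b i)).comp (LinearMap.fst k V V)) : V × V → k) *
        ⇑((b.coord i).comp (LinearMap.snd k V V)) := by
    funext z
    calc B z.1 z.2 = B z.1 (∑ i, b.repr z.2 i • b i) := by rw [b.sum_repr]
      _ = _ := by simp [-Module.Basis.sum_repr, mul_comm]
  rw [h]
  exact sum_mem fun i _ => mul_mem (linearForm_mem_polyFun _) (linearForm_mem_polyFun _)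

section InvariantForm

variable {k L : Type} [Field k] [LieRing L] [LieAlgebra k L] (Φ : LinearMap.BilinForm k L)

theorem pairing_bracket_mem_polyFun [Module.Finite k L] {φ : L × L → L}
    (hφ : φ ∈ polyMap k (L × L) L) :
    (fun z : L × L => Φ (φ z) ⁅z.1, z.2⁆) ∈ polyFun k (L × L) := by
  induction hφ using Submodule.span_induction with
  | mem f hf =>
    obtain ⟨p, hp, w, rfl⟩ := hf
    have hB := bilin_mem_polyFun ((LieModule.toEnd k L L : L →ₗ[k] Module.End k L).compr₂ (Φ w))
    convert mul_mem hp hB using 1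
    funext z
    simp
  | zero =>
    convert zero_mem (polyFun k (L × L)) using 1
    funext z
    simp
  | add f g _ _ hf hg =>
    convert add_mem hf hg using 1
    funext z
    simp
  | smul c f _ hf =>
    convert (polyFun k (L × L)).smul_mem hf c using 1
    funext z
    simp

theorem orthogonal_bracket_of_mem_Vprime
    (hΦinv : ∀ u v w : L, Φ ⁅u, v⁆ w = Φ u ⁅v, w⁆) {z : L × L} {v : L}
    (hv : v ∈ Vprime k L z) : Φ v ⁅z.1, z.2⁆ = 0 := by
  suffices h : Vprime k L z ≤ LinearMap.ker (Φ.flip ⁅z.1, z.2⁆) by simpa using h hv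
  refine iSup₂_le fun c hc w hw => ?_
  simp only [LinearMap.mem_ker, LieAlgebra.ad_apply] at hw ⊢
  have hw' : ⁅w, c.1 • z.1 + c.2 • z.2⁆ = 0 := by rw [← lie_skew, hw, neg_zero]
  have key (u : L) : Φ w ⁅c.1 • z.1 + c.2 • z.2, u⁆ = 0 := by rw [← hΦinv, hw']; simp
  have h₁ : c.1 * Φ w ⁅z.1, z.2⁆ = 0 := by simpa using key z.2
  have h₂ : c.2 * Φ w ⁅z.1, z.2⁆ = 0 := by
    have := key z.1
    rw [add_lie, smul_lie, smul_lie, lie_self, ← lie_skew z.2 z.1, smul_zero,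
      zero_add, map_smul, map_neg, smul_eq_mul, mul_neg, neg_eq_zero] at this
    exact this
  by_contra hne
  exact hc (Prod.ext ((mul_eq_zero.1 h₁).resolve_right hne) ((mul_eq_zero.1 h₂).resolve_right hne))

end InvariantForm

/- For every `φ` in the characteristic module `B(g)` and every `(x,y) ∈ g × g`,
`⟨φ(x,y), [x,y]⟩ = 0`. -/
theorem stmt6 (k : Type) [Field k] [IsAlgClosed k] [CharZero k]
    (L : Type) [LieRing L] [LieAlgebra k L] [Module.Finite k L]
    (hred : IsCompl (LieAlgebra.center k L).toSubmodule
      (LieAlgebra.derivedSeries k L 1).toSubmodule)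
    (hss : LieAlgebra.IsSemisimple k ↥(LieAlgebra.derivedSeries k L 1))
    (Φ : LinearMap.BilinForm k L)
    (hΦnd : Φ.Nondegenerate)
    (hΦsymm : ∀ u v : L, Φ u v = Φ v u)
    (hΦinv : ∀ u v w : L, Φ ⁅u, v⁆ w = Φ u ⁅v, w⁆)
    (hΦext : ∀ u v : ↥(LieAlgebra.derivedSeries k L 1),
      Φ ↑u ↑v = killingForm k ↥(LieAlgebra.derivedSeries k L 1) u v) :
    ∀ φ ∈ charSet k L, ∀ x y : L, Φ (φ (x, y)) ⁅x, y⁆ = 0 := by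
  rintro φ ⟨hφ, U, hU, hφU⟩ x y
  exact congrFun (hU _ (pairing_bracket_mem_polyFun Φ hφ)
    fun z hz => orthogonal_bracket_of_mem_Vprime Φ hΦinv (hφU z hz)) (x, y)
end

section
/- Let C(g) be the orthogonal complement of B(g) in k[g×g] ⊗_k g (the set of all ψ such that ⟨ψ(x,y), φ(x,y)⟩ = 0 for every φ ∈ B(g) and every (x,y) ∈ g×g). Then the orthogonal complement of C(g) in k[g×g] ⊗_k g is equal to B(g). -/
/-- The orthogonal complement `C(g)` of `B(g)` in `k[g×g] ⊗ g`. -/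
def orthSet (k : Type) [Field k] (L : Type) [LieRing L] [LieAlgebra k L]
    (Φ : LinearMap.BilinForm k L) : Set ((L × L) → L) :=
  {ψ | ψ ∈ polyMap k (L × L) L ∧
    ∀ φ ∈ charSet k L, ∀ z : L × L, Φ (ψ z) (φ z) = 0}

section PointLifting

/-- An injective homomorphism of finitely generated algebras over an algebraically closed field,
with source a domain, induces on rational points a map whose image contains a nonempty basic
open set. -/
theorem exists_ne_zero_forall_exists_comp_eq {k A S : Type} [Field k] [IsAlgClosed k]
    [CommRing A] [IsDomain A] [Algebra k A] [Algebra.FiniteType k A]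
    [CommRing S] [Algebra k S] [Algebra.FiniteType k S]
    (g : A →ₐ[k] S) (hg : Function.Injective g) :
    ∃ f : A, f ≠ 0 ∧ ∀ x : A →ₐ[k] k, x f ≠ 0 → ∃ y : S →ₐ[k] k, y.comp g = x := by
  have : IsNoetherianRing A := Algebra.FiniteType.isNoetherianRing k A
  have hgft : (g : A →+* S).FiniteType := by
    refine RingHom.FiniteType.of_comp_finiteType (f := algebraMap k A) ?_
    have : (g : A →+* S).comp (algebraMap k A) = algebraMap k S := by ext; simp
    rw [this]
    exact RingHom.finiteType_algebraMap.mpr inferInstance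
  have hgfp := RingHom.FinitePresentation.of_finiteType.mp hgft
  obtain ⟨C, hC⟩ := PrimeSpectrum.exists_constructibleSetData_iff.mpr
    (PrimeSpectrum.isConstructible_range_comap hgfp)
  have hbot : (⊥ : PrimeSpectrum A) ∈ C.toSet := by
    rw [hC]
    obtain ⟨q, hq, hqc⟩ := Ideal.exists_comap_eq_of_mem_minimalPrimes_of_injective
      (f := (g : A →+* S)) hg ⊥ (by simp [IsDomain.minimalPrimes_eq_singleton_bot])
    exact ⟨⟨q, hq⟩, PrimeSpectrum.ext hqc⟩
  simp only [PrimeSpectrum.ConstructibleSetData.toSet, Set.mem_iUnion] at hbot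
  obtain ⟨D, hD, hbD⟩ := hbot
  have hbD1 : ∀ i, D.g i = 0 := fun i => by
    simpa using hbD.1 ⟨i, rfl⟩
  have hbD2 : D.f ≠ 0 := by
    simpa [PrimeSpectrum.mem_zeroLocus] using hbD.2
  refine ⟨D.f, hbD2, fun x hx => ?_⟩
  let m : PrimeSpectrum A := ⟨RingHom.ker x, RingHom.ker_isPrime x⟩
  have hm : m ∈ Set.range (PrimeSpectrum.comap (g : A →+* S)) := by
    rw [← hC]
    simp only [PrimeSpectrum.ConstructibleSetData.toSet, Set.mem_iUnion]
    refine ⟨D, hD, ?_, ?_⟩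
    · rintro _ ⟨i, rfl⟩
      simp [hbD1]
    · simpa [PrimeSpectrum.mem_zeroLocus, m] using hx
  obtain ⟨q, hq⟩ := hm
  obtain ⟨M, hM, hqM⟩ := q.asIdeal.exists_le_maximal q.isPrime.ne_top
  let := Ideal.Quotient.field M
  have : Algebra.FiniteType k (S ⧸ M) :=
    Algebra.FiniteType.of_surjective (Ideal.Quotient.mkₐ k M) (Ideal.Quotient.mkₐ_surjective k M)
  have : Module.Finite k (S ⧸ M) := finite_of_finite_type_of_isJacobsonRing k (S ⧸ M)
  have hbij := IsAlgClosed.algebraMap_bijective_of_isIntegral (k := k) (K := S ⧸ M)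
  let e : k ≃ₐ[k] (S ⧸ M) := AlgEquiv.ofBijective (Algebra.ofId k (S ⧸ M)) hbij
  refine ⟨(e.symm : (S ⧸ M) →ₐ[k] k).comp (Ideal.Quotient.mkₐ k M), ?_⟩
  ext a
  have ha : a - algebraMap k A (x a) ∈ m.asIdeal := by simp [m, RingHom.mem_ker]
  rw [← hq] at ha
  have ha' : g (a - algebraMap k A (x a)) ∈ M := hqM ha
  have h0 : Ideal.Quotient.mkₐ k M (g (a - algebraMap k A (x a))) = 0 :=
    Ideal.Quotient.eq_zero_iff_mem.mpr ha'
  have h1 : (e.symm : (S ⧸ M) →ₐ[k] k)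
      (Ideal.Quotient.mkₐ k M (g (a - algebraMap k A (x a)))) = 0 := by
    rw [h0, map_zero]
  rw [map_sub, map_sub, map_sub, sub_eq_zero] at h1
  rw [AlgHom.comp_apply, AlgHom.comp_apply, h1]
  simp

/-- A version of `exists_ne_zero_forall_exists_comp_eq` for the points of a closed subscheme. -/
theorem exists_ne_zero_forall_exists_comp_eq_of_ideal {k A T : Type} [Field k] [IsAlgClosed k]
    [CommRing A] [IsDomain A] [Algebra k A] [Algebra.FiniteType k A]
    [CommRing T] [Algebra k T] [Algebra.FiniteType k T]
    (c : A →ₐ[k] T) (I : Ideal T) (hI : ∀ a, c a ∈ I → a = 0) :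
    ∃ f : A, f ≠ 0 ∧ ∀ x : A →ₐ[k] k, x f ≠ 0 →
      ∃ y : T →ₐ[k] k, (∀ e ∈ I, y e = 0) ∧ ∀ a, y (c a) = x a := by
  have : Algebra.FiniteType k (T ⧸ I) :=
    Algebra.FiniteType.of_surjective (Ideal.Quotient.mkₐ k I) (Ideal.Quotient.mkₐ_surjective k I)
  obtain ⟨f, hf, h⟩ := exists_ne_zero_forall_exists_comp_eq ((Ideal.Quotient.mkₐ k I).comp c)
    ((injective_iff_map_eq_zero _).mpr fun a ha => hI a (Ideal.Quotient.eq_zero_iff_mem.mp ha))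
  refine ⟨f, hf, fun x hx => ?_⟩
  obtain ⟨y, hy⟩ := h x hx
  refine ⟨y.comp (Ideal.Quotient.mkₐ k I), fun e he => ?_, fun a => DFunLike.congr_fun hy a⟩
  rw [AlgHom.comp_apply, Ideal.Quotient.mkₐ_eq_mk, Ideal.Quotient.eq_zero_iff_mem.mpr he, map_zero]

end PointLifting

section PolyFun

variable {k : Type} [Field k] {V W : Type} [AddCommGroup V] [Module k V]
  [AddCommGroup W] [Module k W]

theorem dual_mem_polyFun (l : Module.Dual k V) : ⇑l ∈ polyFun k V :=
  Algebra.subset_adjoin ⟨l, rfl⟩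

/-- Precomposition with a linear map preserves polynomial functions. -/
theorem comp_mem_polyFun (l : V →ₗ[k] W) {p : W → k} (hp : p ∈ polyFun k W) :
    (fun v => p (l v)) ∈ polyFun k V := by
  induction hp using Algebra.adjoin_induction with
  | mem x hx =>
    obtain ⟨m, rfl⟩ := hx
    exact dual_mem_polyFun (m.comp l)
  | algebraMap r => exact (polyFun k V).algebraMap_mem r
  | add x y _ _ hx hy => exact (polyFun k V).add_mem hx hy
  | mul x y _ _ hx hy => exact (polyFun k V).mul_mem hx hy

/-- The restriction of a polynomial function to a line is a polynomial. -/
theorem exists_polynomial_eval_eq_of_mem_polyFun {p : V → k} (hp : p ∈ polyFun k V) (u w : V) :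
    ∃ P : Polynomial k, ∀ t : k, P.eval t = p (u + t • w) := by
  induction hp using Algebra.adjoin_induction with
  | mem x hx =>
    obtain ⟨m, rfl⟩ := hx
    exact ⟨Polynomial.C (m u) + Polynomial.X * Polynomial.C (m w), fun t => by simp; ring⟩
  | algebraMap r => exact ⟨Polynomial.C r, fun t => by simp⟩
  | add x y _ _ hx hy =>
    obtain ⟨P, hP⟩ := hx
    obtain ⟨Q, hQ⟩ := hy
    exact ⟨P + Q, fun t => by simp [hP, hQ]⟩
  | mul x y _ _ hx hy =>
    obtain ⟨P, hP⟩ := hx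
    obtain ⟨Q, hQ⟩ := hy
    exact ⟨P * Q, fun t => by simp [hP, hQ]⟩

instance isDomain_polyFun [Infinite k] : IsDomain (polyFun k V) := by
  have : NoZeroDivisors (polyFun k V) := by
    refine ⟨fun {f g} hfg => ?_⟩
    by_contra! h
    obtain ⟨u, hu⟩ : ∃ u, f.1 u ≠ 0 := by
      by_contra! h0
      exact h.1 (Subtype.ext (funext h0))
    obtain ⟨w, hw⟩ : ∃ w, g.1 w ≠ 0 := by
      by_contra! h0
      exact h.2 (Subtype.ext (funext h0))
    obtain ⟨P, hP⟩ := exists_polynomial_eval_eq_of_mem_polyFun f.2 u (w - u)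
    obtain ⟨Q, hQ⟩ := exists_polynomial_eval_eq_of_mem_polyFun g.2 u (w - u)
    have hPQ : P * Q = 0 := Polynomial.funext fun t => by
      rw [Polynomial.eval_mul, hP, hQ]
      simpa using congrFun (congrArg Subtype.val hfg) (u + t • (w - u))
    rcases mul_eq_zero.mp hPQ with h0 | h0
    · apply hu
      simpa [h0] using (hP 0).symm
    · apply hw
      simpa [h0] using (hQ 1).symm
  exact NoZeroDivisors.to_isDomain _

instance finiteType_polyFun [Module.Finite k V] : Algebra.FiniteType k (polyFun k V) := by
  let b := Module.finBasis k V
  have h : polyFun k V = Algebra.adjoin k (Set.range fun i => ⇑(b.coord i)) := by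
    refine le_antisymm (Algebra.adjoin_le ?_) (Algebra.adjoin_mono ?_)
    · rintro _ ⟨l, rfl⟩
      have : ⇑l = ∑ i, l (b i) • ⇑(b.coord i) := by
        ext v
        conv_lhs => rw [← b.sum_repr v, map_sum]
        simp [mul_comm]
      change ⇑l ∈ _
      rw [this]
      exact Subalgebra.sum_mem _ fun i _ =>
        Subalgebra.smul_mem _ (Algebra.subset_adjoin (Set.mem_range_self i)) _
    · rintro _ ⟨i, rfl⟩
      exact ⟨b.coord i, rfl⟩
  have hfg : (polyFun k V).FG := by
    rw [h]
    exact Subalgebra.fg_def.mpr ⟨_, Set.finite_range _, rfl⟩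
  exact (polyFun k V).fg_iff_finiteType.mp hfg

/-- Evaluation of polynomial functions at a point. -/
def evalPolyFun (v : V) : polyFun k V →ₐ[k] k :=
  (Pi.evalAlgHom k (fun _ : V => k) v).comp (polyFun k V).val

@[simp]
theorem evalPolyFun_apply (v : V) (p : polyFun k V) : evalPolyFun v p = p.1 v := rfl

theorem exists_eq_evalPolyFun [Module.Finite k V] (y : polyFun k V →ₐ[k] k) :
    ∃ v : V, y = evalPolyFun v := by
  let d : Module.Dual k (Module.Dual k V) :=
    { toFun := fun l => y ⟨l, dual_mem_polyFun l⟩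
      map_add' := fun l m => by rw [← map_add]; rfl
      map_smul' := fun c l => by rw [RingHom.id_apply, ← map_smul]; rfl }
  refine ⟨(Module.evalEquiv k V).symm d, ?_⟩
  ext ⟨p, hp⟩
  rw [evalPolyFun_apply]
  dsimp only
  induction hp using Algebra.adjoin_induction with
  | mem x hx =>
    obtain ⟨m, rfl⟩ := hx
    change d m = _
    simp
  | algebraMap r => exact y.commutes r
  | add p q hp hq h₁ h₂ =>
    rw [Pi.add_apply, ← h₁, ← h₂, ← map_add]
    rfl
  | mul p q hp hq h₁ h₂ =>
    rw [Pi.mul_apply, ← h₁, ← h₂, ← map_mul]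
    rfl

/-- The homomorphism of algebras of polynomial functions given by precomposition with a
linear map. -/
def polyFunComap (l : V →ₗ[k] W) : polyFun k W →ₐ[k] polyFun k V where
  toFun p := ⟨fun v => p.1 (l v), comp_mem_polyFun l p.2⟩
  map_one' := rfl
  map_mul' _ _ := rfl
  map_zero' := rfl
  map_add' _ _ := rfl
  commutes' _ := rfl

/-- If the projection to `V` of a Zariski-closed subset of `V × W` is dense, then it contains a
nonempty basic open set. -/
theorem exists_ne_zero_forall_exists_of_isPolyDense [IsAlgClosed k] [Module.Finite k V]
    [Module.Finite k W] (E : Set (V × W → k)) (hE : E ⊆ polyFun k (V × W))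
    (hU : IsPolyDense k V {v | ∃ w, ∀ e ∈ E, e (v, w) = 0}) :
    ∃ f ∈ polyFun k V, f ≠ 0 ∧ ∀ v, f v ≠ 0 → ∃ w, ∀ e ∈ E, e (v, w) = 0 := by
  have : Infinite k := IsAlgClosed.instInfinite
  let I : Ideal (polyFun k (V × W)) := Ideal.span {e | e.1 ∈ E}
  have hI : ∀ p, polyFunComap (LinearMap.fst k V W) p ∈ I → p = 0 := by
    intro p hp
    refine Subtype.ext (hU p.1 p.2 ?_)
    rintro v ⟨w, hw⟩
    have hle : I ≤ RingHom.ker (evalPolyFun (k := k) (v, w)) :=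
      Ideal.span_le.mpr fun e he => hw e.1 he
    exact hle hp
  obtain ⟨f, hf, h⟩ := exists_ne_zero_forall_exists_comp_eq_of_ideal _ I hI
  refine ⟨f.1, f.2, fun h0 => hf (Subtype.ext h0), fun v hv => ?_⟩
  obtain ⟨y, hy, hyc⟩ := h (evalPolyFun v) hv
  obtain ⟨⟨v', w⟩, rfl⟩ := exists_eq_evalPolyFun y
  have hvv : v' = v := by
    rw [← sub_eq_zero, ← Module.forall_dual_apply_eq_zero_iff k]
    intro l
    rw [map_sub, sub_eq_zero]
    exact hyc ⟨l, dual_mem_polyFun l⟩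
  subst hvv
  exact ⟨w, fun e he => hy ⟨e, hE he⟩ (Ideal.subset_span he)⟩

end PolyFun

section Saturated

/-- A vector outside a saturated submodule of a finite free module over a domain is separated from
it by a linear functional. -/
theorem exists_sum_mul_ne_zero_of_notMem {A ι : Type*} [CommRing A] [IsDomain A] [Fintype ι]
    (N : Submodule A (ι → A)) (hN : ∀ a : A, a ≠ 0 → ∀ m, a • m ∈ N → m ∈ N)
    {v : ι → A} (hv : v ∉ N) :
    ∃ w : ι → A, (∀ m ∈ N, ∑ i, w i * m i = 0) ∧ ∑ i, w i * v i ≠ 0 := by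
  classical
  let K := FractionRing A
  let j : (ι → A) → (ι → K) := fun m i => algebraMap A K (m i)
  have hspan : ∀ u ∈ Submodule.span K (j '' N), ∃ a : A, a ≠ 0 ∧ ∃ m ∈ N,
      algebraMap A K a • u = j m := by
    intro u hu
    induction hu using Submodule.span_induction with
    | mem x hx =>
      obtain ⟨m, hm, rfl⟩ := hx
      exact ⟨1, one_ne_zero, m, hm, by simp⟩
    | zero => exact ⟨1, one_ne_zero, 0, N.zero_mem, by ext; simp [j]⟩
    | add x y _ _ hx hy =>
      obtain ⟨a, ha, m, hm, ham⟩ := hx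
      obtain ⟨b, hb, n, hn, hbn⟩ := hy
      refine ⟨a * b, mul_ne_zero ha hb, b • m + a • n,
        N.add_mem (N.smul_mem _ hm) (N.smul_mem _ hn), ?_⟩
      ext i
      have h1 := congrFun ham i
      have h2 := congrFun hbn i
      simp only [Pi.smul_apply, smul_eq_mul, j] at h1 h2
      simp only [Pi.smul_apply, Pi.add_apply, smul_eq_mul, map_mul, map_add, j, ← h1, ← h2]
      ring
    | smul c x _ hx =>
      obtain ⟨a, ha, m, hm, ham⟩ := hx
      obtain ⟨p, q, hq, hpq⟩ := IsFractionRing.div_surjective (A := A) c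
      have hq0 : q ≠ 0 := nonZeroDivisors.ne_zero hq
      have hq1 : algebraMap A K q ≠ 0 := by
        simpa using hq0
      refine ⟨q * a, mul_ne_zero hq0 ha, p • m, N.smul_mem _ hm, ?_⟩
      ext i
      have h1 := congrFun ham i
      simp only [Pi.smul_apply, smul_eq_mul, j] at h1
      simp only [Pi.smul_apply, smul_eq_mul, map_mul, j, ← h1, ← hpq]
      rw [mul_mul_mul_comm, mul_div_cancel₀ _ hq1]
  have hjv : j v ∉ Submodule.span K (j '' N) := by
    intro h
    obtain ⟨a, ha, m, hm, ham⟩ := hspan _ h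
    refine hv (hN a ha v ?_)
    convert hm using 1
    ext i
    apply IsFractionRing.injective A K
    simpa [j] using congrFun ham i
  obtain ⟨F, hFv, hF⟩ := Submodule.exists_dual_map_eq_bot_of_notMem hjv inferInstance
  obtain ⟨b, hb⟩ := IsLocalization.exist_integer_multiples_of_finite (nonZeroDivisors A)
    (fun i => F (Pi.single i 1))
  choose w hw using hb
  have hb0 : algebraMap A K b ≠ 0 := by simp
  have key : ∀ m : ι → A, algebraMap A K (∑ i, w i * m i) = algebraMap A K b * F (j m) := by
    intro m
    have : j m = ∑ i, algebraMap A K (m i) • (Pi.single i 1 : ι → K) := by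
      ext i
      simp [j, Finset.sum_apply, Pi.single_apply, Algebra.smul_def]
    rw [this, map_sum, map_sum, Finset.mul_sum]
    refine Finset.sum_congr rfl fun i _ => ?_
    rw [map_mul, hw, map_smul, Algebra.smul_def, smul_eq_mul]
    ring
  refine ⟨w, fun m hm => ?_, fun h => ?_⟩
  · apply IsFractionRing.injective A K
    have h0 : F (j m) = 0 := by
      have : F (j m) ∈ Submodule.map F (Submodule.span K (j '' N)) :=
        Submodule.mem_map_of_mem (Submodule.subset_span ⟨m, hm, rfl⟩)
      rwa [hF, Submodule.mem_bot] at this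
    rw [key, h0, mul_zero, map_zero]
  · have h1 := key v
    rw [h, map_zero] at h1
    exact mul_ne_zero hb0 hFv h1.symm

end Saturated

section PolyMap

variable {k : Type} [Field k] {V W : Type} [AddCommGroup V] [Module k V]
  [AddCommGroup W] [Module k W]

theorem dual_comp_mem_polyFun {φ : V → W} (hφ : φ ∈ polyMap k V W) (l : Module.Dual k W) :
    (fun v => l (φ v)) ∈ polyFun k V := by
  induction hφ using Submodule.span_induction with
  | mem x hx =>
    obtain ⟨p, hp, w, rfl⟩ := hx
    have : (fun v => l (p v • w)) = l w • p := by ext; simp [mul_comm]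
    rw [this]
    exact (polyFun k V).smul_mem hp _
  | zero =>
    simp only [Pi.zero_apply, map_zero]
    exact (polyFun k V).zero_mem
  | add x y _ _ hx hy =>
    simp only [Pi.add_apply, map_add]
    exact (polyFun k V).add_mem hx hy
  | smul c x _ hx =>
    simp only [Pi.smul_apply, map_smul]
    exact (polyFun k V).smul_mem hx c

theorem sum_smul_mem_polyMap {ι : Type} [Fintype ι] (b : ι → W) (a : ι → polyFun k V) :
    (fun v => ∑ i, (a i).1 v • b i) ∈ polyMap k V W := by
  have : (fun v => ∑ i, (a i).1 v • b i) = ∑ i, fun v => (a i).1 v • b i := by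
    ext; simp
  rw [this]
  exact Submodule.sum_mem _ fun i _ => Submodule.subset_span ⟨(a i).1, (a i).2, b i, rfl⟩

/-- A bilinear form is a polynomial function. -/
theorem bilin_mem_polyFun_s8 [Module.Finite k V] (B : V →ₗ[k] W →ₗ[k] k) :
    (fun x : V × W => B x.1 x.2) ∈ polyFun k (V × W) := by
  let b := Module.finBasis k V
  have : (fun x : V × W => B x.1 x.2) =
      ∑ i, ⇑((b.coord i).comp (LinearMap.fst k V W)) * ⇑((B (b i)).comp (LinearMap.snd k V W)) := by
    ext x
    conv_lhs => rw [← b.sum_repr x.1, map_sum]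
    simp
  rw [this]
  exact Subalgebra.sum_mem _ fun i _ => mul_mem (dual_mem_polyFun _) (dual_mem_polyFun _)

theorem isPolyDense_ne_zero [Infinite k] {f : V → k} (hf : f ∈ polyFun k V) (hf0 : f ≠ 0) :
    IsPolyDense k V {v | f v ≠ 0} := by
  intro p hp h
  have hpf : (⟨p, hp⟩ : polyFun k V) * ⟨f, hf⟩ = 0 := by
    refine Subtype.ext (funext fun v => ?_)
    by_cases hv : f v = 0
    · simp [hv]
    · simp [h v hv]
  rcases mul_eq_zero.mp hpf with h0 | h0
  · exact congrArg Subtype.val h0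
  · exact absurd (congrArg Subtype.val h0) hf0

end PolyMap

section CharSet

variable {k : Type} [Field k] {L : Type} [LieRing L] [LieAlgebra k L]

/-- An element of `V′_{x,y}` is a sum of `dim L` elements, each centralizing some `ax+by` with
`(a,b)` nonzero. The nonvanishing of `(a,b)` is expressed by an equation. -/
theorem mem_Vprime_iff [Module.Finite k L] (z : L × L) (u : L) :
    u ∈ Vprime k L z ↔ ∃ w : Fin (Module.finrank k L) → (k × k) × (k × k) × L,
      (∀ i, (w i).1.1 * (w i).2.1.1 + (w i).1.2 * (w i).2.1.2 = 1 ∧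
        ⁅(w i).1.1 • z.1 + (w i).1.2 • z.2, (w i).2.2⁆ = 0) ∧ ∑ i, (w i).2.2 = u := by
  constructor
  · intro hu
    let s : Set L := {v | ∃ c : k × k, c ≠ 0 ∧ ⁅c.1 • z.1 + c.2 • z.2, v⁆ = 0}
    have hs : Vprime k L z ≤ Submodule.span k s :=
      iSup₂_le fun c hc v hv => Submodule.subset_span ⟨c, hc, hv⟩
    obtain ⟨f, hfs, hf, -⟩ := Submodule.exists_fun_fin_finrank_span_eq k s
    have hu' := hs hu
    rw [← hf, Submodule.mem_span_range_iff_exists_fun] at hu'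
    obtain ⟨a, rfl⟩ := hu'
    have hle : Module.finrank k (Submodule.span k s) ≤ Module.finrank k L :=
      Submodule.finrank_le _
    let e := Fin.castLEEmb hle
    have hex : ∀ v ∈ s, ∃ c : (k × k) × (k × k), c.1.1 * c.2.1 + c.1.2 * c.2.2 = 1 ∧
        ⁅c.1.1 • z.1 + c.1.2 • z.2, v⁆ = 0 := by
      rintro v ⟨c, hc, hv⟩
      by_cases h1 : c.1 = 0
      · have h2 : c.2 ≠ 0 := fun h2 => hc (Prod.ext h1 h2)
        exact ⟨(c, (0, c.2⁻¹)), by simp [h2], hv⟩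
      · exact ⟨(c, (c.1⁻¹, 0)), by simp [h1], hv⟩
    have hsmul : ∀ (r : k), ∀ v ∈ s, r • v ∈ s := by
      rintro r v ⟨c, hc, hv⟩
      exact ⟨c, hc, by rw [lie_smul, hv, smul_zero]⟩
    let g : Fin (Module.finrank k L) → L := Function.extend e (fun i => a i • f i) 0
    have hg : ∀ i, g i ∈ s := by
      intro i
      by_cases hi : ∃ j, e j = i
      · obtain ⟨j, rfl⟩ := hi
        simp only [g]
        rw [e.injective.extend_apply]
        exact hsmul _ _ (hfs j)
      · simp only [g]
        rw [Function.extend_apply' _ _ _ hi]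
        exact ⟨(1, 0), by simp, by simp⟩
    choose c hc using fun i => hex _ (hg i)
    refine ⟨fun i => ((c i).1, (c i).2, g i), hc, ?_⟩
    change ∑ i, g i = _
    rw [← Finset.sum_subset (Finset.subset_univ (Finset.univ.map e)), Finset.sum_map]
    · exact Finset.sum_congr rfl fun i _ => e.injective.extend_apply _ _ _
    · intro i _ hi
      exact Function.extend_apply' _ _ _ fun ⟨j, hj⟩ => hi (by simp [← hj])
  · rintro ⟨w, hw, rfl⟩
    refine Submodule.sum_mem _ fun i _ => ?_
    have hc : (w i).1 ≠ 0 := by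
      intro h
      simpa [h] using (hw i).1
    exact Submodule.mem_iSup_of_mem (w i).1 (Submodule.mem_iSup_of_mem hc (hw i).2)

/-- A polynomial map takes values in `V′_{x,y}` on a dense set if and only if it does so on a
nonempty basic open set. -/
theorem mem_charSet_iff [IsAlgClosed k] [Module.Finite k L] {φ : L × L → L} :
    φ ∈ charSet k L ↔ φ ∈ polyMap k (L × L) L ∧
      ∃ f ∈ polyFun k (L × L), f ≠ 0 ∧ ∀ z, f z ≠ 0 → φ z ∈ Vprime k L z := by
  have : Infinite k := IsAlgClosed.instInfinite
  refine and_congr_right fun hφ => ⟨?_, ?_⟩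
  · rintro ⟨U, hU, hUφ⟩
    let n := Module.finrank k L
    let W := Fin n → (k × k) × (k × k) × L
    let π (i : Fin n) : (L × L) × W →ₗ[k] (k × k) × (k × k) × L :=
      (LinearMap.proj i).comp (LinearMap.snd k _ _)
    let unit (i : Fin n) (x : (L × L) × W) : k :=
      (x.2 i).1.1 * (x.2 i).2.1.1 + (x.2 i).1.2 * (x.2 i).2.1.2 - 1
    let comm (i : Fin n) (l : Module.Dual k L) (x : (L × L) × W) : k :=
      l ⁅(x.2 i).1.1 • x.1.1 + (x.2 i).1.2 • x.1.2, (x.2 i).2.2⁆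
    let total (l : Module.Dual k L) (x : (L × L) × W) : k :=
      l (∑ i, (x.2 i).2.2) - l (φ x.1)
    let E : Set ((L × L) × W → k) := Set.range unit ∪
      Set.range (fun p : Fin n × Module.Dual k L => comm p.1 p.2) ∪ Set.range total
    have hE : ∀ z, φ z ∈ Vprime k L z ↔ ∃ w : W, ∀ e ∈ E, e (z, w) = 0 := by
      intro z
      rw [mem_Vprime_iff]
      refine exists_congr fun w => ⟨?_, ?_⟩
      · rintro ⟨h1, h2⟩ e ((⟨i, rfl⟩ | ⟨⟨i, l⟩, rfl⟩) | ⟨l, rfl⟩)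
        · exact sub_eq_zero.mpr (h1 i).1
        · simp only [comm]
          rw [(h1 i).2, map_zero]
        · simp only [total]
          rw [h2, sub_self]
      · intro h
        refine ⟨fun i => ⟨sub_eq_zero.mp (h (unit i) (Or.inl (Or.inl ⟨i, rfl⟩))), ?_⟩, ?_⟩
        · rw [← Module.forall_dual_apply_eq_zero_iff k]
          exact fun l => h (comm i l) (Or.inl (Or.inr ⟨(i, l), rfl⟩))
        · rw [← sub_eq_zero, ← Module.forall_dual_apply_eq_zero_iff k]
          intro l
          rw [map_sub]
          exact h (total l) (Or.inr ⟨l, rfl⟩)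
    have hEpoly : E ⊆ polyFun k ((L × L) × W) := by
      have hcoord (i : Fin n) (m : (k × k) × (k × k) × L →ₗ[k] k) :
          (fun x : (L × L) × W => m (x.2 i)) ∈ polyFun k ((L × L) × W) :=
        dual_mem_polyFun (m.comp (π i))
      have hbr (i : Fin n) (l : Module.Dual k L) (m : L × L →ₗ[k] L) :
          (fun x : (L × L) × W => l ⁅m x.1, (x.2 i).2.2⁆) ∈ polyFun k ((L × L) × W) :=
        comp_mem_polyFun ((m.comp (LinearMap.fst k _ _)).prod
          ((LinearMap.snd k _ _ ∘ₗ LinearMap.snd k _ _) ∘ₗ π i))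
          (bilin_mem_polyFun_s8 ((LieModule.toEnd k L L : L →ₗ[k] Module.End k L).compr₂ l))
      have ha (i : Fin n) := hcoord i (LinearMap.fst k _ _ ∘ₗ LinearMap.fst k _ _)
      have hb (i : Fin n) := hcoord i (LinearMap.snd k _ _ ∘ₗ LinearMap.fst k _ _)
      rintro e ((⟨i, rfl⟩ | ⟨⟨i, l⟩, rfl⟩) | ⟨l, rfl⟩)
      · exact sub_mem (add_mem
          (mul_mem (ha i)
            (hcoord i (LinearMap.fst k _ _ ∘ₗ LinearMap.fst k _ _ ∘ₗ LinearMap.snd k _ _)))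
          (mul_mem (hb i)
            (hcoord i (LinearMap.snd k _ _ ∘ₗ LinearMap.fst k _ _ ∘ₗ LinearMap.snd k _ _))))
          (one_mem _)
      · have : comm i l = (fun x : (L × L) × W => (x.2 i).1.1) *
              (fun x => l ⁅x.1.1, (x.2 i).2.2⁆) +
            (fun x => (x.2 i).1.2) * (fun x => l ⁅x.1.2, (x.2 i).2.2⁆) := by
          ext x
          simp [comm]
        change comm i l ∈ _
        rw [this]
        exact add_mem (mul_mem (ha i) (hbr i l (LinearMap.fst k L L)))
          (mul_mem (hb i) (hbr i l (LinearMap.snd k L L)))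
      · have : total l = (∑ i, fun x : (L × L) × W => l (x.2 i).2.2) - fun x => l (φ x.1) := by
          ext x
          simp [total]
        rw [this]
        exact sub_mem (sum_mem fun i _ =>
            hcoord i (l ∘ₗ LinearMap.snd k _ _ ∘ₗ LinearMap.snd k _ _))
          (comp_mem_polyFun (LinearMap.fst k (L × L) W) (dual_comp_mem_polyFun hφ l))
    simp only [hE]
    refine exists_ne_zero_forall_exists_of_isPolyDense E hEpoly fun p hp h => hU p hp fun v hv => ?_
    exact h v ((hE v).mp (hUφ v hv))
  · rintro ⟨f, hf, hf0, h⟩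
    exact ⟨_, isPolyDense_ne_zero hf hf0, h⟩

/-- The coordinates, with respect to a family `b` of vectors, of the elements of the characteristic
module. -/
def charSubmodule [Infinite k] {ι : Type} [Fintype ι] (b : ι → L) :
    Submodule (polyFun k (L × L)) (ι → polyFun k (L × L)) where
  carrier := {a | ∃ f : polyFun k (L × L), f ≠ 0 ∧
    ∀ z, f.1 z ≠ 0 → ∑ i, (a i).1 z • b i ∈ Vprime k L z}
  zero_mem' := ⟨1, one_ne_zero, fun z _ => by simp⟩
  add_mem' := by
    rintro a a' ⟨f, hf, h⟩ ⟨f', hf', h'⟩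
    refine ⟨f * f', mul_ne_zero hf hf', fun z hz => ?_⟩
    have := add_mem (h z (left_ne_zero_of_mul hz)) (h' z (right_ne_zero_of_mul hz))
    simpa [add_smul, Finset.sum_add_distrib] using this
  smul_mem' := by
    rintro c a ⟨f, hf, h⟩
    refine ⟨f, hf, fun z hz => ?_⟩
    have := Submodule.smul_mem _ (c.1 z) (h z hz)
    simpa [Finset.smul_sum, mul_smul] using this

theorem mem_charSubmodule_of_smul_mem [Infinite k] {ι : Type} [Fintype ι] {b : ι → L}
    {c : polyFun k (L × L)} (hc : c ≠ 0) {a : ι → polyFun k (L × L)}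
    (h : c • a ∈ charSubmodule b) : a ∈ charSubmodule b := by
  obtain ⟨f, hf, h⟩ := h
  refine ⟨f * c, mul_ne_zero hf hc, fun z hz => ?_⟩
  have hcz : c.1 z ≠ 0 := right_ne_zero_of_mul hz
  have h1 := h z (left_ne_zero_of_mul hz)
  have h2 : ∑ i, ((c • a) i).1 z • b i = c.1 z • ∑ i, (a i).1 z • b i := by
    simp [Finset.smul_sum, mul_smul]
  rw [h2] at h1
  exact (Submodule.smul_mem_iff _ hcz).mp h1

/-- For any nondegenerate symmetric bilinear form, the characteristic module is equal to its double
orthogonal complement. -/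
theorem orth_orthSet_eq_charSet [IsAlgClosed k] [Module.Finite k L]
    (Φ : LinearMap.BilinForm k L) (hnd : Φ.Nondegenerate) (hsymm : ∀ u v : L, Φ u v = Φ v u) :
    {φ | φ ∈ polyMap k (L × L) L ∧ ∀ ψ ∈ orthSet k L Φ, ∀ z : L × L, Φ (φ z) (ψ z) = 0}
      = charSet k L := by
  have : Infinite k := IsAlgClosed.instInfinite
  ext φ
  refine ⟨?_, fun hφ => ⟨hφ.1, fun ψ hψ z => by rw [hsymm]; exact hψ.2 φ hφ z⟩⟩
  rintro ⟨hφ, h⟩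
  let b := Module.finBasis k L
  let coords (χ : L × L → L) (hχ : χ ∈ polyMap k (L × L) L) (i : Fin (Module.finrank k L)) :
      polyFun k (L × L) := ⟨fun z => b.coord i (χ z), dual_comp_mem_polyFun hχ _⟩
  have hsum : ∀ χ hχ z, ∑ i, (coords χ hχ i).1 z • b i = χ z := fun χ hχ z => b.sum_repr (χ z)
  have hmem : ∀ χ hχ, χ ∈ charSet k L ↔ coords χ hχ ∈ charSubmodule (k := k) b := by
    intro χ hχ
    rw [mem_charSet_iff]
    constructor
    · rintro ⟨-, f, hf, hf0, hfz⟩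
      exact ⟨⟨f, hf⟩, fun h0 => hf0 (congrArg Subtype.val h0), fun z hz => by
        rw [hsum χ hχ]
        exact hfz z hz⟩
    · rintro ⟨f, hf0, hfz⟩
      refine ⟨hχ, f.1, f.2, fun h0 => hf0 (Subtype.ext h0), fun z hz => ?_⟩
      rw [← hsum χ hχ]
      exact hfz z hz
  rw [hmem φ hφ]
  by_contra hnot
  obtain ⟨w, hw, hwφ⟩ := exists_sum_mul_ne_zero_of_notMem (charSubmodule (k := k) b)
    (fun c hc a ha => mem_charSubmodule_of_smul_mem hc ha) hnot
  let d := Φ.dualBasis hnd b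
  let ψ : L × L → L := fun z => ∑ i, (w i).1 z • d i
  have hpair : ∀ χ hχ z, Φ (ψ z) (χ z) = (∑ i, w i * coords χ hχ i).1 z := by
    intro χ hχ z
    conv_lhs => rw [← hsum χ hχ z]
    simp [ψ, d, LinearMap.BilinForm.apply_dualBasis_left, mul_comm]
  have hψ : ψ ∈ orthSet k L Φ := by
    refine ⟨sum_smul_mem_polyMap _ _, fun χ hχ z => ?_⟩
    rw [hpair χ hχ.1, hw _ ((hmem χ hχ.1).mp hχ)]
    rfl
  refine hwφ (Subtype.ext (funext fun z => ?_))
  rw [← hpair φ hφ, hsymm]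
  exact h ψ hψ z

end CharSet

/- The orthogonal complement of `C(g)` in `k[g×g] ⊗ g` is equal to `B(g)`. -/
theorem stmt8 (k : Type) [Field k] [IsAlgClosed k] [CharZero k]
    (L : Type) [LieRing L] [LieAlgebra k L] [Module.Finite k L]
    (hred : IsCompl (LieAlgebra.center k L).toSubmodule
      (LieAlgebra.derivedSeries k L 1).toSubmodule)
    (hss : LieAlgebra.IsSemisimple k ↥(LieAlgebra.derivedSeries k L 1))
    (Φ : LinearMap.BilinForm k L)
    (hΦnd : Φ.Nondegenerate)
    (hΦsymm : ∀ u v : L, Φ u v = Φ v u)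
    (hΦinv : ∀ u v w : L, Φ ⁅u, v⁆ w = Φ u ⁅v, w⁆)
    (hΦext : ∀ u v : ↥(LieAlgebra.derivedSeries k L 1),
      Φ ↑u ↑v = killingForm k ↥(LieAlgebra.derivedSeries k L 1) u v) :
    {φ | φ ∈ polyMap k (L × L) L ∧
        ∀ ψ ∈ orthSet k L Φ, ∀ z : L × L, Φ (φ z) (ψ z) = 0}
      = charSet k L := by
  exact orth_orthSet_eq_charSet Φ hΦnd hΦsymm
end

section
/- Let E be a linear subspace of V of dimension e and let m ≥ 1 be an integer. Then the augmented complex 0 → S^m E ⊗ Λ^e E → S^m V ⊗ Λ^e E → S^{m−1} V ⊗ (Λ¹ V ∧ Λ^e E) → ⋯ → S^{m−i} V ⊗ (Λ^i V ∧ Λ^e E) → ⋯ → Λ^m V ∧ Λ^e E → 0, whose first map is induced by the inclusion S^m E ⊆ S^m V and whose other maps are induced by the differential d, is exact. -/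
open ExteriorAlgebra

section KoszulComplex

open CliffordAlgebra (contractLeft contractLeft_ι_mul)

variable {k V : Type*} [Field k] [AddCommGroup V] [Module k V]

section ExteriorAlgebra

theorem ι_mul_eq_zero_of_mem_pow_finrank [FiniteDimensional k V] {E : Submodule k V} {x : V}
    (hx : x ∈ E) {θ : ExteriorAlgebra k V} (hθ : θ ∈ (E.map (ι k)) ^ Module.finrank k E) :
    ι k x * θ = 0 := by
  have hbot : (LinearMap.range (ι k : E →ₗ[k] ExteriorAlgebra k E)) ^
      (Module.finrank k E + 1) = ⊥ := by
    have h := exteriorPower.finrank_eq k (M := E) (n := Module.finrank k E + 1)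
    rw [Nat.choose_succ_self] at h
    exact Submodule.finrank_eq_zero.mp h
  have hmap : E.map (ι k) =
      (LinearMap.range (ι k : E →ₗ[k] ExteriorAlgebra k E)).map
        (ExteriorAlgebra.map E.subtype).toLinearMap := by
    rw [← LinearMap.range_comp, ExteriorAlgebra.map_comp_ι, LinearMap.range_comp,
      Submodule.range_subtype]
  have h : ι k x * θ ∈ (E.map (ι k)) ^ (Module.finrank k E + 1) := by
    rw [pow_succ']
    exact Submodule.mul_mem_mul (Submodule.mem_map_of_mem hx) hθ
  rw [hmap, ← Submodule.map_pow, hbot, Submodule.map_bot] at h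
  exact (Submodule.mem_bot k).mp h

theorem contractLeft_eq_zero_of_mem_pow {E : Submodule k V} {φ : Module.Dual k V}
    (hφ : ∀ x ∈ E, φ x = 0) (n : ℕ) {θ : ExteriorAlgebra k V} (hθ : θ ∈ (E.map (ι k)) ^ n) :
    contractLeft φ θ = 0 := by
  induction n generalizing θ with
  | zero =>
    rw [pow_zero, Submodule.mem_one] at hθ
    obtain ⟨r, rfl⟩ := hθ
    exact CliffordAlgebra.contractLeft_algebraMap _ _ r
  | succ n ih =>
    rw [pow_succ'] at hθ
    induction hθ using Submodule.mul_induction_on' with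
    | mem_mul_mem a ha b hb =>
      obtain ⟨x, hx, rfl⟩ := ha
      rw [contractLeft_ι_mul, hφ x hx, ih hb, zero_smul, mul_zero, sub_zero]
    | add a _ b _ ha hb => rw [map_add, ha, hb, add_zero]

/-- The space `Λ^i V ∧ W` for a subspace `W` of the exterior algebra. -/
def extWedge (i : ℕ) (W : Submodule k (ExteriorAlgebra k V)) :
    Submodule k (ExteriorAlgebra k V) :=
  LinearMap.range (ι k : V →ₗ[k] ExteriorAlgebra k V) ^ i * W

variable {W : Submodule k (ExteriorAlgebra k V)} {i : ℕ}

theorem extWedge_zero : extWedge 0 W = W := by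
  rw [extWedge, pow_zero, one_mul]

theorem extWedge_succ :
    extWedge (i + 1) W = LinearMap.range (ι k : V →ₗ[k] ExteriorAlgebra k V) * extWedge i W := by
  rw [extWedge, extWedge, pow_succ', mul_assoc]

theorem ι_mul_mem_extWedge (x : V) {ω : ExteriorAlgebra k V} (hω : ω ∈ extWedge i W) :
    ι k x * ω ∈ extWedge (i + 1) W := by
  rw [extWedge_succ]
  exact Submodule.mul_mem_mul (LinearMap.mem_range_self _ x) hω

theorem extWedge_succ_le {S : Submodule k (ExteriorAlgebra k V)}
    (h : ∀ x : V, ∀ ω ∈ extWedge i W, ι k x * ω ∈ S) : extWedge (i + 1) W ≤ S := by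
  rw [extWedge_succ, Submodule.mul_le]
  rintro _ ⟨x, rfl⟩ ω hω
  exact h x ω hω

theorem ι_mul_eq_zero_of_mem_extWedge {x : V} (hx : ∀ ω ∈ W, ι k x * ω = 0)
    {ω : ExteriorAlgebra k V} (hω : ω ∈ extWedge i W) : ι k x * ω = 0 := by
  induction i generalizing ω with
  | zero => exact hx ω (by rwa [extWedge_zero] at hω)
  | succ i ih =>
    refine extWedge_succ_le (S := LinearMap.ker (LinearMap.mulLeft k (ι k x)))
      (fun y ω hω => ?_) hω
    rw [LinearMap.mem_ker, LinearMap.mulLeft_apply, ← mul_assoc,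
      eq_neg_of_add_eq_zero_left (ι_add_mul_swap x y), neg_mul, mul_assoc, ih hω, mul_zero,
      neg_zero]

theorem contractLeft_mem_extWedge {φ : Module.Dual k V} (hφ : ∀ ω ∈ W, contractLeft φ ω = 0)
    {ω : ExteriorAlgebra k V} (hω : ω ∈ extWedge (i + 1) W) :
    contractLeft φ ω ∈ extWedge i W := by
  induction i generalizing ω with
  | zero =>
    refine extWedge_succ_le (S := (extWedge 0 W).comap (contractLeft φ)) (fun y ω hω => ?_) hω
    rw [Submodule.mem_comap, contractLeft_ι_mul, hφ ω (by rwa [extWedge_zero] at hω), mul_zero,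
      sub_zero]
    exact Submodule.smul_mem _ _ hω
  | succ i ih =>
    refine extWedge_succ_le (S := (extWedge (i + 1) W).comap (contractLeft φ))
      (fun y ω hω => ?_) hω
    rw [Submodule.mem_comap, contractLeft_ι_mul]
    exact Submodule.sub_mem _ (Submodule.smul_mem _ _ hω) (ι_mul_mem_extWedge y (ih hω))

theorem sum_ι_mul_contractLeft {J : Type*} [Fintype J] (b : Module.Basis J k V) {P : V →ₗ[k] V}
    (hP : ∀ x, P (P x) = P x) (hW : ∀ x, ∀ ω ∈ W, ι k (x - P x) * ω = 0)
    (hφ : ∀ φ : Module.Dual k V, ∀ ω ∈ W, contractLeft (φ ∘ₗ P) ω = 0)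
    {ω : ExteriorAlgebra k V} (hω : ω ∈ extWedge i W) :
    ∑ j, ι k (P (b j)) * contractLeft (b.coord j ∘ₗ P) ω = (i : k) • ω := by
  induction i generalizing ω with
  | zero =>
    rw [extWedge_zero] at hω
    simp [hφ _ ω hω]
  | succ i ih =>
    have key : extWedge (i + 1) W ≤ LinearMap.eqLocus
        (∑ j, LinearMap.mulLeft k (ι k (P (b j))) ∘ₗ contractLeft (b.coord j ∘ₗ P))
        (((i + 1 : ℕ) : k) • LinearMap.id) := by
      refine extWedge_succ_le fun y ω hω => ?_
      have hy : ι k (P y) * ω = ι k y * ω := by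
        have := ι_mul_eq_zero_of_mem_extWedge (hW y) hω
        rw [map_sub, sub_mul, sub_eq_zero] at this
        exact this.symm
      have hsum : ∑ j, (b.coord j (P y)) • (ι k (P (b j)) * ω) = ι k (P y) * ω := by
        simp_rw [← smul_mul_assoc, ← map_smul, ← Finset.sum_mul, ← map_sum]
        rw [← hP y]
        simp [hP]
      have hterm : ∀ j, ι k (P (b j)) * contractLeft (b.coord j ∘ₗ P) (ι k y * ω) =
          (b.coord j (P y)) • (ι k (P (b j)) * ω) +
            ι k y * (ι k (P (b j)) * contractLeft (b.coord j ∘ₗ P) ω) := by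
        intro j
        rw [contractLeft_ι_mul, mul_sub, mul_smul_comm, ← mul_assoc (ι k y),
          eq_neg_of_add_eq_zero_left (ι_add_mul_swap y (P (b j))), neg_mul, ← sub_eq_add_neg,
          mul_assoc, LinearMap.comp_apply]
      simp only [LinearMap.mem_eqLocus, LinearMap.sum_apply, LinearMap.comp_apply,
        LinearMap.mulLeft_apply, hterm, Finset.sum_add_distrib, ← Finset.mul_sum, ih hω, hsum, hy,
        LinearMap.smul_apply, LinearMap.id_apply, mul_smul_comm]
      push_cast
      rw [add_smul, one_smul, add_comm]
    simpa using key hω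

end ExteriorAlgebra

section Operators

/-- Multiplication by the linear form on the dual space given by a vector. -/
def mulCoord (x : V) :
    (Module.Dual k V → ExteriorAlgebra k V) →ₗ[k] (Module.Dual k V → ExteriorAlgebra k V) :=
  LinearMap.pi fun ξ => ξ x • LinearMap.proj ξ

/-- Left exterior multiplication by a vector. -/
def wedge (x : V) :
    (Module.Dual k V → ExteriorAlgebra k V) →ₗ[k] (Module.Dual k V → ExteriorAlgebra k V) :=
  LinearMap.pi fun ξ => LinearMap.mulLeft k (ι k x) ∘ₗ LinearMap.proj ξ

/-- Contraction with the image under an endomorphism `P` of the Euler vector field. -/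
def eulerContraction (P : V →ₗ[k] V) :
    (Module.Dual k V → ExteriorAlgebra k V) →ₗ[k] (Module.Dual k V → ExteriorAlgebra k V) :=
  LinearMap.pi fun ξ => contractLeft (ξ ∘ₗ P) ∘ₗ LinearMap.proj ξ

variable (x : V) (P : V →ₗ[k] V) (p : Module.Dual k V → ExteriorAlgebra k V)

@[simp]
theorem mulCoord_apply (ξ : Module.Dual k V) : mulCoord x p ξ = ξ x • p ξ := rfl

@[simp]
theorem wedge_apply (ξ : Module.Dual k V) : wedge x p ξ = ι k x * p ξ := rfl

@[simp]
theorem eulerContraction_apply (ξ : Module.Dual k V) :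
    eulerContraction P p ξ = contractLeft (ξ ∘ₗ P) (p ξ) := rfl

theorem mulCoord_add (y : V) : mulCoord (x + y) p = mulCoord x p + mulCoord y p := by
  ext1 ξ
  simp [add_smul]

theorem eulerContraction_mulCoord :
    eulerContraction P (mulCoord x p) = mulCoord x (eulerContraction P p) := by
  ext1 ξ
  simp

theorem eulerContraction_wedge :
    eulerContraction P (wedge x p) = mulCoord (P x) p - wedge x (eulerContraction P p) := by
  ext1 ξ
  exact contractLeft_ι_mul (ξ ∘ₗ P) x (p ξ)

theorem eulerContraction_const {J : Type*} [Fintype J] (b : Module.Basis J k V)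
    (hP : ∀ x, P (P x) = P x) (ω : ExteriorAlgebra k V) :
    eulerContraction P (Function.const _ ω) =
      ∑ j, mulCoord (P (b j)) (Function.const _ (contractLeft (b.coord j ∘ₗ P) ω)) := by
  ext1 ξ
  have h : ξ ∘ₗ P = ∑ j, ξ (P (b j)) • (b.coord j ∘ₗ P) := by
    ext y
    have hy : P y = P (∑ j, b.coord j (P y) • b j) := by
      simp only [Module.Basis.coord_apply, b.sum_repr, hP]
    rw [LinearMap.comp_apply, hy]
    simp only [map_sum, map_smul, LinearMap.sum_apply, LinearMap.smul_apply, smul_eq_mul,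
      LinearMap.comp_apply, mul_comm]
  simp only [eulerContraction_apply, Function.const_apply, Finset.sum_apply, mulCoord_apply]
  rw [h, map_sum, LinearMap.sum_apply]
  simp

end Operators

section PolynomialForms

/-- The space `S^n V ⊗ W` of homogeneous polynomial functions of degree `n` with values in `W`. -/
def polyForms (n : ℕ) (W : Submodule k (ExteriorAlgebra k V)) :
    Submodule k (Module.Dual k V → ExteriorAlgebra k V) :=
  Submodule.span k {f | ∃ (v : Fin n → V) (ω : ExteriorAlgebra k V), ω ∈ W ∧
    f = fun ξ => (∏ l, ξ (v l)) • ω}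

variable {W W' : Submodule k (ExteriorAlgebra k V)} {n : ℕ}
  {S : Submodule k (Module.Dual k V → ExteriorAlgebra k V)}

theorem mulCoord_prod (x : V) (v : Fin n → V) (ω : ExteriorAlgebra k V) :
    mulCoord x (fun ξ => (∏ l, ξ (v l)) • ω) =
      fun ξ => (∏ l, ξ ((Fin.cons x v : Fin (n + 1) → V) l)) • ω := by
  ext1 ξ
  simp [Fin.prod_univ_succ, mul_smul]

theorem polyForms_zero_le (h : ∀ ω ∈ W, Function.const _ ω ∈ S) : polyForms 0 W ≤ S := by
  refine Submodule.span_le.mpr ?_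
  rintro _ ⟨v, ω, hω, rfl⟩
  simp only [Finset.univ_eq_empty, Finset.prod_empty, one_smul]
  exact h ω hω

theorem polyForms_succ_le (h : ∀ x : V, ∀ p ∈ polyForms n W, mulCoord x p ∈ S) :
    polyForms (n + 1) W ≤ S := by
  refine Submodule.span_le.mpr ?_
  rintro _ ⟨v, ω, hω, rfl⟩
  have := h (v 0) _ (Submodule.subset_span ⟨Fin.tail v, ω, hω, rfl⟩)
  rwa [mulCoord_prod, Fin.cons_self_tail] at this

theorem const_mem_polyForms {ω : ExteriorAlgebra k V} (hω : ω ∈ W) :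
    Function.const _ ω ∈ polyForms 0 W :=
  Submodule.subset_span ⟨Fin.elim0, ω, hω, by ext1; simp⟩

theorem mulCoord_mem_polyForms (x : V) {p : Module.Dual k V → ExteriorAlgebra k V}
    (hp : p ∈ polyForms n W) : mulCoord x p ∈ polyForms (n + 1) W := by
  suffices h : polyForms n W ≤ (polyForms (n + 1) W).comap (mulCoord x) from h hp
  refine Submodule.span_le.mpr ?_
  rintro _ ⟨v, ω, hω, rfl⟩
  exact Submodule.subset_span ⟨_, ω, hω, mulCoord_prod x v ω⟩

theorem polyForms_bot : polyForms n (⊥ : Submodule k (ExteriorAlgebra k V)) = ⊥ := by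
  refine eq_bot_iff.mpr (Submodule.span_le.mpr ?_)
  rintro _ ⟨v, ω, hω, rfl⟩
  rw [(Submodule.mem_bot k).mp hω]
  ext1
  simp

theorem wedge_mem_polyForms {x : V} (h : ∀ ω ∈ W, ι k x * ω ∈ W')
    {p : Module.Dual k V → ExteriorAlgebra k V} (hp : p ∈ polyForms n W) :
    wedge x p ∈ polyForms n W' := by
  suffices h : polyForms n W ≤ (polyForms n W').comap (wedge x) from h hp
  refine Submodule.span_le.mpr ?_
  rintro _ ⟨v, ω, hω, rfl⟩
  exact Submodule.subset_span ⟨v, _, h ω hω, by ext1; simp⟩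

theorem eulerContraction_mem_polyForms [FiniteDimensional k V] {P : V →ₗ[k] V}
    (hP : ∀ x, P (P x) = P x)
    (h : ∀ φ : Module.Dual k V, ∀ ω ∈ W, contractLeft (φ ∘ₗ P) ω ∈ W')
    {p : Module.Dual k V → ExteriorAlgebra k V} (hp : p ∈ polyForms n W) :
    eulerContraction P p ∈ polyForms (n + 1) W' := by
  induction n generalizing p with
  | zero =>
    refine polyForms_zero_le (S := (polyForms (0 + 1) W').comap (eulerContraction P))
      (fun ω hω => ?_) hp
    rw [Submodule.mem_comap, eulerContraction_const P (Module.finBasis k V) hP]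
    exact Submodule.sum_mem _ fun j _ =>
      mulCoord_mem_polyForms _ (const_mem_polyForms (h _ ω hω))
  | succ n ih =>
    refine polyForms_succ_le (S := (polyForms (n + 1 + 1) W').comap (eulerContraction P))
      (fun x p hp => ?_) hp
    rw [Submodule.mem_comap, eulerContraction_mulCoord]
    exact mulCoord_mem_polyForms x (ih hp)

/-- `IsBihomogeneous E F W a c p` says that `p` is a product of `a` linear forms, of which
`a - c` come from `E` and `c` from `F`, and of a constant in `W`. -/
inductive IsBihomogeneous (E F : Submodule k V) (W : Submodule k (ExteriorAlgebra k V)) :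
    ℕ → ℕ → (Module.Dual k V → ExteriorAlgebra k V) → Prop
  | const {ω : ExteriorAlgebra k V} (hω : ω ∈ W) :
    IsBihomogeneous E F W 0 0 (Function.const _ ω)
  | left {x : V} (hx : x ∈ E) {a c : ℕ} {p : Module.Dual k V → ExteriorAlgebra k V}
    (hp : IsBihomogeneous E F W a c p) : IsBihomogeneous E F W (a + 1) c (mulCoord x p)
  | right {x : V} (hx : x ∈ F) {a c : ℕ} {p : Module.Dual k V → ExteriorAlgebra k V}
    (hp : IsBihomogeneous E F W a c p) : IsBihomogeneous E F W (a + 1) (c + 1) (mulCoord x p)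

variable {E F : Submodule k V} {a c : ℕ} {p : Module.Dual k V → ExteriorAlgebra k V}

theorem IsBihomogeneous.mem_polyForms (hp : IsBihomogeneous E F W a c p) :
    p ∈ polyForms a W := by
  induction hp with
  | const hω => exact const_mem_polyForms hω
  | left _ _ ih => exact mulCoord_mem_polyForms _ ih
  | right _ _ ih => exact mulCoord_mem_polyForms _ ih

theorem IsBihomogeneous.exists_prod (hp : IsBihomogeneous E F W a 0 p) :
    ∃ u : Fin a → V, (∀ l, u l ∈ E) ∧ ∃ ω ∈ W, p = fun ξ => (∏ l, ξ (u l)) • ω := by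
  generalize hc : 0 = c at hp
  induction hp with
  | @const ω hω => exact ⟨Fin.elim0, fun l => l.elim0, ω, hω, by ext1; simp⟩
  | @left x hx a c p _ ih =>
    obtain ⟨u, hu, ω, hω, rfl⟩ := ih hc
    exact ⟨Fin.cons x u, Fin.cases hx hu, ω, hω, mulCoord_prod x u ω⟩
  | right => exact absurd hc (by omega)

/-- The polynomial forms of degree `a` with values in `W` whose degree along `F` is at most `C`. -/
def degreeFiltration (E F : Submodule k V) (W : Submodule k (ExteriorAlgebra k V)) (a C : ℕ) :
    Submodule k (Module.Dual k V → ExteriorAlgebra k V) :=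
  Submodule.span k {p | ∃ c ≤ C, IsBihomogeneous E F W a c p}

theorem degreeFiltration_le_polyForms (C : ℕ) : degreeFiltration E F W a C ≤ polyForms a W := by
  refine Submodule.span_le.mpr ?_
  rintro p ⟨c, _, hp⟩
  exact hp.mem_polyForms

theorem polyForms_le_degreeFiltration (h : E ⊔ F = ⊤) (a : ℕ) :
    polyForms a W ≤ degreeFiltration E F W a a := by
  induction a with
  | zero => exact polyForms_zero_le fun ω hω => Submodule.subset_span ⟨0, le_rfl, .const hω⟩
  | succ a ih =>
    refine polyForms_succ_le fun x p hp => ?_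
    suffices hle : degreeFiltration E F W a a ≤
        (degreeFiltration E F W (a + 1) (a + 1)).comap (mulCoord x) from hle (ih hp)
    refine Submodule.span_le.mpr ?_
    rintro p ⟨c, hc, hp⟩
    obtain ⟨y, hy, z, hz, rfl⟩ := Submodule.mem_sup.mp (h ▸ Submodule.mem_top : x ∈ E ⊔ F)
    rw [SetLike.mem_coe, Submodule.mem_comap, mulCoord_add]
    exact Submodule.add_mem _ (Submodule.subset_span ⟨c, by omega, .left hy hp⟩)
      (Submodule.subset_span ⟨c + 1, by omega, .right hz hp⟩)

end PolynomialForms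

section Differential

/-- The characterization of the Koszul differential on products of linear forms. -/
def IsKoszulDifferential (d : (Module.Dual k V → ExteriorAlgebra k V) →ₗ[k]
    (Module.Dual k V → ExteriorAlgebra k V)) : Prop :=
  ∀ (n : ℕ) (v : Fin n → V) (ω : ExteriorAlgebra k V),
    d (fun ξ => (∏ i, ξ (v i)) • ω) =
      fun ξ => ∑ i : Fin n, (∏ j ∈ Finset.univ.erase i, ξ (v j)) • (ι k (v i) * ω)

namespace IsKoszulDifferential

variable {d : (Module.Dual k V → ExteriorAlgebra k V) →ₗ[k]
    (Module.Dual k V → ExteriorAlgebra k V)}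
  {W W' : Submodule k (ExteriorAlgebra k V)} {n : ℕ} {p : Module.Dual k V → ExteriorAlgebra k V}

theorem map_const (hd : IsKoszulDifferential d) (ω : ExteriorAlgebra k V) :
    d (Function.const _ ω) = 0 := by
  have h := hd 0 Fin.elim0 ω
  simp only [Finset.univ_eq_empty, Finset.prod_empty, one_smul, Finset.sum_empty] at h
  exact h

theorem map_mulCoord (hd : IsKoszulDifferential d) (x : V) (hp : p ∈ polyForms n W) :
    d (mulCoord x p) = wedge x p + mulCoord x (d p) := by
  suffices h : polyForms n W ≤
      LinearMap.eqLocus (d ∘ₗ mulCoord x) (wedge x + mulCoord x ∘ₗ d) from h hp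
  refine Submodule.span_le.mpr ?_
  rintro _ ⟨v, ω, -, rfl⟩
  simp only [SetLike.mem_coe, LinearMap.mem_eqLocus, LinearMap.comp_apply, LinearMap.add_apply]
  rw [mulCoord_prod, hd, hd]
  ext1 ξ
  have h0 : ∏ j ∈ Finset.univ.erase (0 : Fin (n + 1)),
      ξ ((Fin.cons x v : Fin (n + 1) → V) j) = ∏ j, ξ (v j) := by
    rw [Fin.univ_succ, Finset.cons_eq_insert, Finset.erase_insert (by simp), Finset.prod_map]
    simp
  have hs (i : Fin n) : ∏ j ∈ Finset.univ.erase i.succ,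
      ξ ((Fin.cons x v : Fin (n + 1) → V) j) = ξ x * ∏ j ∈ Finset.univ.erase i, ξ (v j) := by
    have h : Finset.univ.erase i.succ =
        Finset.cons 0 ((Finset.univ.erase i).map (Fin.succEmb n)) (by simp) := by
      ext j
      refine Fin.cases ?_ (fun j => ?_) j <;> simp [(Fin.succ_ne_zero _).symm]
    rw [h, Finset.prod_cons, Finset.prod_map]
    simp
  simp only [Fin.sum_univ_succ, h0, hs, Fin.cons_zero, Fin.cons_succ, Pi.add_apply, wedge_apply,
    mulCoord_apply, Finset.smul_sum, mul_smul, mul_smul_comm]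

theorem map_wedge (hd : IsKoszulDifferential d) (x : V) (hp : p ∈ polyForms n W) :
    d (wedge x p) = -wedge x (d p) := by
  suffices h : polyForms n W ≤ LinearMap.eqLocus (d ∘ₗ wedge x) (-(wedge x ∘ₗ d)) from h hp
  refine Submodule.span_le.mpr ?_
  rintro _ ⟨v, ω, -, rfl⟩
  have h : wedge x (fun ξ => (∏ l, ξ (v l)) • ω) = fun ξ => (∏ l, ξ (v l)) • (ι k x * ω) := by
    ext1
    simp
  simp only [SetLike.mem_coe, LinearMap.mem_eqLocus, LinearMap.comp_apply, LinearMap.neg_apply]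
  rw [h, hd, hd]
  ext1 ξ
  simp only [Pi.neg_apply, wedge_apply, Finset.mul_sum, ← Finset.sum_neg_distrib, mul_smul_comm,
    ← smul_neg]
  refine Finset.sum_congr rfl fun i _ => ?_
  rw [← mul_assoc, ← mul_assoc, eq_neg_of_add_eq_zero_left (ι_add_mul_swap (v i) x), neg_mul]

theorem map_mem_polyForms (hd : IsKoszulDifferential d)
    (h : ∀ x : V, ∀ ω ∈ W, ι k x * ω ∈ W') (hp : p ∈ polyForms (n + 1) W) :
    d p ∈ polyForms n W' := by
  induction n generalizing p with
  | zero =>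
    refine polyForms_succ_le (S := (polyForms 0 W').comap d) (fun x p hp => ?_) hp
    refine polyForms_zero_le (S := ((polyForms 0 W').comap d).comap (mulCoord x))
      (fun ω hω => ?_) hp
    rw [Submodule.mem_comap, Submodule.mem_comap, hd.map_mulCoord x (const_mem_polyForms hω),
      hd.map_const, map_zero, add_zero]
    exact wedge_mem_polyForms (h x) (const_mem_polyForms hω)
  | succ n ih =>
    refine polyForms_succ_le (S := (polyForms (n + 1) W').comap d) (fun x p hp => ?_) hp
    rw [Submodule.mem_comap, hd.map_mulCoord x hp]
    exact Submodule.add_mem _ (wedge_mem_polyForms (h x) hp) (mulCoord_mem_polyForms x (ih hp))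

theorem map_eq_zero_of_mem_polyForms_zero (hd : IsKoszulDifferential d)
    (hp : p ∈ polyForms 0 W) : d p = 0 :=
  polyForms_zero_le (S := LinearMap.ker d) (fun ω _ => hd.map_const ω) hp

theorem map_map (hd : IsKoszulDifferential d) (hp : p ∈ polyForms n W) : d (d p) = 0 := by
  induction n generalizing p with
  | zero => rw [hd.map_eq_zero_of_mem_polyForms_zero hp, map_zero]
  | succ n ih =>
    refine polyForms_succ_le (S := LinearMap.ker (d ∘ₗ d)) (fun x p hp => ?_) hp
    rw [LinearMap.mem_ker, LinearMap.comp_apply, hd.map_mulCoord x hp, map_add, hd.map_wedge x hp]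
    have h : d (mulCoord x (d p)) = wedge x (d p) + mulCoord x (d (d p)) := by
      cases n with
      | zero => simp [hd.map_eq_zero_of_mem_polyForms_zero hp]
      | succ n =>
        exact hd.map_mulCoord x (hd.map_mem_polyForms (W' := ⊤) (fun _ _ _ => trivial) hp)
    rw [h, ih hp, map_zero, add_zero, neg_add_cancel]

section Homotopy

variable [FiniteDimensional k V] {P : V →ₗ[k] V} {i a c : ℕ}

theorem homotopy (hd : IsKoszulDifferential d) (hP : ∀ x, P (P x) = P x)
    (hW : ∀ x ∈ LinearMap.ker P, ∀ ω ∈ W, ι k x * ω = 0)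
    (hφ : ∀ φ : Module.Dual k V, ∀ ω ∈ W, contractLeft (φ ∘ₗ P) ω = 0)
    (hp : IsBihomogeneous (LinearMap.ker P) (LinearMap.range P) (extWedge i W) a c p) :
    d (eulerContraction P p) + eulerContraction P (d p) = ((c + i : ℕ) : k) • p := by
  have step (x : V) {a c : ℕ} {p : Module.Dual k V → ExteriorAlgebra k V}
      (hp : IsBihomogeneous (LinearMap.ker P) (LinearMap.range P) (extWedge i W) a c p)
      (ih : d (eulerContraction P p) + eulerContraction P (d p) = ((c + i : ℕ) : k) • p) :
      d (eulerContraction P (mulCoord x p)) + eulerContraction P (d (mulCoord x p)) =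
        mulCoord (P x) p + ((c + i : ℕ) : k) • mulCoord x p := by
    rw [eulerContraction_mulCoord, hd.map_mulCoord x hp.mem_polyForms, map_add,
      hd.map_mulCoord x (eulerContraction_mem_polyForms (W' := ⊤) hP (fun _ _ _ => trivial)
        hp.mem_polyForms), eulerContraction_wedge, eulerContraction_mulCoord, ← map_smul, ← ih,
      map_add]
    abel
  induction hp with
  | @const ω hω =>
    have hb := sum_ι_mul_contractLeft (Module.finBasis k V) hP
      (fun x => hW _ (by simp [hP])) hφ hω
    rw [hd.map_const, map_zero, add_zero, eulerContraction_const P (Module.finBasis k V) hP,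
      map_sum, zero_add]
    simp only [hd.map_mulCoord _ (const_mem_polyForms (W := ⊤) trivial), hd.map_const, map_zero,
      add_zero]
    ext1 ξ
    simpa using hb
  | @left x hx a c p hp ih =>
    rw [step x hp ih, LinearMap.mem_ker.mp hx]
    ext1 ξ
    simp
  | @right x hx a c p hp ih =>
    obtain ⟨y, rfl⟩ := hx
    rw [step _ hp ih, hP]
    ext1 ξ
    simp only [Pi.add_apply, Pi.smul_apply]
    push_cast
    module

end Homotopy

end IsKoszulDifferential

theorem ker_sup_range_eq_top {P : V →ₗ[k] V} (hP : ∀ x, P (P x) = P x) :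
    LinearMap.ker P ⊔ LinearMap.range P = ⊤ :=
  eq_top_iff.mpr fun x _ => Submodule.mem_sup.mpr
    ⟨x - P x, by simp [hP], P x, LinearMap.mem_range_self P x, sub_add_cancel x (P x)⟩

/-- If `N` acts on the graded pieces of a filtration `B` by nonzero scalars and maps `K` to `I`,
then `K` meets the filtration only inside `I`, as soon as it does so for the bottom step. -/
theorem mem_of_mem_filtration {M : Type*} [AddCommGroup M] [Module k M] {B : ℕ → Submodule k M}
    {N : M →ₗ[k] M} {μ : ℕ → k} {K I : Submodule k M} (hIK : I ≤ K) (hN : ∀ f ∈ K, N f ∈ I)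
    (hμ : ∀ c, μ (c + 1) ≠ 0) (hB : ∀ c, ∀ f ∈ B (c + 1), N f - μ (c + 1) • f ∈ B c)
    (h0 : ∀ f ∈ B 0, f ∈ K → f ∈ I) {C : ℕ} {f : M} (hf : f ∈ B C) (hK : f ∈ K) : f ∈ I := by
  induction C generalizing f with
  | zero => exact h0 f hf hK
  | succ C ih =>
    have h := ih (hB C f hf) (K.sub_mem (hIK (hN f hK)) (K.smul_mem _ hK))
    rw [I.sub_mem_iff_right (hN f hK)] at h
    exact (I.smul_mem_iff (hμ C)).mp h

namespace IsKoszulDifferential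

variable {d : (Module.Dual k V → ExteriorAlgebra k V) →ₗ[k]
    (Module.Dual k V → ExteriorAlgebra k V)}
  {W : Submodule k (ExteriorAlgebra k V)} {f : Module.Dual k V → ExteriorAlgebra k V}
  [FiniteDimensional k V] {P : V →ₗ[k] V} {i a c C : ℕ}

theorem homotopy_sub_mem (hd : IsKoszulDifferential d) (hP : ∀ x, P (P x) = P x)
    (hW : ∀ x ∈ LinearMap.ker P, ∀ ω ∈ W, ι k x * ω = 0)
    (hφ : ∀ φ : Module.Dual k V, ∀ ω ∈ W, contractLeft (φ ∘ₗ P) ω = 0)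
    (hf : f ∈ degreeFiltration (LinearMap.ker P) (LinearMap.range P) (extWedge i W) a (C + 1)) :
    (d ∘ₗ eulerContraction P + eulerContraction P ∘ₗ d) f - ((C + 1 + i : ℕ) : k) • f ∈
      degreeFiltration (LinearMap.ker P) (LinearMap.range P) (extWedge i W) a C := by
  suffices h : degreeFiltration (LinearMap.ker P) (LinearMap.range P) (extWedge i W) a (C + 1) ≤
      (degreeFiltration (LinearMap.ker P) (LinearMap.range P) (extWedge i W) a C).comap
        ((d ∘ₗ eulerContraction P + eulerContraction P ∘ₗ d) -
          ((C + 1 + i : ℕ) : k) • LinearMap.id) from h hf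
  refine Submodule.span_le.mpr ?_
  rintro p ⟨c, hc, hp⟩
  have h := hd.homotopy hP hW hφ hp
  simp only [SetLike.mem_coe, Submodule.mem_comap, LinearMap.sub_apply, LinearMap.add_apply,
    LinearMap.comp_apply, LinearMap.smul_apply, LinearMap.id_apply, h, ← sub_smul]
  rcases hc.lt_or_eq with hc | rfl
  · exact Submodule.smul_mem _ _ (Submodule.subset_span ⟨c, by omega, hp⟩)
  · simp

theorem homotopy_of_mem_degreeFiltration_zero (hd : IsKoszulDifferential d)
    (hP : ∀ x, P (P x) = P x)
    (hW : ∀ x ∈ LinearMap.ker P, ∀ ω ∈ W, ι k x * ω = 0)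
    (hφ : ∀ φ : Module.Dual k V, ∀ ω ∈ W, contractLeft (φ ∘ₗ P) ω = 0)
    (hf : f ∈ degreeFiltration (LinearMap.ker P) (LinearMap.range P) (extWedge i W) a 0) :
    d (eulerContraction P f) + eulerContraction P (d f) = (i : k) • f := by
  suffices h : degreeFiltration (LinearMap.ker P) (LinearMap.range P) (extWedge i W) a 0 ≤
      LinearMap.eqLocus (d ∘ₗ eulerContraction P + eulerContraction P ∘ₗ d)
        ((i : k) • LinearMap.id) from h hf
  refine Submodule.span_le.mpr ?_
  rintro p ⟨c, hc, hp⟩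
  obtain rfl := Nat.le_zero.mp hc
  simpa using hd.homotopy hP hW hφ hp

theorem mem_degreeFiltration_zero_of_map_eq_zero [CharZero k] (hd : IsKoszulDifferential d)
    (hP : ∀ x, P (P x) = P x)
    (hW : ∀ x ∈ LinearMap.ker P, ∀ ω ∈ W, ι k x * ω = 0)
    (hφ : ∀ φ : Module.Dual k V, ∀ ω ∈ W, contractLeft (φ ∘ₗ P) ω = 0)
    (hf : f ∈ polyForms a W) (hdf : d f = 0) :
    f ∈ degreeFiltration (LinearMap.ker P) (LinearMap.range P) W a 0 := by
  have hδ {f} (hf : f ∈ polyForms a W) : eulerContraction P f = 0 := by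
    have := eulerContraction_mem_polyForms (W' := ⊥) hP
      (fun φ ω hω => (Submodule.mem_bot k).mpr (hφ φ ω hω)) hf
    rwa [polyForms_bot, Submodule.mem_bot] at this
  refine (mem_of_mem_filtration
    (B := degreeFiltration (LinearMap.ker P) (LinearMap.range P) W a)
    (N := d ∘ₗ eulerContraction P + eulerContraction P ∘ₗ d) (μ := fun c => (c : k))
    (K := LinearMap.ker d ⊓ polyForms a W)
    (I := LinearMap.ker d ⊓ degreeFiltration (LinearMap.ker P) (LinearMap.range P) W a 0)
    (inf_le_inf_left _ (degreeFiltration_le_polyForms 0)) ?_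
    (fun c => Nat.cast_ne_zero.mpr (by omega)) ?_
    (fun f hf hK => ⟨hK.1, hf⟩) (polyForms_le_degreeFiltration (ker_sup_range_eq_top hP) a hf)
    ⟨hdf, hf⟩).2
  · rintro f ⟨hdf, hf⟩
    rw [LinearMap.add_apply, LinearMap.comp_apply, LinearMap.comp_apply, hδ hf,
      LinearMap.mem_ker.mp hdf, map_zero, map_zero, add_zero]
    exact Submodule.zero_mem _
  · intro c f hf
    rw [← extWedge_zero (W := W)] at hf ⊢
    exact hd.homotopy_sub_mem hP hW hφ hf

theorem exists_map_eq_of_map_eq_zero [CharZero k] (hd : IsKoszulDifferential d)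
    (hP : ∀ x, P (P x) = P x)
    (hW : ∀ x ∈ LinearMap.ker P, ∀ ω ∈ W, ι k x * ω = 0)
    (hφ : ∀ φ : Module.Dual k V, ∀ ω ∈ W, contractLeft (φ ∘ₗ P) ω = 0)
    (hf : f ∈ polyForms a (extWedge (i + 1) W)) (hdf : d f = 0) :
    f ∈ (polyForms (a + 1) (extWedge i W)).map d := by
  have hN {f} (hf : f ∈ LinearMap.ker d ⊓ polyForms a (extWedge (i + 1) W)) :
      d (eulerContraction P f) + eulerContraction P (d f) ∈
        (polyForms (a + 1) (extWedge i W)).map d := by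
    rw [LinearMap.mem_ker.mp hf.1, map_zero, add_zero]
    exact Submodule.mem_map_of_mem (eulerContraction_mem_polyForms hP
      (fun φ ω hω => contractLeft_mem_extWedge (hφ φ) hω) hf.2)
  refine mem_of_mem_filtration
    (B := degreeFiltration (LinearMap.ker P) (LinearMap.range P) (extWedge (i + 1) W) a)
    (N := d ∘ₗ eulerContraction P + eulerContraction P ∘ₗ d)
    (μ := fun c => ((c + (i + 1) : ℕ) : k))
    (K := LinearMap.ker d ⊓ polyForms a (extWedge (i + 1) W)) ?_ (fun f hf => hN hf)
    (fun c => Nat.cast_ne_zero.mpr (by omega)) (fun c f hf => hd.homotopy_sub_mem hP hW hφ hf) ?_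
    (polyForms_le_degreeFiltration (ker_sup_range_eq_top hP) a hf) ⟨hdf, hf⟩
  · rintro _ ⟨p, hp, rfl⟩
    exact ⟨hd.map_map hp, hd.map_mem_polyForms (fun x ω hω => ι_mul_mem_extWedge x hω) hp⟩
  · intro f hf hK
    have h := hN hK
    rw [hd.homotopy_of_mem_degreeFiltration_zero hP hW hφ hf] at h
    exact (Submodule.smul_mem_iff _ (Nat.cast_ne_zero.mpr i.succ_ne_zero)).mp h

end IsKoszulDifferential

end Differential

end KoszulComplex

/- We realize the algebra `S(V) ⊗ Λ(V)` as the algebra of `Λ(V)`-valued polynomial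
functions on the dual space `V* = Module.Dual k V`: the subspace `S^a V ⊗ W`
(for a subspace `W ⊆ Λ(V)`) corresponds to the span of the functions
`ξ ↦ (ξ v₁ ⋯ ξ v_a) • ω` with `v₁, …, v_a ∈ V` and `ω ∈ W`.  The derivation `d`
is the unique linear map acting on these generators by
`d((ξ v₁ ⋯ ξ v_n) • ω) = ∑ i (∏_{j ≠ i} ξ v_j) • (v_i ∧ ω)`.
Here `ΛE = Λ^e E` is the `e`-th exterior power of the subspace `E` inside `Λ(V)`,
`MM i = S^{m-i} V ⊗ (Λ^i V ∧ Λ^e E)` and `SE = S^m E ⊗ Λ^e E`; the statement is the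
exactness of the augmented complex
`0 → S^m E ⊗ Λ^e E → S^m V ⊗ Λ^e E → ⋯ → S^{m-i} V ⊗ (Λ^i V ∧ Λ^e E) → ⋯ → Λ^m V ∧ Λ^e E → 0`. -/
theorem stmt11 (k : Type) [Field k] [CharZero k]
    (V : Type) [AddCommGroup V] [Module k V] [FiniteDimensional k V]
    (d : (Module.Dual k V → ExteriorAlgebra k V) →ₗ[k] (Module.Dual k V → ExteriorAlgebra k V))
    (hd : ∀ (n : ℕ) (v : Fin n → V) (ω : ExteriorAlgebra k V),
      d (fun ξ => (∏ i, ξ (v i)) • ω) =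
        fun ξ => ∑ i : Fin n, (∏ j ∈ Finset.univ.erase i, ξ (v j)) • (ι k (v i) * ω))
    (E : Submodule k V) (e : ℕ) (he : Module.finrank k ↥E = e)
    (m : ℕ) (hm : 1 ≤ m)
    (ΛE : Submodule k (ExteriorAlgebra k V))
    (hΛE : ΛE = (Submodule.map (ι k : V →ₗ[k] ExteriorAlgebra k V) E) ^ e)
    (MM : ℕ → Submodule k (Module.Dual k V → ExteriorAlgebra k V))
    (hMM : ∀ i, MM i = Submodule.span k
      {f | ∃ (v : Fin (m - i) → V) (ω : ExteriorAlgebra k V),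
        ω ∈ (LinearMap.range (ι k : V →ₗ[k] ExteriorAlgebra k V) ^ i * ΛE :
          Submodule k (ExteriorAlgebra k V)) ∧
        f = fun ξ => (∏ l, ξ (v l)) • ω})
    (SE : Submodule k (Module.Dual k V → ExteriorAlgebra k V))
    (hSE : SE = Submodule.span k
      {f | ∃ (u : Fin m → V), (∀ l, u l ∈ E) ∧ ∃ ω ∈ ΛE,
        f = fun ξ => (∏ l, ξ (u l)) • ω}) :
    SE ≤ MM 0 ∧
    (∀ i, Submodule.map d (MM i) ≤ MM (i + 1)) ∧
    (∀ f ∈ MM 0, (d f = 0 ↔ f ∈ SE)) ∧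
    (∀ i, i + 1 ≤ m → ∀ f ∈ MM (i + 1), d f = 0 → f ∈ Submodule.map d (MM i)) := by
  have hd : IsKoszulDifferential d := hd
  have hMM : ∀ i, MM i = polyForms (m - i) (extWedge i ΛE) := hMM
  obtain ⟨π, hπ⟩ := E.subtype.exists_leftInverse_of_injective E.ker_subtype
  have hπE (x : E) : π x = x := LinearMap.congr_fun hπ x
  set P : V →ₗ[k] V := LinearMap.id - E.subtype ∘ₗ π with hPdef
  have hP (x : V) : P (P x) = P x := by simp [hPdef, hπE]
  have hker : LinearMap.ker P = E := by
    ext x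
    rw [LinearMap.mem_ker]
    refine ⟨fun h => ?_, fun h => ?_⟩
    · have hx : x = π x := sub_eq_zero.mp h
      exact hx ▸ (π x).2
    · simpa [hPdef, sub_eq_zero] using (congrArg Subtype.val (hπE ⟨x, h⟩)).symm
  have hW : ∀ x ∈ LinearMap.ker P, ∀ ω ∈ ΛE, ι k x * ω = 0 := by
    subst he hΛE
    rw [hker]
    exact fun x hx ω hω => ι_mul_eq_zero_of_mem_pow_finrank hx hω
  have hφ : ∀ φ : Module.Dual k V, ∀ ω ∈ ΛE, CliffordAlgebra.contractLeft (φ ∘ₗ P) ω = 0 := by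
    subst hΛE
    refine fun φ ω hω => contractLeft_eq_zero_of_mem_pow (fun x hx => ?_) e hω
    rw [LinearMap.comp_apply, LinearMap.mem_ker.mp (hker.symm ▸ hx : x ∈ LinearMap.ker P),
      map_zero]
  have hSE_le : SE ≤ polyForms m ΛE := by
    rw [hSE]
    refine Submodule.span_mono ?_
    rintro _ ⟨u, -, ω, hω, rfl⟩
    exact ⟨u, ω, hω, rfl⟩
  have hMM0 : MM 0 = polyForms m ΛE := by rw [hMM, extWedge_zero, Nat.sub_zero]
  refine ⟨hMM0 ▸ hSE_le, fun i => ?_, fun f hf => ⟨fun hdf => ?_, fun hf => ?_⟩,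
    fun i hi f hf hdf => ?_⟩
  · rw [hMM, hMM]
    rintro _ ⟨f, hf, rfl⟩
    rcases lt_or_ge i m with hi | hi
    · rw [SetLike.mem_coe, show m - i = m - (i + 1) + 1 by omega] at hf
      exact hd.map_mem_polyForms (fun x ω hω => ι_mul_mem_extWedge x hω) hf
    · rw [SetLike.mem_coe, Nat.sub_eq_zero_of_le hi] at hf
      rw [hd.map_eq_zero_of_mem_polyForms_zero hf]
      exact Submodule.zero_mem _
  · rw [hMM0] at hf
    have h := hd.mem_degreeFiltration_zero_of_map_eq_zero hP hW hφ hf hdf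
    rw [hker] at h
    rw [hSE]
    refine Submodule.span_mono ?_ h
    rintro p ⟨c, hc, hp⟩
    obtain rfl := Nat.le_zero.mp hc
    exact hp.exists_prod
  · suffices h : SE ≤ LinearMap.ker d from h hf
    rw [hSE, Submodule.span_le]
    rintro _ ⟨u, hu, ω, hω, rfl⟩
    rw [SetLike.mem_coe, LinearMap.mem_ker, hd]
    ext1 ξ
    exact Finset.sum_eq_zero fun l _ => by rw [hW _ (hker.symm ▸ hu l) ω hω, smul_zero]
  · rw [hMM] at hf ⊢
    rw [show m - i = m - (i + 1) + 1 by omega]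
    exact hd.exists_map_eq_of_map_eq_zero hP hW hφ hf hdf
end

section
/- Let P_• : 0 → P_l → P_{l−1} → ⋯ → P_0 be a complex of finitely generated projective k[X]-modules of finite length l, let ε : P_0 → R be an augmentation morphism with image R, and consider the augmented complex 0 → P_l → ⋯ → P_0 → R → 0. Assume: (1) p ≥ l + 2, where p is the codimension of S in X; (2) X is normal; (3) S contains the support of the homology of the augmented complex. Then the augmented complex is exact; that is, P_• is a projective resolution of R of length l. -/
/-- A commutative ring is Cohen–Macaulay if it is Noetherian and, for every maximal
ideal, the localization admits a regular sequence (contained in the maximal ideal)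
whose length equals the Krull dimension of the localization
(i.e. depth = dimension for all localizations at maximal ideals). -/
def IsCohenMacaulayRing (A : Type*) [CommRing A] : Prop :=
  IsNoetherianRing A ∧
  ∀ P : Ideal A, ∀ hP : P.IsMaximal,
    haveI : P.IsPrime := hP.isPrime
    ∃ rs : List (Localization.AtPrime P),
      (∀ r ∈ rs, r ∈ IsLocalRing.maximalIdeal (Localization.AtPrime P)) ∧
      RingTheory.Sequence.IsRegular (Localization.AtPrime P) rs ∧
      ((rs.length : ℕ∞) : WithBot ℕ∞) = ringKrullDim (Localization.AtPrime P)

section ExtVanishing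

open CategoryTheory CategoryTheory.Abelian IsLocalRing

universe u

variable {B : Type u} [CommRing B]

/-- The short exact sequence in `ModuleCat` attached to an exact pair of linear maps. -/
lemma exists_shortExact_of_exact {L M N : Type u} [AddCommGroup L] [Module B L] [AddCommGroup M]
    [Module B M] [AddCommGroup N] [Module B N] {f : L →ₗ[B] M} {g : M →ₗ[B] N}
    (hf : Function.Injective f) (hg : Function.Surjective g) (hfg : Function.Exact f g) :
    ∃ w, (ShortComplex.mk (ModuleCat.ofHom f) (ModuleCat.ofHom g) w).ShortExact :=
  ⟨by ext x; exact hfg.apply_apply_eq_zero x,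
    { exact := (ShortComplex.ShortExact.moduleCat_exact_iff_function_exact _).mpr hfg
      mono_f := (ModuleCat.mono_iff_injective _).mpr hf
      epi_g := (ModuleCat.epi_iff_surjective _).mpr hg }⟩

/-- If `Ext` into `M` vanishes on `B ⧸ q` for all `q` in the support of `N`, it vanishes on `N`. -/
lemma subsingleton_ext_of_forall_mem_support [IsNoetherianRing B] (M : ModuleCat.{u} B) (i : ℕ)
    (N : Type u) [AddCommGroup N] [Module B N] [Module.Finite B N]
    (h : ∀ q ∈ Module.support B N, Subsingleton (Ext (ModuleCat.of B (B ⧸ q.asIdeal)) M i)) :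
    Subsingleton (Ext (ModuleCat.of B N) M i) := by
  induction ‹Module.Finite B N› using
    IsNoetherianRing.induction_on_isQuotientEquivQuotientPrime B with
  | subsingleton N =>
    have : Limits.IsZero (ModuleCat.of B N) := ModuleCat.isZero_of_subsingleton _
    exact ⟨fun x y => by
      rw [← Ext.mk₀_id_comp x, ← Ext.mk₀_id_comp y, this.eq_of_src (𝟙 _) 0]; simp⟩
  | quotient N p e =>
    have hp : p ∈ Module.support B N := by
      rw [e.support_eq, Module.support_eq_zeroLocus, Ideal.annihilator_quotient]
      exact fun _ hx => hx
    have := h p hp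
    exact ((((extFunctor i).mapIso e.toModuleIso.op).app M).addCommGroupIsoToAddEquiv
      ).toEquiv.subsingleton_congr.mp this
  | exact N₁ N₂ N₃ f g hf hg hfg h₁ h₃ =>
    obtain ⟨w, hS⟩ := exists_shortExact_of_exact hf hg hfg
    have s₁ := h₁ fun q hq => h q (Module.support_subset_of_injective f hf hq)
    have s₃ := h₃ fun q hq => h q (Module.support_subset_of_surjective g hg hq)
    refine subsingleton_of_forall_eq 0 fun x => ?_
    obtain ⟨y, rfl⟩ := Ext.contravariant_sequence_exact₂ hS M x (s₁.elim _ _)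
    rw [s₃.elim y 0, Ext.comp_zero]

lemma subsingleton_ext_quotient_of_forall_lt [IsNoetherianRing B] [IsLocalRing B]
    (M : ModuleCat.{u} B) [Module.Finite B M] (i : ℕ) (p : Ideal B) [p.IsPrime]
    (hp : p ≠ maximalIdeal B)
    (h : ∀ q : Ideal B, p < q → q.IsPrime →
      Subsingleton (Ext (ModuleCat.of B (B ⧸ q)) M (i + 1))) :
    Subsingleton (Ext (ModuleCat.of B (B ⧸ p)) M i) := by
  obtain ⟨x, hxm, hxp⟩ := SetLike.exists_of_lt
    ((IsLocalRing.le_maximalIdeal (Ideal.IsPrime.ne_top ‹_›)).lt_of_ne hp)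
  let f : (B ⧸ p) →ₗ[B] (B ⧸ p) := LinearMap.lsmul B (B ⧸ p) x
  have hf : Function.Injective f := by
    rw [← LinearMap.ker_eq_bot, LinearMap.ker_eq_bot']
    intro y hy
    obtain ⟨y, rfl⟩ := Ideal.Quotient.mk_surjective y
    have : Ideal.Quotient.mk p (x * y) = 0 := hy
    rw [Ideal.Quotient.eq_zero_iff_mem] at this ⊢
    exact (Ideal.IsPrime.mem_or_mem ‹_› this).resolve_left hxp
  obtain ⟨w, hS⟩ := exists_shortExact_of_exact hf (LinearMap.range f).mkQ_surjective
    (LinearMap.exact_map_mkQ_range f)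
  have hQ : Subsingleton (Ext (ModuleCat.of B ((B ⧸ p) ⧸ LinearMap.range f)) M (i + 1)) := by
    refine subsingleton_ext_of_forall_mem_support M (i + 1) _ fun q hq => h _ ?_ q.isPrime
    rw [Module.support_eq_zeroLocus] at hq
    have hann : ∀ a : B, (∀ b : B, Ideal.Quotient.mk p (a * b) ∈ LinearMap.range f) →
        a ∈ q.asIdeal := fun a ha => hq <| by
      rw [SetLike.mem_coe, Module.mem_annihilator]
      intro z
      obtain ⟨z, rfl⟩ := Submodule.mkQ_surjective _ z
      obtain ⟨z, rfl⟩ := Ideal.Quotient.mk_surjective z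
      rw [← map_smul, Submodule.mkQ_apply, Submodule.Quotient.mk_eq_zero]
      exact ha z
    refine lt_of_le_of_ne (fun a ha => hann a fun b => ?_) ?_
    · rw [Ideal.Quotient.eq_zero_iff_mem.mpr (p.mul_mem_right b ha)]
      exact zero_mem _
    · intro e
      exact hxp (e ▸ hann x fun b => ⟨Ideal.Quotient.mk p b, rfl⟩)
  by_contra hne
  rw [not_subsingleton_iff_nontrivial] at hne
  have hmem : x ∈ (Module.annihilator B (Ext (ModuleCat.of B (B ⧸ p)) M i)).jacobson :=
    IsLocalRing.maximalIdeal_le_jacobson _ hxm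
  refine Submodule.top_ne_pointwise_smul_of_mem_jacobson_annihilator hmem (Eq.symm ?_)
  rw [eq_top_iff]
  intro y _
  obtain ⟨z, hz⟩ := Ext.contravariant_sequence_exact₁ hS M y (add_comm 1 i) (hQ.elim _ _)
  refine (Submodule.mem_smul_pointwise_iff_exists _ _ _).mpr ⟨z, trivial, ?_⟩
  rw [← hz]
  have : ModuleCat.ofHom f = x • 𝟙 (ModuleCat.of B (B ⧸ p)) := by ext; rfl
  simp [this, Ext.mk₀_smul]

/-- Over a local ring whose depth equals its dimension, `Extⁱ(B ⧸ p, M) = 0` for `i < height p`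
and `M` finite flat. -/
lemma subsingleton_ext_quotient_of_lt_height [IsNoetherianRing B] [IsLocalRing B]
    {rs : List B} (hrs : ∀ r ∈ rs, r ∈ maximalIdeal B)
    (hreg : RingTheory.Sequence.IsRegular B rs)
    (hlen : ((rs.length : ℕ∞) : WithBot ℕ∞) = ringKrullDim B)
    (M : ModuleCat.{u} B) [Module.Finite B M] [Module.Flat B M]
    (p : Ideal B) (hp : p.IsPrime) (i : ℕ) (hi : i < p.height) :
    Subsingleton (Ext (ModuleCat.of B (B ⧸ p)) M i) := by
  induction p using WellFoundedGT.induction generalizing i with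
  | ind p ih =>
  by_cases hpm : p = maximalIdeal B
  · subst hpm
    rw [← IsLocalRing.maximalIdeal_height_eq_ringKrullDim, WithBot.coe_inj] at hlen
    rw [← hlen, Nat.cast_lt] at hi
    cases subsingleton_or_nontrivial M
    · have : Limits.IsZero M := ModuleCat.isZero_of_subsingleton _
      exact ⟨fun x y => by
        rw [← Ext.comp_mk₀_id x, ← Ext.comp_mk₀_id y, this.eq_of_src (𝟙 _) 0]; simp⟩
    have hM : RingTheory.Sequence.IsRegular M rs :=
      (IsLocalRing.isRegular_iff_isWeaklyRegular_of_subset_maximalIdeal hrs).mpr <|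
        ((TensorProduct.rid B M).isWeaklyRegular_congr rs).mp
          hreg.toIsWeaklyRegular.isWeaklyRegular_lTensor
    refine ModuleCat.subsingleton_ext_of_exists_isRegular (maximalIdeal B) _ ?_ M ?_ rs hrs hM i hi
    · rw [Module.support_eq_zeroLocus, Ideal.annihilator_quotient]
    · exact (Submodule.top_ne_ideal_smul_of_le_jacobson_annihilator
        (IsLocalRing.maximalIdeal_le_jacobson _)).symm.lt_top
  · refine subsingleton_ext_quotient_of_forall_lt M i p hpm fun q hq hq' => ih q hq hq' (i + 1) ?_
    have h1 := Ideal.height_add_one_le_of_lt_of_isPrime hq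
    refine lt_of_lt_of_le ?_ h1
    rw [Nat.cast_add, Nat.cast_one]
    exact (ENat.add_lt_add_iff_right (by simp)).mpr hi

/-- If `Ext⁰(B ⧸ p, P)` and `Ext¹(B ⧸ p, K)` vanish for all primes `p` of height at least `h`,
then `P ⧸ K` has no nonzero element supported in height at least `h`. -/
lemma mem_of_forall_le_height [IsNoetherianRing B] {P : Type u} [AddCommGroup P] [Module B P]
    (K : Submodule B P) (h : ℕ∞)
    (hP : ∀ p : Ideal B, p.IsPrime → h ≤ p.height →
      Subsingleton (Ext (ModuleCat.of B (B ⧸ p)) (ModuleCat.of B P) 0))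
    (hK : ∀ p : Ideal B, p.IsPrime → h ≤ p.height →
      Subsingleton (Ext (ModuleCat.of B (B ⧸ p)) (ModuleCat.of B K) 1))
    (z : P) (hz : ∀ p : Ideal B, p.IsPrime → (∀ a, a • z ∈ K → a ∈ p) → h ≤ p.height) :
    z ∈ K := by
  by_contra hzK
  obtain ⟨p, hp, hle⟩ := exists_le_isAssociatedPrime_of_isNoetherianRing B (K.mkQ z) (by simpa)
  obtain ⟨hp', y, hy⟩ := isAssociatedPrime_iff.mp hp
  have hht := hz p hp' fun a ha => hle <| by
    rw [Submodule.mem_colon_singleton, ← map_smul]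
    exact (Submodule.mem_bot B).mpr ((Submodule.Quotient.mk_eq_zero K).mpr ha)
  have := hP p hp' hht
  have := hK p hp' hht
  obtain ⟨w, hS⟩ := exists_shortExact_of_exact K.injective_subtype K.mkQ_surjective
    (LinearMap.exact_subtype_mkQ K)
  have hsub : Subsingleton (Ext (ModuleCat.of B (B ⧸ p)) (ModuleCat.of B (P ⧸ K)) 0) := by
    refine subsingleton_of_forall_eq 0 fun x => ?_
    obtain ⟨x₂, rfl⟩ := Ext.covariant_sequence_exact₃ _ hS x (zero_add 1)
      (Subsingleton.elim _ _)
    rw [Subsingleton.elim x₂ 0, Ext.zero_comp]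
  have hsub' : Subsingleton ((B ⧸ p) →ₗ[B] (P ⧸ K)) :=
    ((Ext.addEquiv₀ (X := ModuleCat.of B (B ⧸ p)) (Y := ModuleCat.of B (P ⧸ K))).trans
      ModuleCat.homAddEquiv).symm.subsingleton
  let φ : (B ⧸ p) →ₗ[B] (P ⧸ K) := Submodule.liftQ p (LinearMap.toSpanSingleton B _ y)
    fun a ha => by
      rw [hy, Submodule.mem_colon_singleton] at ha
      simpa using ha
  have h1 : φ (Ideal.Quotient.mk p 1) = y :=
    (Submodule.liftQ_apply p _ (1 : B)).trans (by simp)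
  rw [Subsingleton.elim φ 0, LinearMap.zero_apply] at h1
  refine hp'.one_notMem ?_
  rw [hy, Submodule.mem_colon_singleton, ← h1]
  simp

/-- A version of the Peskine–Szpiro acyclicity lemma, phrased with vanishing of `Ext`. -/
lemma range_eq_ker_of_subsingleton_ext [IsNoetherianRing B] (l : ℕ) (h : ℕ∞)
    (P : ℕ → Type u) [∀ i, AddCommGroup (P i)] [∀ i, Module B (P i)]
    (hP : ∀ i j, j ≤ l + 1 → ∀ p : Ideal B, p.IsPrime → h ≤ p.height →
      Subsingleton (Ext (ModuleCat.of B (B ⧸ p)) (ModuleCat.of B (P i)) j))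
    (htriv : ∀ i, l < i → Subsingleton (P i))
    (d : ∀ i, P (i + 1) →ₗ[B] P i) (hdd : ∀ i, (d i).comp (d (i + 1)) = 0)
    (R : Type u) [AddCommGroup R] [Module B R] (ε : P 0 →ₗ[B] R) (hεd : ε.comp (d 0) = 0)
    (hz₀ : ∀ z, ε z = 0 → ∀ p : Ideal B, p.IsPrime →
      (∀ a : B, a • z ∈ LinearMap.range (d 0) → a ∈ p) → h ≤ p.height)
    (hz : ∀ i z, d i z = 0 → ∀ p : Ideal B, p.IsPrime →
      (∀ a : B, a • z ∈ LinearMap.range (d (i + 1)) → a ∈ p) → h ≤ p.height) :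
    LinearMap.ker ε = LinearMap.range (d 0) ∧
    ∀ i, LinearMap.ker (d i) = LinearMap.range (d (i + 1)) := by
  have key : ∀ i, (∀ j ≤ i + 2, ∀ p : Ideal B, p.IsPrime → h ≤ p.height →
      Subsingleton (Ext (ModuleCat.of B (B ⧸ p))
        (ModuleCat.of B (LinearMap.range (d (i + 1)))) j)) →
      LinearMap.ker (d i) = LinearMap.range (d (i + 1)) := fun i hi =>
    le_antisymm
      (fun z hzi => mem_of_forall_le_height _ h (hP _ 0 (by omega)) (hi 1 (by omega)) z
        (hz i z hzi))
      (LinearMap.range_le_ker_iff.mpr (hdd i))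
  have main : ∀ n i, l ≤ i + n → ∀ j ≤ i + 1, ∀ p : Ideal B, p.IsPrime → h ≤ p.height →
      Subsingleton (Ext (ModuleCat.of B (B ⧸ p))
        (ModuleCat.of B (LinearMap.range (d i))) j) := by
    intro n
    induction n with
    | zero =>
      intro i hi j _ p _ _
      have := htriv (i + 1) (by omega)
      have : Subsingleton (LinearMap.range (d i)) :=
        (d i).surjective_rangeRestrict.subsingleton
      have : Limits.IsZero (ModuleCat.of B (LinearMap.range (d i))) :=
        ModuleCat.isZero_of_subsingleton _
      exact ⟨fun x y => by
        rw [← Ext.comp_mk₀_id x, ← Ext.comp_mk₀_id y, this.eq_of_src (𝟙 _) 0]; simp⟩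
    | succ n ih =>
      intro i hi j hj p hp hht
      by_cases hil : l ≤ i + n
      · exact ih i hil j hj p hp hht
      have hE := ih (i + 1) (by omega)
      have hker := key i hE
      have hS := LinearMap.shortExact_shortComplexKer (d i).surjective_rangeRestrict
      have s₁ : Subsingleton (Ext (ModuleCat.of B (B ⧸ p))
          (ModuleCat.of B (LinearMap.ker (d i).rangeRestrict)) (j + 1)) := by
        rw [LinearMap.ker_rangeRestrict, hker]
        exact hE (j + 1) (by omega) p hp hht
      have s₂ := hP (i + 1) j (by omega) p hp hht
      refine subsingleton_of_forall_eq 0 fun x => ?_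
      obtain ⟨x₂, rfl⟩ := Ext.covariant_sequence_exact₃ _ hS x rfl (s₁.elim _ _)
      rw [s₂.elim x₂ 0, Ext.zero_comp]
  exact ⟨le_antisymm
      (fun z hzi => mem_of_forall_le_height _ h (hP _ 0 (by omega))
        (main l 0 (by omega) 1 le_rfl) z (hz₀ z hzi))
      (LinearMap.range_le_ker_iff.mpr hεd),
    fun i => key i (main l (i + 1) (by omega))⟩

end ExtVanishing

/-- A prime of `Localization S` containing the annihilator of the class of a localized cycle
contracts to a point of the support of the homology. -/
lemma comap_mem_support_homology {A : Type*} [CommRing A] (S : Submonoid A)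
    {L M N : Type*} [AddCommGroup L] [Module A L] [AddCommGroup M] [Module A M]
    [AddCommGroup N] [Module A N] (f : L →ₗ[A] M) (g : M →ₗ[A] N)
    (z : LocalizedModule S M) (hz : LocalizedModule.map S g z = 0)
    (q : Ideal (Localization S)) [hq : q.IsPrime]
    (hzq : ∀ a : Localization S, a • z ∈ LinearMap.range (LocalizedModule.map S f) → a ∈ q) :
    (⟨q.comap (algebraMap A (Localization S)), inferInstance⟩ : PrimeSpectrum A) ∈
      Module.support A
        (↥(LinearMap.ker g) ⧸ (LinearMap.range f).comap (LinearMap.ker g).subtype) := by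
  induction z using LocalizedModule.induction_on with
  | h z s =>
  rw [LocalizedModule.map_mk, ← LocalizedModule.zero_mk 1, LocalizedModule.mk_eq] at hz
  obtain ⟨u, hu⟩ := hz
  rw [one_smul, smul_zero, smul_zero, ← LinearMap.map_smul_of_tower] at hu
  refine Module.mem_support_iff'.mpr ⟨Submodule.Quotient.mk ⟨u • z, hu⟩, fun a ha h0 => ha ?_⟩
  rw [← Submodule.Quotient.mk_smul, Submodule.Quotient.mk_eq_zero] at h0
  obtain ⟨y, hy⟩ := h0
  have hmem : algebraMap A (Localization S) (a * u) ∈ q := by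
    refine hzq _ ⟨LocalizedModule.mk y s, ?_⟩
    rw [LocalizedModule.map_mk, hy, algebraMap_smul, LocalizedModule.smul'_mk, mul_smul]
    rfl
  rw [map_mul] at hmem
  exact (hq.mem_or_mem hmem).resolve_right fun h =>
    hq.ne_top (Ideal.eq_top_of_isUnit_mem q h (IsLocalization.map_units _ u))

lemma le_height_of_support_homology_subset {A : Type*} [CommRing A] (S : Submonoid A)
    {L M N : Type*} [AddCommGroup L] [Module A L] [AddCommGroup M] [Module A M]
    [AddCommGroup N] [Module A N] (f : L →ₗ[A] M) (g : M →ₗ[A] N)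
    (Z : Set (PrimeSpectrum A)) (h : ℕ∞) (hZ : h ≤ ⨅ q ∈ Z, Order.height q)
    (hsupp : Module.support A
      (↥(LinearMap.ker g) ⧸ (LinearMap.range f).comap (LinearMap.ker g).subtype) ⊆ Z)
    (z : LocalizedModule S M) (hz : LocalizedModule.map S g z = 0)
    (q : Ideal (Localization S)) (hq : q.IsPrime)
    (hzq : ∀ a : Localization S, a • z ∈ LinearMap.range (LocalizedModule.map S f) → a ∈ q) :
    h ≤ q.height := by
  have hmem := hsupp (comap_mem_support_homology S f g z hz q hzq)
  rw [← IsLocalization.height_under S q]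
  exact (hZ.trans (iInf₂_le _ hmem)).trans_eq (PrimeSpectrum.height_eq_orderHeight _).symm

/- `X` is an irreducible affine variety over the algebraically closed field `k`, with
Cohen–Macaulay coordinate ring `A = k[X]` (a finitely generated domain over `k`); closed
subsets of `X` are modelled as closed subsets `Z` of `Spec A`, and the codimension of `Z`
is `⨅_{q ∈ Z} height q`.  Given a complex `0 → P_l → ⋯ → P_0` of finitely generated
projective `A`-modules (`dP i : P (i+1) → P i`, with `P i` trivial for `i > l`), an
augmentation `ε : P 0 → R` onto `R`, such that (1) `codim Z ≥ l + 2`, (2) `A` is normal,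
(3) `Z` contains the support of the homology of the augmented complex, the augmented
complex is exact, i.e. `P_•` is a projective resolution of `R` of length `l`. -/
theorem stmt13
    (k : Type) [Field k] [IsAlgClosed k]
    (A : Type) [CommRing A] [IsDomain A] [Algebra k A]
    (hfg : Algebra.FiniteType k A)
    (hCM : IsCohenMacaulayRing A)
    (Z : Set (PrimeSpectrum A)) (hZ : IsClosed Z)
    (l : ℕ)
    (P : ℕ → Type) [∀ i, AddCommGroup (P i)] [∀ i, Module A (P i)]
    (hproj : ∀ i, Module.Projective A (P i))
    (hfin : ∀ i, Module.Finite A (P i))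
    (htriv : ∀ i, l < i → Subsingleton (P i))
    (dP : ∀ i, P (i + 1) →ₗ[A] P i)
    (hdd : ∀ i, (dP i).comp (dP (i + 1)) = 0)
    (R : Type) [AddCommGroup R] [Module A R]
    (ε : P 0 →ₗ[A] R) (hε : Function.Surjective ε)
    (hεd : ε.comp (dP 0) = 0)
    (hcodim : (l + 2 : ℕ∞) ≤ ⨅ q ∈ Z, Order.height q)
    (hnormal : IsIntegrallyClosed A)
    (hsupp0 : Module.support A
        (↥(LinearMap.ker ε) ⧸
          (LinearMap.range (dP 0)).comap (LinearMap.ker ε).subtype) ⊆ Z)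
    (hsupp : ∀ i, Module.support A
        (↥(LinearMap.ker (dP i)) ⧸
          (LinearMap.range (dP (i + 1))).comap (LinearMap.ker (dP i)).subtype) ⊆ Z) :
    LinearMap.ker ε = LinearMap.range (dP 0) ∧
    ∀ i, LinearMap.ker (dP i) = LinearMap.range (dP (i + 1)) := by
  obtain ⟨hN, hreg⟩ := hCM
  have hloc : ∀ m : Ideal A, ∀ hm : m.IsMaximal,
      LinearMap.ker (LocalizedModule.map m.primeCompl ε) =
        LinearMap.range (LocalizedModule.map m.primeCompl (dP 0)) ∧
      ∀ i, LinearMap.ker (LocalizedModule.map m.primeCompl (dP i)) =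
        LinearMap.range (LocalizedModule.map m.primeCompl (dP (i + 1))) := by
    intro m hm
    obtain ⟨rs, hrs, hrsreg, hlen⟩ := hreg m hm
    have hcomp : ∀ {L M N : Type} [AddCommGroup L] [Module A L] [AddCommGroup M] [Module A M]
        [AddCommGroup N] [Module A N] (f : L →ₗ[A] M) (g : M →ₗ[A] N), g.comp f = 0 →
        (LocalizedModule.map m.primeCompl g).comp (LocalizedModule.map m.primeCompl f) = 0 := by
      intro L M N _ _ _ _ _ _ f g hgf
      ext x
      induction x using LocalizedModule.induction_on with
      | h x s =>
        rw [LinearMap.comp_apply, LocalizedModule.map_mk, LocalizedModule.map_mk,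
          ← LinearMap.comp_apply, hgf, LinearMap.zero_apply, LinearMap.zero_apply,
          LocalizedModule.zero_mk]
    have : IsNoetherianRing (Localization m.primeCompl) :=
      IsLocalization.isNoetherianRing m.primeCompl _ hN
    refine range_eq_ker_of_subsingleton_ext l (l + 2)
      (fun i => LocalizedModule m.primeCompl (P i)) (fun i j hj p hp hht => ?_) (fun i hi => ?_)
      (fun i => LocalizedModule.map m.primeCompl (dP i)) (fun i => hcomp _ _ (hdd i))
      (LocalizedModule m.primeCompl R) (LocalizedModule.map m.primeCompl ε) (hcomp _ _ hεd)
      (le_height_of_support_homology_subset _ _ _ Z _ hcodim hsupp0)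
      (fun i => le_height_of_support_homology_subset _ _ _ Z _ hcodim (hsupp i))
    · have := hproj i
      have := hfin i
      have : Module.Finite (Localization m.primeCompl) (LocalizedModule m.primeCompl (P i)) :=
        inferInstance
      refine subsingleton_ext_quotient_of_lt_height hrs hrsreg hlen
        (ModuleCat.of _ (LocalizedModule m.primeCompl (P i))) p hp j (lt_of_lt_of_le ?_ hht)
      exact_mod_cast (by omega : j < l + 2)
    · have := htriv i hi
      infer_instance
  constructor
  · exact LinearMap.exact_iff.mp (exact_of_localized_maximal _ _ fun m hm =>
      LinearMap.exact_iff.mpr (hloc m hm).1)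
  · exact fun i => LinearMap.exact_iff.mp (exact_of_localized_maximal _ _ fun m hm =>
      LinearMap.exact_iff.mpr ((hloc m hm).2 i))
end

section
/- Let P_• : 0 → P_l → P_{l−1} → ⋯ → P_0 be a complex of finitely generated projective k[X]-modules of finite length l, let ε : P_0 → R be an augmentation morphism with image R, and let R′ be a torsion-free k[X]-module containing R. Assume: (1) p ≥ l + 2, where p is the codimension of S in X; (2) X is normal; (3) S contains the support of the homology of the augmented complex 0 → P_l → ⋯ → P_0 → R → 0; (4) S contains the support of R′/R. Then R′ = R. -/
universe u

section ExtVanishing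

open CategoryTheory Abelian Pointwise

/-- `Ext^i(N, M) = 0` for all `i < n`. -/
def ExtVanishing (R : Type u) [CommRing R] (N M : Type u) [AddCommGroup N] [Module R N]
    [AddCommGroup M] [Module R M] (n : ℕ) : Prop :=
  ∀ i < n, Subsingleton (Ext (ModuleCat.of R N) (ModuleCat.of R M) i)

namespace ExtVanishing

variable {R : Type u} [CommRing R] {N M M₁ M₂ M₃ : Type u} [AddCommGroup N] [Module R N]
  [AddCommGroup M] [Module R M] [AddCommGroup M₁] [Module R M₁] [AddCommGroup M₂] [Module R M₂]
  [AddCommGroup M₃] [Module R M₃]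

lemma mono {m n : ℕ} (h : ExtVanishing R N M n) (hmn : m ≤ n) : ExtVanishing R N M m :=
  fun i hi ↦ h i (hi.trans_le hmn)

lemma one_iff : ExtVanishing R N M 1 ↔ Subsingleton (N →ₗ[R] M) := by
  have e : Ext (ModuleCat.of R N) (ModuleCat.of R M) 0 ≃+ (N →ₗ[R] M) :=
    Ext.addEquiv₀.trans ModuleCat.homAddEquiv
  refine ⟨fun h ↦ have := h 0 one_pos; e.symm.subsingleton, fun _ i hi ↦ ?_⟩
  obtain rfl : i = 0 := by lia
  exact e.subsingleton

lemma eq_zero_of_forall_smul_eq_zero {I : Ideal R} {n : ℕ} (h : ExtVanishing R (R ⧸ I) M (n + 1))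
    {y : M} (hy : ∀ a ∈ I, a • y = 0) : y = 0 := by
  have := one_iff.1 (h.mono n.succ_pos)
  have h0 := Subsingleton.elim (Submodule.liftQ I (LinearMap.toSpanSingleton R M y)
    fun a ha ↦ by simpa using hy a ha) 0
  exact (one_smul R y).symm.trans congr($h0 (Submodule.Quotient.mk 1))

lemma exists_mem_isSMulRegular [IsNoetherianRing R] [Module.Finite R M] {I : Ideal R} {n : ℕ}
    (h : ExtVanishing R (R ⧸ I) M (n + 1)) : ∃ x ∈ I, IsSMulRegular M x := by
  have := one_iff.1 (h.mono n.succ_pos)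
  simpa [Ideal.annihilator_quotient] using IsSMulRegular.subsingleton_linearMap_iff.mp this

private lemma shortExact {f : M₁ →ₗ[R] M₂} {g : M₂ →ₗ[R] M₃} (hf : Function.Injective f)
    (hg : Function.Surjective g) (hfg : Function.Exact f g) :
    (ShortComplex.moduleCatMk f g hfg.linearMap_comp_eq_zero).ShortExact :=
  ModuleCat.shortComplex_shortExact _ hfg hf hg

lemma of_exact_right {f : M₁ →ₗ[R] M₂} {g : M₂ →ₗ[R] M₃} (hf : Function.Injective f)
    (hg : Function.Surjective g) (hfg : Function.Exact f g) {n : ℕ}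
    (h₁ : ExtVanishing R N M₁ (n + 1)) (h₂ : ExtVanishing R N M₂ n) : ExtVanishing R N M₃ n := by
  intro i hi
  have hS := shortExact hf hg hfg
  have := h₂ i hi
  have := h₁ (i + 1) (by lia)
  refine subsingleton_of_forall_eq 0 fun e ↦ ?_
  obtain ⟨x, rfl⟩ := Ext.covariant_sequence_exact₃ (ModuleCat.of R N) hS e rfl
    (Subsingleton.elim (α := Ext (ModuleCat.of R N) (ModuleCat.of R M₁) (i + 1)) _ _)
  have hx : x = 0 := Subsingleton.elim (α := Ext (ModuleCat.of R N) (ModuleCat.of R M₂) i) x 0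
  rw [hx, Ext.zero_comp]
  rfl

lemma of_exact_left {f : M₁ →ₗ[R] M₂} {g : M₂ →ₗ[R] M₃} (hf : Function.Injective f)
    (hg : Function.Surjective g) (hfg : Function.Exact f g) {n : ℕ}
    (h₃ : ExtVanishing R N M₃ n)
    (h : ∀ i, ∀ e : Ext (ModuleCat.of R N) (ModuleCat.of R M₁) i,
      e.comp (Ext.mk₀ (ModuleCat.ofHom f)) (add_zero i) = 0) :
    ExtVanishing R N M₁ (n + 1) := by
  intro i hi
  have hS := shortExact hf hg hfg
  refine subsingleton_of_forall_eq 0 fun e ↦ ?_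
  match i with
  | 0 =>
    have : Mono (ModuleCat.ofHom f) := (ModuleCat.mono_iff_injective _).2 hf
    exact Ext.postcomp_mk₀_injective_of_mono (ModuleCat.of R N) (ModuleCat.ofHom f)
      ((h 0 e).trans (map_zero _).symm)
  | i + 1 =>
    have := h₃ i (by lia)
    obtain ⟨x, rfl⟩ := Ext.covariant_sequence_exact₁ (ModuleCat.of R N) hS e (h _ e) rfl
    have hx : x = 0 := Subsingleton.elim (α := Ext (ModuleCat.of R N) (ModuleCat.of R M₃) i) x 0
    rw [hx, Ext.zero_comp]
    rfl

lemma comp_ofHom_smul_id {i : ℕ} (e : Ext (ModuleCat.of R N) (ModuleCat.of R M) i) (x : R)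
    (f : M →ₗ[R] M₁) :
    e.comp (Ext.mk₀ (ModuleCat.ofHom (x • f))) (add_zero i) =
      x • e.comp (Ext.mk₀ (ModuleCat.ofHom f)) (add_zero i) := by
  rw [← Ext.comp_smul, ← Ext.mk₀_smul]
  rfl

lemma smul_eq_zero {i : ℕ} (e : Ext (ModuleCat.of R N) (ModuleCat.of R M) i) {x : R}
    (hx : x ∈ Module.annihilator R N) : x • e = 0 := by
  have h : x • 𝟙 (ModuleCat.of R N) = 0 := by
    ext y
    exact Module.mem_annihilator.mp hx y
  rw [← Ext.mk₀_id_comp e, ← Ext.smul_comp, ← Ext.mk₀_smul, h, Ext.mk₀_zero, Ext.zero_comp]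

lemma quotSMulTop {x : R} (hx : IsSMulRegular M x) {n : ℕ} (h : ExtVanishing R N M (n + 1)) :
    ExtVanishing R N (QuotSMulTop x M) n :=
  of_exact_right (f := LinearMap.lsmul R M x) hx (Submodule.mkQ_surjective _)
    (LinearMap.exact_lsmul_mkQ_smul_top M x) h (h.mono n.le_succ)

lemma of_quotSMulTop {x : R} (hx : IsSMulRegular M x) (hxN : x ∈ Module.annihilator R N) {n : ℕ}
    (h : ExtVanishing R N (QuotSMulTop x M) n) : ExtVanishing R N M (n + 1) := by
  refine of_exact_left (f := LinearMap.lsmul R M x) hx (Submodule.mkQ_surjective _)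
    (LinearMap.exact_lsmul_mkQ_smul_top M x) h fun i e ↦ ?_
  have : LinearMap.lsmul R M x = x • LinearMap.id := rfl
  rw [this, comp_ofHom_smul_id, smul_eq_zero _ hxN]

lemma of_finite_projective {n : ℕ} (h : ExtVanishing R N R n) [Module.Finite R M]
    [Module.Projective R M] : ExtVanishing R N M n := by
  intro i hi
  have := h i hi
  obtain ⟨k, f, g, -, -, hfg⟩ := Module.Finite.exists_comp_eq_id_of_projective R M
  refine subsingleton_of_forall_eq 0 fun e ↦ ?_
  have key : ModuleCat.ofHom (LinearMap.id (R := R) (M := M)) = ∑ j : Fin k,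
      ModuleCat.ofHom (LinearMap.proj j ∘ₗ g) ≫
        ModuleCat.ofHom (f ∘ₗ LinearMap.single R (fun _ ↦ R) j) := by
    rw [← hfg]
    ext y
    simp only [ModuleCat.hom_sum]
    simp [← map_sum, Finset.univ_sum_single]
  have : e = e.comp (Ext.mk₀ (ModuleCat.ofHom LinearMap.id)) (add_zero i) := by
    exact (Ext.comp_mk₀_id e).symm
  rw [this, key, Ext.mk₀_sum, Ext.comp_sum]
  refine Finset.sum_eq_zero fun j _ ↦ ?_
  rw [← Ext.mk₀_comp_mk₀, ← Ext.comp_assoc_of_second_deg_zero,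
    Subsingleton.elim (e.comp (Ext.mk₀ (ModuleCat.ofHom (LinearMap.proj j ∘ₗ g))) (add_zero i)) 0,
    Ext.zero_comp]

lemma of_isWeaklyRegular_localization (m : Ideal R) [hm : m.IsMaximal] {B : Type u} [CommRing B]
    [Algebra R B] [IsLocalization.AtPrime B m] [IsLocalRing B] (rs : List B)
    (hmem : ∀ r ∈ rs, r ∈ IsLocalRing.maximalIdeal B) [Module B M] [IsScalarTower R B M]
    (hrs : RingTheory.Sequence.IsWeaklyRegular M rs) : ExtVanishing R (R ⧸ m) M rs.length := by
  induction rs generalizing M with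
  | nil => exact fun i hi ↦ absurd hi (by simp)
  | cons r rs ih =>
    rw [RingTheory.Sequence.isWeaklyRegular_cons_iff] at hrs
    have hex : Function.Exact ((LinearMap.lsmul B M r).restrictScalars R)
        ((r • (⊤ : Submodule B M)).mkQ.restrictScalars R) :=
      LinearMap.exact_lsmul_mkQ_smul_top M r
    have h₃ : ExtVanishing R (R ⧸ m) (M ⧸ r • (⊤ : Submodule B M)) rs.length :=
      ih (M := M ⧸ r • (⊤ : Submodule B M)) (fun r hr ↦ hmem r (List.mem_cons_of_mem _ hr)) hrs.2
    refine of_exact_left (f := (LinearMap.lsmul B M r).restrictScalars R)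
      (g := (r • (⊤ : Submodule B M)).mkQ.restrictScalars R) hrs.1
      (r • (⊤ : Submodule B M)).mkQ_surjective hex h₃ fun i e ↦ ?_
    obtain ⟨a, s, has⟩ := IsLocalization.exists_mk'_eq m.primeCompl r
    have hr : algebraMap R B s * r = algebraMap R B a := by
      rw [← has, mul_comm, IsLocalization.mk'_spec]
    have ha : a ∈ m := by
      rw [← IsLocalization.AtPrime.to_map_mem_maximal_iff B m, ← hr]
      exact Ideal.mul_mem_left _ _ (hmem r List.mem_cons_self)
    have hf : (s : R) • (LinearMap.lsmul B M r).restrictScalars R = a • LinearMap.id := by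
      ext y
      change (s : R) • r • y = a • y
      rw [← algebraMap_smul B (s : R), ← algebraMap_smul B a, ← mul_smul, hr]
    have h := comp_ofHom_smul_id e (s : R) ((LinearMap.lsmul B M r).restrictScalars R)
    rw [hf, comp_ofHom_smul_id, smul_eq_zero _ (by rwa [Ideal.annihilator_quotient])] at h
    obtain ⟨t, b, hb, ht⟩ := hm.exists_inv s.2
    generalize e.comp (Ext.mk₀ (ModuleCat.ofHom ((LinearMap.lsmul B M r).restrictScalars R)))
      (add_zero i) = z at h ⊢
    rw [← one_smul R z, ← ht, add_smul, mul_smul, ← h, _root_.smul_zero, zero_add,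
      smul_eq_zero _ (by rwa [Ideal.annihilator_quotient])]

/-- The hypotheses on `f` say that it is a localization map at the maximal ideal `m`. -/
lemma of_localization [IsNoetherianRing R] (m : Ideal R) [hm : m.IsMaximal] [Module.Finite R M]
    (f : M →ₗ[R] M₁) (hker : ∀ y, f y = 0 → ∃ s ∉ m, s • y = 0)
    (hrange : ∀ y, ∃ s ∉ m, ∃ z, s • y = f z)
    (hbij : ∀ s ∉ m, Function.Bijective fun y : M₁ ↦ s • y) {n : ℕ}
    (h : ExtVanishing R (R ⧸ m) M₁ n) : ExtVanishing R (R ⧸ m) M n := by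
  induction n generalizing M M₁ with
  | zero => exact fun i hi ↦ absurd hi (by simp)
  | succ n ih =>
    have hzero (y : M) (hy : ∀ a ∈ m, a • y = 0) : y = 0 := by
      obtain ⟨s, hs, hsy⟩ := hker y <| h.eq_zero_of_forall_smul_eq_zero fun a ha ↦ by
        rw [← map_smul, hy a ha, map_zero]
      obtain ⟨t, b, hb, ht⟩ := hm.exists_inv hs
      rw [← one_smul R y, ← ht, add_smul, mul_smul, hsy, _root_.smul_zero, hy b hb, zero_add]
    have : Subsingleton ((R ⧸ m) →ₗ[R] M) := by
      refine subsingleton_of_forall_eq 0 fun φ ↦ ?_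
      ext
      refine hzero _ fun a ha ↦ ?_
      have h0 : a • (1 : R ⧸ m) = 0 := Module.mem_annihilator.mp
        (show a ∈ Module.annihilator R (R ⧸ m) by rwa [Ideal.annihilator_quotient]) _
      change a • φ 1 = 0
      rw [← map_smul, h0, map_zero]
    obtain ⟨x, hxm, hx⟩ : ∃ x ∈ m, IsSMulRegular M x := by
      simpa [Ideal.annihilator_quotient] using IsSMulRegular.subsingleton_linearMap_iff.mp this
    have hx₁ : IsSMulRegular M₁ x := by
      refine isSMulRegular_iff_right_eq_zero_of_smul.2 fun y hy ↦ ?_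
      obtain ⟨s, hs, z, hz⟩ := hrange y
      obtain ⟨t, ht, htz⟩ := hker (x • z) (by
        rw [map_smul, ← hz, smul_comm, hy, _root_.smul_zero])
      have htz : t • z = 0 := hx.right_eq_zero_of_smul (by rw [smul_comm, htz])
      have hty : (t * s) • y = 0 := by rw [mul_smul, hz, ← map_smul, htz, map_zero]
      refine (hbij (t * s) (hm.isPrime.mul_notMem ht hs)).1 ?_
      simpa using hty
    refine of_quotSMulTop hx (by rwa [Ideal.annihilator_quotient]) ?_
    let f' : QuotSMulTop x M →ₗ[R] QuotSMulTop x M₁ := QuotSMulTop.map x f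
    have hmem {L : Type u} [AddCommGroup L] [Module R L] (y : L) :
        (Submodule.Quotient.mk y : QuotSMulTop x L) = 0 ↔ ∃ z, x • z = y := by
      simp [Submodule.mem_smul_pointwise_iff_exists]
    refine ih f' (fun y hy ↦ ?_) (fun y ↦ ?_) (fun s hs ↦ ⟨?_, fun y ↦ ?_⟩) (h.quotSMulTop hx₁)
    · obtain ⟨y, rfl⟩ := Submodule.Quotient.mk_surjective _ y
      obtain ⟨z, hz⟩ : ∃ z, x • z = f y := (hmem _).1 hy
      obtain ⟨s, hs, w, hw⟩ := hrange z
      obtain ⟨t, ht, h0⟩ := hker (s • y - x • w) (by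
        rw [map_sub, map_smul, map_smul, ← hz, ← hw, smul_comm, sub_self])
      refine ⟨t * s, hm.isPrime.mul_notMem ht hs, (hmem _).2 ⟨t • w, ?_⟩⟩
      rw [smul_sub, sub_eq_zero] at h0
      change x • t • w = (t * s) • y
      rw [mul_smul, h0, smul_comm]
    · obtain ⟨y, rfl⟩ := Submodule.Quotient.mk_surjective _ y
      obtain ⟨s, hs, z, hz⟩ := hrange y
      exact ⟨s, hs, Submodule.Quotient.mk z, congrArg Submodule.Quotient.mk hz⟩
    · refine isSMulRegular_iff_right_eq_zero_of_smul.2 fun y hy ↦ ?_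
      obtain ⟨y, rfl⟩ := Submodule.Quotient.mk_surjective _ y
      obtain ⟨z, hz⟩ : ∃ z, x • z = s • y := (hmem _).1 hy
      obtain ⟨w, rfl⟩ := (hbij s hs).2 z
      refine (hmem _).2 ⟨w, (hbij s hs).1 ?_⟩
      simp only at hz ⊢
      rw [← hz, smul_comm]
    · obtain ⟨y, rfl⟩ := Submodule.Quotient.mk_surjective _ y
      obtain ⟨w, rfl⟩ := (hbij s hs).2 y
      exact ⟨Submodule.Quotient.mk w, rfl⟩

/-- Depth of `M` at a maximal ideal `m` bounds below the codimension in `m` of the associated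
primes of `M`. -/
lemma height_add_le_height [IsNoetherianRing R] {M : Type u} [AddCommGroup M] [Module R M]
    [Module.Finite R M] {m p : Ideal R} [hm : m.IsMaximal] {e : ℕ}
    (h : ExtVanishing R (R ⧸ m) M e) (hp : p ∈ associatedPrimes R M) (hpm : p ≤ m) :
    p.height + e ≤ m.height := by
  induction e generalizing M p with
  | zero => simpa using Ideal.height_mono hpm
  | succ e ih =>
    obtain ⟨x, hxm, hx⟩ := h.exists_mem_isSMulRegular
    have hpp : p.IsPrime := hp.1
    have hxp : x ∉ p := fun hxp ↦ by
      have : x ∈ ⋃ p ∈ associatedPrimes R M, (p : Set R) := Set.mem_biUnion hp hxp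
      rw [biUnion_associatedPrimes_eq_compl_regular] at this
      exact this hx
    let M' := Submodule.torsionBySet R M (p : Set R)
    have hM' (y : M) : y ∈ M' ↔ ∀ a ∈ p, a • y = 0 := by
      simp [M', Submodule.mem_torsionBySet_iff]
    have hmM' : (⟨m, hm.isPrime⟩ : PrimeSpectrum R) ∈ Module.support R (QuotSMulTop x M') := by
      rw [Module.support_quotSMulTop]
      refine ⟨?_, by simpa using hxm⟩
      rw [Module.mem_support_iff_of_finite]
      refine le_trans (fun a ha ↦ ?_) hpm
      obtain ⟨y, hy⟩ := (isAssociatedPrime_iff.1 hp).2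
      have hyM : y ∈ M' := (hM' y).2 fun a ha ↦ by
        rw [hy, Submodule.mem_colon_singleton] at ha
        simpa using ha
      rw [hy, Submodule.mem_colon_singleton]
      simpa using congrArg Subtype.val (Module.mem_annihilator.1 ha ⟨y, hyM⟩)
    rw [Module.mem_support_iff_of_finite] at hmM'
    obtain ⟨q, hq, hqm⟩ := Ideal.exists_minimalPrimes_le hmM'
    have hqp : q.IsPrime := hq.1.1
    have hqann : Module.annihilator R (QuotSMulTop x M') ≤ q := hq.1.2
    have hxq : x ∈ q := hqann <| Module.mem_annihilator.2 fun y ↦ by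
      obtain ⟨y, rfl⟩ := Submodule.Quotient.mk_surjective _ y
      exact (Submodule.Quotient.mk_eq_zero _).2 (Submodule.smul_mem_pointwise_smul _ _ _ trivial)
    have hpq : p < q := by
      refine lt_of_le_of_ne (fun a ha ↦ hqann <| Module.mem_annihilator.2 fun y ↦ ?_) ?_
      · obtain ⟨y, rfl⟩ := Submodule.Quotient.mk_surjective _ y
        rw [← Submodule.Quotient.mk_smul]
        have h0 : a • y = 0 := Subtype.ext ((hM' _).1 y.2 a ha)
        rw [h0, Submodule.Quotient.mk_zero]
      · rintro rfl
        exact hxp hxq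
    have hqM : q ∈ associatedPrimes R (QuotSMulTop x M) := by
      refine IsAssociatedPrime.map_of_injective (f := QuotSMulTop.map x M'.subtype)
        (h := Module.associatedPrimes.minimalPrimes_annihilator_subset_associatedPrimes R _ hq)
        (hf := (injective_iff_map_eq_zero _).2 fun y hy ↦ ?_)
      obtain ⟨y, rfl⟩ := Submodule.Quotient.mk_surjective _ y
      have hy' : (Submodule.Quotient.mk (y : M) : QuotSMulTop x M) = 0 := hy
      rw [Submodule.Quotient.mk_eq_zero, Submodule.mem_smul_pointwise_iff_exists] at hy' ⊢
      obtain ⟨z, -, hz⟩ := hy'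
      refine ⟨⟨z, (hM' z).2 fun a ha ↦ hx.right_eq_zero_of_smul ?_⟩, trivial, Subtype.ext hz⟩
      rw [smul_comm, hz]
      exact (hM' _).1 y.2 a ha
    calc p.height + (e + 1 : ℕ) = p.height + 1 + e := by push_cast; ring
      _ ≤ q.height + e := by
        gcongr
        exact Ideal.height_add_one_le_of_lt_of_isPrime hpq
      _ ≤ m.height := ih (h.quotSMulTop hx) hqM hqm

lemma of_forall_isMaximal [IsNoetherianRing R] {q : Ideal R} [q.IsPrime] {n : ℕ}
    (hn : n ≤ q.height) {M : Type u} [AddCommGroup M] [Module R M] [Module.Finite R M] {j : ℕ}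
    (h : ∀ m : Ideal R, m.IsMaximal → q ≤ m →
      ∃ e : ℕ, ExtVanishing R (R ⧸ m) M e ∧ m.height + j ≤ e + n) :
    ExtVanishing R (R ⧸ q) M j := by
  induction j generalizing M with
  | zero => exact fun i hi ↦ absurd hi (by simp)
  | succ j ih =>
    obtain ⟨x, hxq, hx⟩ : ∃ x ∈ q, IsSMulRegular M x := by
      by_contra! hx
      have hsub : (q : Set R) ⊆ ⋃ p ∈ associatedPrimes R M, (p : Set R) := by
        rw [biUnion_associatedPrimes_eq_compl_regular]
        exact hx
      obtain ⟨p, hp, hqp⟩ := (Ideal.subset_union_prime_finite (associatedPrimes.finite R M) ⊥ ⊥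
        fun p hp _ _ ↦ hp.1).1 hsub
      obtain ⟨m, hm, hpm⟩ := Ideal.exists_le_maximal p hp.1.ne_top
      obtain ⟨e, he, hme⟩ := h m hm (hqp.trans hpm)
      have h₁ := he.height_add_le_height hp hpm
      have h₂ : (n : ℕ∞) ≤ p.height := hn.trans (Ideal.height_mono hqp)
      have h₃ : m.height ≠ ⊤ := Ideal.height_ne_top hm.ne_top
      have h₄ : p.height ≠ ⊤ := Ideal.height_ne_top hp.1.ne_top
      lift m.height to ℕ using h₃ with a
      lift p.height to ℕ using h₄ with b
      norm_cast at *
      lia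
    refine of_quotSMulTop hx (by rwa [Ideal.annihilator_quotient]) (ih fun m hm hqm ↦ ?_)
    obtain ⟨e, he, hme⟩ := h m hm hqm
    have h₁ : (n : ℕ∞) ≤ m.height := hn.trans (Ideal.height_mono hqm)
    have h₂ : m.height ≠ ⊤ := Ideal.height_ne_top hm.ne_top
    lift m.height to ℕ using h₂ with a
    norm_cast at *
    obtain ⟨e, rfl⟩ := Nat.exists_eq_succ_of_ne_zero (n := e) (by lia)
    exact ⟨e, he.quotSMulTop hx, by lia⟩

lemma of_subsingleton [Subsingleton M] (n : ℕ) : ExtVanishing R N M n := by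
  refine fun i _ ↦ subsingleton_of_forall_eq 0 fun e ↦ ?_
  have h : 𝟙 (ModuleCat.of R M) = 0 := by
    ext y
    exact Subsingleton.elim (α := M) _ _
  rw [← Ext.comp_mk₀_id e, h, Ext.mk₀_zero, Ext.comp_zero]

lemma of_linearEquiv (f : M ≃ₗ[R] M₁) {n : ℕ} (h : ExtVanishing R N M n) :
    ExtVanishing R N M₁ n :=
  of_exact_right (f := (0 : PUnit.{u + 1} →ₗ[R] M)) (g := f.toLinearMap)
    (Function.injective_of_subsingleton _) f.surjective
    ((LinearMap.exact_zero_iff_injective _ _).2 f.injective) (of_subsingleton _) h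

end ExtVanishing

variable {R : Type u} [CommRing R]

/-- In a Cohen–Macaulay ring, `Ext^i(R ⧸ q, R)` vanishes for `i` less than the height of `q`. -/
lemma IsCohenMacaulayRing.extVanishing (hR : IsCohenMacaulayRing R) {q : Ideal R} [q.IsPrime]
    {n : ℕ} (hn : n ≤ q.height) : ExtVanishing R (R ⧸ q) R n := by
  have := hR.1
  refine .of_forall_isMaximal hn fun m hm hqm ↦ ?_
  obtain ⟨rs, hmem, hrs, hlen⟩ := hR.2 m hm
  refine ⟨rs.length, ?_, ?_⟩
  · refine .of_localization m (Algebra.linearMap R (Localization.AtPrime m)) (fun y hy ↦ ?_)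
      (fun y ↦ ?_) (fun s hs ↦ ?_) (.of_isWeaklyRegular_localization m rs hmem hrs.1)
    · obtain ⟨s, hs⟩ := (IsLocalization.map_eq_zero_iff m.primeCompl _ y).1 hy
      exact ⟨s, s.2, hs⟩
    · obtain ⟨⟨z, s⟩, hz⟩ := IsLocalization.surj m.primeCompl y
      exact ⟨s, s.2, z, by simpa [Algebra.smul_def, mul_comm] using hz⟩
    · simp_rw [Algebra.smul_def]
      exact (IsUnit.isUnit_iff_mulLeft_bijective).1
        (IsLocalization.map_units (M := m.primeCompl) (Localization.AtPrime m) ⟨s, hs⟩)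
  · rw [IsLocalization.AtPrime.ringKrullDim_eq_height m (Localization.AtPrime m)] at hlen
    rw [← WithBot.coe_injective hlen]

/-- A submodule `B` of a torsion-free module `C` is everything if `C ⧸ B` is supported where `B`
has depth at least two. -/
lemma Submodule.eq_top_of_extVanishing [IsDomain R] [IsNoetherianRing R] {C : Type u}
    [AddCommGroup C] [Module R C] [Module.IsTorsionFree R C] (B : Submodule R C)
    (h : ∀ q ∈ Module.support R (C ⧸ B),
      q.asIdeal ≠ ⊥ ∧ ExtVanishing R (R ⧸ q.asIdeal) B 2) : B = ⊤ := by
  by_contra hB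
  have := Submodule.Quotient.nontrivial_iff.2 hB
  obtain ⟨q, hq⟩ := associatedPrimes.nonempty R (C ⧸ B)
  obtain ⟨hqp, y, hy⟩ := isAssociatedPrime_iff.1 hq
  have hy0 (a : R) : a ∈ q ↔ a • y = 0 := by
    rw [hy, Submodule.mem_colon_singleton, Submodule.mem_bot]
  obtain ⟨h0, h2⟩ := h ⟨q, hqp⟩ (Module.mem_support_iff_exists_annihilator.2
    ⟨y, fun a ha ↦ (hy0 a).2 ((Submodule.mem_annihilator_span_singleton _ _).1 ha)⟩)
  obtain ⟨a, ha, ha0⟩ := Submodule.exists_mem_ne_zero_of_ne_bot h0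
  have hC : ExtVanishing R (R ⧸ q) C 1 := by
    refine ExtVanishing.one_iff.2 (subsingleton_of_forall_eq 0 fun φ ↦ LinearMap.ext fun z ↦ ?_)
    have haz : a • z = 0 := Module.mem_annihilator.1
      (show a ∈ Module.annihilator R (R ⧸ q) by rwa [Ideal.annihilator_quotient]) z
    exact (smul_eq_zero_iff_right ha0).1 (by rw [← map_smul, haz, map_zero])
  have hquot : ExtVanishing R (R ⧸ q) (C ⧸ B) 1 :=
    .of_exact_right B.subtype_injective B.mkQ_surjective (LinearMap.exact_subtype_mkQ B) h2 hC
  have hy1 : y = 0 := hquot.eq_zero_of_forall_smul_eq_zero fun a ha ↦ (hy0 a).1 ha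
  exact hqp.ne_top ((Ideal.eq_top_iff_one q).2 ((hy0 1).2 (by rw [hy1, smul_zero])))

end ExtVanishing

/- Same setting as for the projective-resolution statement: `A = k[X]` is the
Cohen–Macaulay coordinate ring of an irreducible affine variety over the algebraically
closed field `k`, `Z ⊆ Spec A` is closed with `codim Z ≥ l + 2`, `A` is normal, and
`0 → P_l → ⋯ → P_0 →^ε R → 0` is an augmented complex of finitely generated projective
modules with homology supported in `Z`, where `R = range ε` sits inside a torsion-free
module `R'`.  If moreover `Z` contains the support of `R'/R`, then `R' = R`,
i.e. `ε` is surjective onto `R'`. -/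
theorem stmt14
    (k : Type) [Field k] [IsAlgClosed k]
    (A : Type) [CommRing A] [IsDomain A] [Algebra k A]
    (hfg : Algebra.FiniteType k A)
    (hCM : IsCohenMacaulayRing A)
    (Z : Set (PrimeSpectrum A)) (hZ : IsClosed Z)
    (l : ℕ)
    (P : ℕ → Type) [∀ i, AddCommGroup (P i)] [∀ i, Module A (P i)]
    (hproj : ∀ i, Module.Projective A (P i))
    (hfin : ∀ i, Module.Finite A (P i))
    (htriv : ∀ i, l < i → Subsingleton (P i))
    (dP : ∀ i, P (i + 1) →ₗ[A] P i)
    (hdd : ∀ i, (dP i).comp (dP (i + 1)) = 0)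
    (R' : Type) [AddCommGroup R'] [Module A R']
    (htf : NoZeroSMulDivisors A R')
    (ε : P 0 →ₗ[A] R')
    (hεd : ε.comp (dP 0) = 0)
    (hcodim : (l + 2 : ℕ∞) ≤ ⨅ q ∈ Z, Order.height q)
    (hnormal : IsIntegrallyClosed A)
    (hsupp0 : Module.support A
        (↥(LinearMap.ker ε) ⧸
          (LinearMap.range (dP 0)).comap (LinearMap.ker ε).subtype) ⊆ Z)
    (hsupp : ∀ i, Module.support A
        (↥(LinearMap.ker (dP i)) ⧸
          (LinearMap.range (dP (i + 1))).comap (LinearMap.ker (dP i)).subtype) ⊆ Z)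
    (hsuppR : Module.support A (R' ⧸ LinearMap.range ε) ⊆ Z) :
    LinearMap.range ε = ⊤ := by
  have := hCM.1
  have hheight (q : PrimeSpectrum A) (hq : q ∈ Z) : ((l + 2 : ℕ) : ℕ∞) ≤ q.asIdeal.height := by
    rw [PrimeSpectrum.height_eq_orderHeight]
    exact_mod_cast hcodim.trans (iInf₂_le q hq)
  have hbot (q : PrimeSpectrum A) (hq : q ∈ Z) : q.asIdeal ≠ ⊥ := fun h ↦ by
    have := hheight q hq
    rw [h, Ideal.height_bot] at this
    norm_cast at this
  have hP (q : PrimeSpectrum A) (hq : q ∈ Z) (i : ℕ) :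
      ExtVanishing A (A ⧸ q.asIdeal) (P i) (l + 2) :=
    (hCM.extVanishing (hheight q hq)).of_finite_projective
  have hstep {M₁ M₂ M₃ : Type} [AddCommGroup M₁] [Module A M₁] [AddCommGroup M₂] [Module A M₂]
      [AddCommGroup M₃] [Module A M₃] [Module.IsTorsionFree A M₂] (d : M₁ →ₗ[A] M₂)
      (d' : M₂ →ₗ[A] M₃) (hd : d'.comp d = 0)
      (hs : Module.support A (↥(LinearMap.ker d') ⧸
        (LinearMap.range d).comap (LinearMap.ker d').subtype) ⊆ Z) (n : ℕ)
      (h₁ : ∀ q ∈ Z, ExtVanishing A (A ⧸ q.asIdeal) (LinearMap.range d) (n + 2))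
      (h₂ : ∀ q ∈ Z, ExtVanishing A (A ⧸ q.asIdeal) M₂ (n + 1)) :
      ∀ q ∈ Z, ExtVanishing A (A ⧸ q.asIdeal) (LinearMap.range d') (n + 1) := by
    have hle : LinearMap.range d ≤ LinearMap.ker d' := LinearMap.range_le_ker_iff.2 hd
    have htop := Submodule.eq_top_of_extVanishing
      ((LinearMap.range d).comap (LinearMap.ker d').subtype) fun q hq ↦ ⟨hbot q (hs hq),
        ((h₁ q (hs hq)).mono (by lia)).of_linearEquiv (Submodule.comapSubtypeEquivOfLe hle).symm⟩
    have hker : LinearMap.ker d' = LinearMap.range d :=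
      le_antisymm (Submodule.comap_subtype_eq_top.1 htop) hle
    intro q hq
    refine .of_exact_right (LinearMap.range d).subtype_injective d'.surjective_rangeRestrict ?_
      (h₁ q hq) (h₂ q hq)
    rw [LinearMap.exact_iff, LinearMap.ker_rangeRestrict, hker, Submodule.range_subtype]
  have hrange (j : ℕ) : ∀ i, l ≤ i + j → ∀ q ∈ Z,
      ExtVanishing A (A ⧸ q.asIdeal) (LinearMap.range (dP i)) (i + 3) := by
    induction j with
    | zero =>
      intro i hi q _
      have := htriv (i + 1) (by lia)
      have := (dP i).surjective_rangeRestrict.subsingleton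
      exact .of_subsingleton _
    | succ j ih =>
      intro i hi
      by_cases hli : l ≤ i + j
      · exact ih i hli
      · exact hstep (dP (i + 1)) (dP i) (hdd i) (hsupp i) (i + 2) (ih (i + 1) (by lia))
          fun q hq ↦ (hP q hq _).mono (by lia)
  have hε := hstep (dP 0) ε hεd hsupp0 1 (hrange l 0 (by lia))
    fun q hq ↦ (hP q hq _).mono (by lia)
  exact Submodule.eq_top_of_extVanishing _ fun q hq ↦ ⟨hbot q (hsuppR hq), hε q (hsuppR hq)⟩
end

section
/- Let C_• : 0 → C_l → ⋯ → C_1 → C_0 → 0 be a homology complex of finitely generated k[X]-modules of finite positive length l, and for j = 0, …, l let Z_j denote the module of cycles of degree j (Z_j = ker(C_j → C_{j−1}) for j ≥ 1 and Z_0 = C_0). Assume: (1) S contains the support of the homology of C_•; (2) every C_i is a submodule of a free k[X]-module; (3) for i = 1, …, l, the module C_i has projective dimension at most d; (4) X is normal and l + d ≤ p − 1, where p is the codimension of S in X. Then C_• is acyclic (its homology vanishes in every positive degree) and, for j = 0, …, l, the module Z_j has projective dimension at most l + d − j − 1. -/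
universe u v

/-- `ProjDimLE A n M` says that the `A`-module `M` has projective dimension at most `n`,
i.e. it admits a projective resolution of length at most `n`. -/
def ProjDimLE (A : Type u) [Ring A] :
    ℕ → (M : Type v) → [AddCommGroup M] → [Module A M] → Prop
  | 0, M, _, _ => Module.Projective A M
  | n + 1, M, _, _ =>
    ∃ (P : Type v) (_ : AddCommGroup P) (_ : Module A P) (f : P →ₗ[A] M),
      Module.Projective A P ∧ Function.Surjective f ∧
        ProjDimLE A n ↥(LinearMap.ker f)

section ProjectiveDimension

open CategoryTheory

/-- `ProjDimLE` agrees with Mathlib's notion of projective dimension. -/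
theorem projDimLE_iff {R : Type u} [CommRing R] (n : ℕ) (M : Type u) [AddCommGroup M]
    [Module R M] : ProjDimLE R n M ↔ HasProjectiveDimensionLE (ModuleCat.of R M) n := by
  induction n generalizing M with
  | zero =>
    rw [← projective_iff_hasProjectiveDimensionLE_zero, ← IsProjective.iff_projective]
    rfl
  | succ n ih =>
    constructor
    · rintro ⟨P, _, _, f, hP, hf, hk⟩
      have : Projective (f.shortComplexKer).X₂ := (IsProjective.iff_projective P).mp hP
      exact ((LinearMap.shortExact_shortComplexKer hf).hasProjectiveDimensionLT_X₃_iff n this).mpr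
        ((ih _).mp hk)
    · intro h
      let f := Finsupp.linearCombination R (id : M → M)
      have hf : Function.Surjective f := Finsupp.linearCombination_id_surjective R M
      have : Projective (f.shortComplexKer).X₂ := (IsProjective.iff_projective _).mp inferInstance
      exact ⟨_, _, _, f, inferInstance, hf, (ih _).mpr <|
        ((LinearMap.shortExact_shortComplexKer hf).hasProjectiveDimensionLT_X₃_iff n this).mp h⟩

end ProjectiveDimension

section Dimension

theorem WithBot.eq_bot_or_exists_natCast_of_add_le {a : WithBot ℕ∞} {g d : ℕ}
    (h : a + g ≤ d) : a = ⊥ ∨ ∃ n : ℕ, a = n ∧ n + g ≤ d := by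
  induction a with
  | bot => exact .inl rfl
  | coe a =>
    induction a using ENat.recTopCoe with
    | top =>
      replace h : ((⊤ + g : ℕ∞) : WithBot ℕ∞) ≤ (d : ℕ∞) := h
      rw [top_add, WithBot.coe_le_coe] at h
      exact absurd h (ENat.natCast_lt_top d).not_ge
    | coe n => exact .inr ⟨n, rfl, by exact_mod_cast h⟩

/-- If every prime in the support of `M` has height at least `g`, then
`dim M + g ≤ dim R`. -/
theorem Module.supportDim_add_le_ringKrullDim {R : Type*} [CommRing R] (M : Type*)
    [AddCommGroup M] [Module R M] (g : ℕ)
    (h : ∀ p ∈ Module.support R M, (g : ℕ∞) ≤ Order.height p) :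
    Module.supportDim R M + g ≤ ringKrullDim R := by
  rcases subsingleton_or_nontrivial M with hM | hM
  · simp [Module.supportDim_eq_bot_of_subsingleton]
  have : Nonempty (Module.support R M) := Module.nonempty_support_of_nontrivial.to_subtype
  rw [Module.supportDim, Order.krullDim_eq_iSup_coheight_of_nonempty, ← WithBot.coe_natCast,
    ← WithBot.coe_add]
  have : Nonempty (PrimeSpectrum R) := this.map Subtype.val
  rw [ringKrullDim, Order.krullDim_eq_iSup_height_add_coheight_of_nonempty, WithBot.coe_le_coe,
    ENat.iSup_add]
  refine iSup_le fun q ↦ le_iSup_of_le q.1 ?_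
  rw [add_comm]
  exact add_le_add (h q q.2)
    (Order.coheight_le_coheight_apply_of_strictMono _ (Subtype.strictMono_coe _) q)

end Dimension

section Ischebeck

open CategoryTheory Abelian RingTheory.Sequence IsLocalRing Pointwise

variable {R : Type u} [CommRing R]

theorem ModuleCat.subsingleton_ext_X₂ {S : ShortComplex (ModuleCat.{u} R)} (hS : S.ShortExact)
    (M : ModuleCat.{u} R) (i : ℕ) [Subsingleton (Ext S.X₁ M i)] [Subsingleton (Ext S.X₃ M i)] :
    Subsingleton (Ext S.X₂ M i) := by
  refine subsingleton_of_forall_eq 0 fun x ↦ ?_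
  obtain ⟨y, rfl⟩ := Ext.contravariant_sequence_exact₂ hS M x (Subsingleton.elim _ _)
  rw [Subsingleton.elim y 0, Ext.comp_zero]

variable [IsNoetherianRing R] [IsLocalRing R]

/-- Nakayama's lemma for `Ext`: if `x` is a nonunit regular on `N` and
`Ext (N ⧸ x N) M (i + 1) = 0`, then `Ext N M i = 0`. -/
theorem ModuleCat.subsingleton_ext_of_quotSMulTop (N M : ModuleCat.{u} R) [Module.Finite R N]
    [Module.Finite R M] {x : R} (hx : x ∈ maximalIdeal R) (hreg : IsSMulRegular N x) (i : ℕ)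
    [Subsingleton (Ext (ModuleCat.of R (QuotSMulTop x N)) M (i + 1))] :
    Subsingleton (Ext N M i) := by
  have hmk (z : Ext N M i) : (Ext.mk₀ (x • 𝟙 N)).comp z (zero_add i) = x • z := by
    rw [Ext.mk₀_smul, Ext.smul_comp, Ext.mk₀_id_comp]
  have hsurj (y : Ext N M i) : ∃ z : Ext N M i, x • z = y := by
    obtain ⟨z, hz⟩ := Ext.contravariant_sequence_exact₁ hreg.smulShortComplex_shortExact M y
      (add_comm 1 i) (Subsingleton.elim (α := Ext (ModuleCat.of R (QuotSMulTop x N)) M (i + 1)) _ _)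
    exact ⟨z, (hmk z).symm.trans hz⟩
  by_contra hne
  rw [not_subsingleton_iff_nontrivial] at hne
  refine Submodule.top_ne_pointwise_smul_of_mem_jacobson_annihilator (M := Ext N M i)
    (maximalIdeal_le_jacobson _ hx) (eq_top_iff.mpr fun y _ ↦ ?_).symm
  obtain ⟨z, rfl⟩ := hsurj y
  exact Submodule.smul_mem_pointwise_smul _ _ _ trivial

/-- Ischebeck's theorem: `Ext N M i` vanishes for `i < depth M - dim N`. -/
theorem ModuleCat.subsingleton_ext_of_supportDim_le (M : ModuleCat.{u} R) [Module.Finite R M]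
    (rs : List R) (mem : ∀ r ∈ rs, r ∈ maximalIdeal R) (reg : IsRegular M rs) (n : ℕ)
    (N : ModuleCat.{u} R) [Module.Finite R N] (hN : Module.supportDim R N ≤ n) (i : ℕ)
    (hi : i + n < rs.length) : Subsingleton (Ext N M i) := by
  have : Nontrivial M := reg.nontrivial
  induction n generalizing N i with
  | zero =>
    refine subsingleton_ext_of_exists_isRegular (maximalIdeal R) N ?_ M ?_ rs mem reg i hi
    · rcases subsingleton_or_nontrivial N with h | h
      · simp [Module.support_eq_empty]
      · have : Nonempty (Module.support R N) :=
          Module.nonempty_support_of_nontrivial.to_subtype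
        exact (support_of_supportDim_eq_zero R N
          (le_antisymm (by simpa using hN) Order.krullDim_nonneg)).le
    · exact lt_top_iff_ne_top.mpr
        (Submodule.top_ne_ideal_smul_of_le_jacobson_annihilator (maximalIdeal_le_jacobson _)).symm
  | succ n ih =>
    suffices H : Module.supportDim R N ≤ (n + 1 : ℕ) →
        Subsingleton (Ext (ModuleCat.of R N) M i) from H hN
    refine IsNoetherianRing.induction_on_isQuotientEquivQuotientPrime R
      (inferInstanceAs (Module.Finite R N))
      (motive := fun N _ _ _ ↦ Module.supportDim R N ≤ (n + 1 : ℕ) →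
        Subsingleton (Ext (ModuleCat.of R N) M i)) ?_ ?_ ?_
    · intro N _ _ _ _ _
      exact ih (ModuleCat.of R N)
        (by simp [Module.supportDim_eq_bot_of_subsingleton R N]) i (by lia)
    · intro N _ _ _ p e hdim
      rcases eq_or_ne p.1 (maximalIdeal R) with hp | hp
      · refine ih (ModuleCat.of R N) ?_ i (by lia)
        change Module.supportDim R N ≤ n
        rw [Module.supportDim_eq_of_equiv e, Module.supportDim_quotient_eq_ringKrullDim, hp]
        exact (ringKrullDim_eq_zero_of_field (ResidueField R)).trans_le (by simp)
      · obtain ⟨x, hx, hxp⟩ := SetLike.exists_of_lt (lt_of_le_of_ne (le_maximalIdeal p.2.ne_top) hp)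
        have hreg : IsSMulRegular N x := by
          refine (e.isSMulRegular_congr x).mpr
            ((isSMulRegular_quotient_iff_mem_of_smul_mem _ _).mpr fun y hy ↦ ?_)
          exact (p.2.mem_or_mem hy).resolve_left hxp
        have := ih (ModuleCat.of R (QuotSMulTop x N)) (by
          have := Module.supportDim_quotSMulTop_succ_eq_supportDim hreg hx
          rw [← this, Nat.cast_succ] at hdim
          rcases WithBot.eq_bot_or_exists_natCast_of_add_le (g := 1) (d := n + 1)
            (by exact_mod_cast hdim) with h | ⟨k, h, hk⟩
          · exact h.trans_le bot_le
          · exact h.trans_le (by exact_mod_cast Nat.le_of_add_le_add_right hk)) (i + 1) (by lia)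
        exact subsingleton_ext_of_quotSMulTop (ModuleCat.of R N) M hx hreg i
    · intro N₁ _ _ _ N₂ _ _ _ N₃ _ _ _ f g hf hg hfg h₁ h₃ hdim
      have := h₁ ((Module.supportDim_le_of_injective f hf).trans hdim)
      have := h₃ ((Module.supportDim_le_of_surjective g hg).trans hdim)
      exact subsingleton_ext_X₂ (ModuleCat.shortComplex_shortExact
        (ModuleCat.shortComplexOfCompEqZero f g hfg.linearMap_comp_eq_zero) hfg hf hg) M i

/-- A finitely generated module of projective dimension at most `m` over a local ring of depth
at least `d` receives no nonzero `Ext` of degree `< d - m - n` from modules of dimension at most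
`n`. -/
theorem ModuleCat.subsingleton_ext_of_hasProjectiveDimensionLE
    (rs : List R) (mem : ∀ r ∈ rs, r ∈ maximalIdeal R) (reg : IsRegular R rs) (n : ℕ)
    (N : ModuleCat.{u} R) [Module.Finite R N] (hN : Module.supportDim R N ≤ n) (m : ℕ)
    (M : ModuleCat.{u} R) [Module.Finite R M] [HasProjectiveDimensionLE M m] (i : ℕ)
    (hi : i + n + m < rs.length) : Subsingleton (Ext N M i) := by
  induction m generalizing M i with
  | zero =>
    rcases subsingleton_or_nontrivial M with h | h
    · refine subsingleton_of_forall_eq 0 fun x ↦ ?_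
      rw [← x.comp_mk₀_id, (ModuleCat.isZero_of_subsingleton M).eq_of_src (𝟙 M) 0, Ext.mk₀_zero,
        Ext.comp_zero]
    have : Projective M := (projective_iff_hasProjectiveDimensionLE_zero _).mpr inferInstance
    have : Module.Projective R M := (IsProjective.iff_projective _).mpr this
    have hM : IsWeaklyRegular M rs :=
      (LinearEquiv.isWeaklyRegular_congr (TensorProduct.rid R M) rs).mp
        reg.toIsWeaklyRegular.isWeaklyRegular_lTensor
    exact subsingleton_ext_of_supportDim_le M rs mem
      (.of_isWeaklyRegular_of_mem_maximalIdeal M mem hM) n N hN i (by lia)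
  | succ m ih =>
    obtain ⟨P, _, _, _, _, f, hf⟩ := Module.exists_finite_presentation R M
    have hS := LinearMap.shortExact_shortComplexKer hf
    have hP : Projective (f.shortComplexKer).X₂ := (IsProjective.iff_projective P).mp inferInstance
    have : HasProjectiveDimensionLE (f.shortComplexKer).X₁ m :=
      (hS.hasProjectiveDimensionLT_X₃_iff m hP).mp ‹_›
    have : HasProjectiveDimensionLE (ModuleCat.of R P) m :=
      hasProjectiveDimensionLT_of_ge _ 1 (m + 1) (by lia)
    have h₂ : Subsingleton (Ext N (ModuleCat.of R P) i) := ih (ModuleCat.of R P) i (by lia)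
    have h₁ : Subsingleton (Ext N (ModuleCat.of R (LinearMap.ker f)) (i + 1)) :=
      ih (ModuleCat.of R (LinearMap.ker f)) (i + 1) (by lia)
    refine subsingleton_of_forall_eq 0 fun x ↦ ?_
    obtain ⟨y, rfl⟩ := Ext.covariant_sequence_exact₃ N hS x rfl (h₁.elim _ _)
    rw [h₂.elim y 0]
    exact Ext.zero_comp ..

/-- Over a local Cohen–Macaulay ring, a short exact sequence splits if its kernel has projective
dimension at most `m` and its cokernel is supported in codimension at least `m + 2`. -/
theorem CategoryTheory.ShortComplex.ShortExact.exists_section_of_le_height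
    {S : ShortComplex (ModuleCat.{u} R)} (hS : S.ShortExact)
    [Module.Finite R S.X₁] [Module.Finite R S.X₃]
    (rs : List R) (mem : ∀ r ∈ rs, r ∈ maximalIdeal R) (reg : IsRegular R rs)
    (hdim : rs.length = ringKrullDim R) (m : ℕ) [HasProjectiveDimensionLE S.X₁ m]
    (h : ∀ p ∈ Module.support R S.X₃, ((m + 2 : ℕ) : ℕ∞) ≤ Order.height p) :
    ∃ s : S.X₃ ⟶ S.X₂, s ≫ S.g = 𝟙 S.X₃ := by
  have hle := Module.supportDim_add_le_ringKrullDim S.X₃ (m + 2) h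
  rw [← hdim] at hle
  have : Subsingleton (Ext S.X₃ S.X₁ 1) := by
    rcases WithBot.eq_bot_or_exists_natCast_of_add_le hle with h | ⟨n, h, hn⟩
    · have : Subsingleton S.X₃ := (Module.supportDim_eq_bot_iff_subsingleton R _).mp h
      refine subsingleton_of_forall_eq 0 fun x ↦ ?_
      rw [← x.mk₀_id_comp, (ModuleCat.isZero_of_subsingleton S.X₃).eq_of_src (𝟙 S.X₃) 0,
        Ext.mk₀_zero, Ext.zero_comp]
    · exact ModuleCat.subsingleton_ext_of_hasProjectiveDimensionLE rs mem reg n _ h.le m _ 1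
        (by lia)
  obtain ⟨y, hy⟩ := Ext.covariant_sequence_exact₃ _ hS (Ext.mk₀ (𝟙 S.X₃)) (zero_add 1)
    (Subsingleton.elim _ _)
  obtain ⟨s, rfl⟩ := (Ext.mk₀_bijective _ _).2 y
  exact ⟨s, (Ext.mk₀_bijective _ _).1 (by simpa using hy)⟩

/-- In the situation of `exists_section_of_le_height`, the cokernel vanishes if it is annihilated
by an element that is regular on the middle term. -/
theorem CategoryTheory.ShortComplex.ShortExact.subsingleton_X₃_of_le_height
    {S : ShortComplex (ModuleCat.{u} R)} (hS : S.ShortExact)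
    [Module.Finite R S.X₁] [Module.Finite R S.X₃]
    (rs : List R) (mem : ∀ r ∈ rs, r ∈ maximalIdeal R) (reg : IsRegular R rs)
    (hdim : rs.length = ringKrullDim R) (m : ℕ) [HasProjectiveDimensionLE S.X₁ m]
    (h : ∀ p ∈ Module.support R S.X₃, ((m + 2 : ℕ) : ℕ∞) ≤ Order.height p)
    {a : R} (ha : ∀ x : S.X₃, a • x = 0) (hreg : IsSMulRegular S.X₂ a) :
    Subsingleton S.X₃ := by
  obtain ⟨s, hs⟩ := hS.exists_section_of_le_height rs mem reg hdim m h
  refine subsingleton_of_forall_eq 0 fun x ↦ ?_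
  have hsx : s.hom x = 0 := hreg.right_eq_zero_of_smul (by rw [← map_smul, ha, map_zero])
  have := ConcreteCategory.congr_hom hs x
  rwa [ModuleCat.comp_apply, hsx, map_zero, ModuleCat.id_apply, eq_comm] at this

end Ischebeck

section Localization

/-- Localizing a module does not decrease the heights of the primes in its support. -/
theorem Module.le_height_of_mem_support_of_isLocalizedModule {R : Type*} [CommRing R]
    (T : Submonoid R) (R' : Type*) [CommRing R'] [Algebra R R'] [IsLocalization T R']
    {H H' : Type*} [AddCommGroup H] [Module R H] [Module.Finite R H] [AddCommGroup H'] [Module R H']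
    [Module R' H'] [IsScalarTower R R' H'] (f : H →ₗ[R] H') [IsLocalizedModule T f] {g : ℕ∞}
    (h : ∀ p ∈ Module.support R H, g ≤ Order.height p) :
    ∀ q ∈ Module.support R' H', g ≤ Order.height q := by
  intro q hq
  rw [← PrimeSpectrum.height_eq_orderHeight, ← IsLocalization.height_under T]
  change g ≤ (q.comap (algebraMap R R')).asIdeal.height
  rw [PrimeSpectrum.height_eq_orderHeight]
  refine h _ (Module.mem_support_iff_of_finite.mpr fun a ha ↦ ?_)
  refine Module.annihilator_le_of_mem_support hq (Module.mem_annihilator.mpr fun y ↦ ?_)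
  obtain ⟨⟨m, s⟩, rfl⟩ := IsLocalizedModule.mk'_surjective T f y
  rw [algebraMap_smul, Function.uncurry_apply_pair, ← IsLocalizedModule.mk'_smul,
    Module.mem_annihilator.mp ha, IsLocalizedModule.mk'_zero]

open CategoryTheory

theorem ModuleCat.finite_localizedModule {A : Type u} [CommRing A] (T : Submonoid A)
    (X : ModuleCat.{u} A) [Module.Finite A X] :
    Module.Finite (Localization T) (X.localizedModule T) :=
  Module.Finite.of_isLocalizedModule T (X.localizedModuleMkLinearMap T)

theorem ModuleCat.subsingleton_of_localizedModule {A : Type u} [CommRing A] (X : ModuleCat.{u} A)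
    (hX : ∀ (P : Ideal A) [P.IsMaximal], Subsingleton (X.localizedModule P.primeCompl)) :
    Subsingleton X :=
  Module.subsingleton_of_localization_maximal (fun P _ ↦ X.localizedModule P.primeCompl)
    (fun P _ ↦ X.localizedModuleMkLinearMap P.primeCompl) hX

theorem ModuleCat.smul_localizedModule_eq_zero {A : Type u} [CommRing A] (T : Submonoid A)
    (X : ModuleCat.{u} A) {a : A} (ha : a ∈ Module.annihilator A X) (x : X.localizedModule T) :
    algebraMap A (Localization T) a • x = 0 := by
  obtain ⟨⟨z, t⟩, rfl⟩ := IsLocalizedModule.mk'_surjective T (X.localizedModuleMkLinearMap T) x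
  rw [algebraMap_smul, Function.uncurry_apply_pair, ← IsLocalizedModule.mk'_smul,
    Module.mem_annihilator.mp ha, IsLocalizedModule.mk'_zero]

theorem ModuleCat.le_height_of_mem_support_localizedModule {A : Type u} [CommRing A]
    (T : Submonoid A) (X : ModuleCat.{u} A) [Module.Finite A X] {g : ℕ∞}
    (h : ∀ p ∈ Module.support A X, g ≤ Order.height p) :
    ∀ q ∈ Module.support (Localization T) (X.localizedModule T), g ≤ Order.height q :=
  Module.le_height_of_mem_support_of_isLocalizedModule T _ (X.localizedModuleMkLinearMap T) h

variable {A : Type u} [CommRing A] [IsDomain A]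

/-- Over a Cohen–Macaulay domain, the cokernel in a short exact sequence of finite modules
vanishes if the kernel has projective dimension at most `m`, the middle term is torsion-free and
the cokernel is supported in codimension at least `m + 2`. -/
theorem CategoryTheory.ShortComplex.ShortExact.subsingleton_X₃_of_isCohenMacaulayRing
    (hCM : IsCohenMacaulayRing A) {S : ShortComplex (ModuleCat.{u} A)} (hS : S.ShortExact)
    [Module.Finite A S.X₁] [Module.Finite A S.X₃]
    (hreg : ∀ a : A, a ≠ 0 → IsSMulRegular S.X₂ a) (m : ℕ) [HasProjectiveDimensionLE S.X₁ m]
    (h : ∀ p ∈ Module.support A S.X₃, ((m + 2 : ℕ) : ℕ∞) ≤ Order.height p) :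
    Subsingleton S.X₃ := by
  have := hCM.1
  obtain ⟨a, ha, ha0⟩ : ∃ a ∈ Module.annihilator A S.X₃, a ≠ 0 := by
    by_contra! h0
    have := h ⊥ (Module.mem_support_iff_of_finite.mpr fun a ha ↦ h0 a ha)
    rw [Order.height_bot] at this
    simp at this
  refine S.X₃.subsingleton_of_localizedModule fun P _ ↦ ?_
  let T := S.map (ModuleCat.localizedModuleFunctor P.primeCompl)
  have hT : T.ShortExact := hS.map_of_exact (ModuleCat.localizedModuleFunctor P.primeCompl)
  have : Module.Finite (Localization.AtPrime P) T.X₁ := S.X₁.finite_localizedModule P.primeCompl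
  have : Module.Finite (Localization.AtPrime P) T.X₃ := S.X₃.finite_localizedModule P.primeCompl
  have : HasProjectiveDimensionLE T.X₁ m :=
    S.X₁.localizedModule_hasProjectiveDimensionLE m P.primeCompl
  obtain ⟨rs, mem, reg, hdim⟩ := hCM.2 P ‹_›
  exact hT.subsingleton_X₃_of_le_height rs mem reg hdim m
    (S.X₃.le_height_of_mem_support_localizedModule P.primeCompl h)
    (S.X₃.smul_localizedModule_eq_zero P.primeCompl ha)
    ((hreg a ha0).of_isLocalizedModule (Localization P.primeCompl) P.primeCompl
      (S.X₂.localizedModuleMkLinearMap P.primeCompl))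

/-- Over a Cohen–Macaulay domain, a submodule `N` of projective dimension at most `m` of a finite
torsion-free module `M` is everything as soon as `M ⧸ N` is supported in codimension at least
`m + 2`. -/
theorem Submodule.eq_top_of_le_height (hCM : IsCohenMacaulayRing A) {M : Type u} [AddCommGroup M]
    [Module A M] [Module.Finite A M] (hM : ∀ a : A, a ≠ 0 → IsSMulRegular M a)
    (N : Submodule A M) (m : ℕ) [HasProjectiveDimensionLE (ModuleCat.of A N) m]
    (h : ∀ p ∈ Module.support A (M ⧸ N), ((m + 2 : ℕ) : ℕ∞) ≤ Order.height p) : N = ⊤ := by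
  have := hCM.1
  have hS := ModuleCat.shortComplex_shortExact
    (ModuleCat.shortComplexOfCompEqZero N.subtype N.mkQ (by ext; simp))
    (LinearMap.exact_subtype_mkQ N) N.injective_subtype N.mkQ_surjective
  have : Subsingleton (M ⧸ N) := hS.subsingleton_X₃_of_isCohenMacaulayRing hCM hM m h
  rwa [← Submodule.Quotient.subsingleton_iff]

end Localization

/-- A submodule of a free module over a domain is torsion-free. -/
theorem isSMulRegular_of_injective_finsupp {A : Type*} [CommRing A] [IsDomain A] {M ι : Type*}
    [AddCommGroup M] [Module A M] (f : M →ₗ[A] (ι →₀ A)) (hf : Function.Injective f) {a : A}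
    (ha : a ≠ 0) : IsSMulRegular M a := by
  refine fun x y hxy ↦ hf (smul_right_injective _ ha ?_)
  simpa using congr_arg f hxy

section Complex

open CategoryTheory

/-- Over a Cohen–Macaulay domain, a complex is exact at a torsion-free term if the boundaries have
projective dimension at most `m` and the homology is supported in codimension at least `m + 2`. -/
theorem ker_eq_range_of_hasProjectiveDimensionLE {A : Type u} [CommRing A] [IsDomain A]
    (hCM : IsCohenMacaulayRing A) {M₀ M₁ M₂ : Type u} [AddCommGroup M₀] [AddCommGroup M₁]
    [AddCommGroup M₂] [Module A M₀] [Module A M₁] [Module A M₂]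
    [Module.Finite A M₁] (hM : ∀ a : A, a ≠ 0 → IsSMulRegular M₁ a) (f : M₂ →ₗ[A] M₁)
    (g : M₁ →ₗ[A] M₀) (hgf : g ∘ₗ f = 0) (m : ℕ)
    [HasProjectiveDimensionLE (ModuleCat.of A (LinearMap.range f)) m]
    (h : ∀ p ∈ Module.support A
      (LinearMap.ker g ⧸ (LinearMap.range f).comap (LinearMap.ker g).subtype),
      ((m + 2 : ℕ) : ℕ∞) ≤ Order.height p) :
    LinearMap.ker g = LinearMap.range f := by
  have := hCM.1
  have hle : LinearMap.range f ≤ LinearMap.ker g := LinearMap.range_le_ker_iff.mpr hgf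
  refine le_antisymm ?_ hle
  rw [← Submodule.comap_subtype_eq_top]
  have := ModuleCat.hasProjectiveDimensionLE_of_linearEquiv
    (M := ModuleCat.of A (LinearMap.range f))
    (N := ModuleCat.of A ((LinearMap.range f).comap (LinearMap.ker g).subtype))
    (Submodule.comapSubtypeEquivOfLe hle).symm m
  exact Submodule.eq_top_of_le_height hCM (fun a ha ↦ (hM a ha).submodule _ _) _ m h

/-- In a complex of length `l` that is exact wherever the boundaries have small projective
dimension, the boundaries in degree `l - t` have projective dimension less than `t + e`. -/
theorem hasProjectiveDimensionLT_range {A : Type u} [CommRing A] {C : ℕ → Type u}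
    [∀ i, AddCommGroup (C i)] [∀ i, Module A (C i)] (dC : ∀ i, C (i + 1) →ₗ[A] C i) (l e : ℕ)
    (htriv : Subsingleton (C (l + 1)))
    (hexact : ∀ i, i < l → ∀ m, m + 1 ≤ l + e →
      HasProjectiveDimensionLE (ModuleCat.of A (LinearMap.range (dC (i + 1)))) m →
      LinearMap.ker (dC i) = LinearMap.range (dC (i + 1)))
    (hpd : ∀ i, i < l → HasProjectiveDimensionLE (ModuleCat.of A (C (i + 1))) e)
    (t i : ℕ) (h : i + t = l) :
    HasProjectiveDimensionLT (ModuleCat.of A (LinearMap.range (dC i))) (t + e) := by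
  induction t generalizing i with
  | zero =>
    obtain rfl : i = l := h
    have : Subsingleton (LinearMap.range (dC i)) :=
      (dC i).surjective_rangeRestrict.subsingleton
    have := (ModuleCat.isZero_of_subsingleton
      (ModuleCat.of A (LinearMap.range (dC i)))).hasProjectiveDimensionLT_zero
    exact hasProjectiveDimensionLT_of_ge _ 0 _ (Nat.zero_le _)
  | succ t ih =>
    have hr := ih (i + 1) (by lia)
    have hk : HasProjectiveDimensionLT (ModuleCat.of A (LinearMap.ker (dC i))) (t + e) := by
      rwa [hexact i (by lia) (t + e - 1) (by lia)
        (hasProjectiveDimensionLT_of_ge _ (t + e) _ (by lia))]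
    have := hpd i (by lia)
    have hS := ModuleCat.shortComplex_shortExact (ModuleCat.shortComplexOfCompEqZero
      (LinearMap.ker (dC i)).subtype (dC i).rangeRestrict (by ext x; simp))
      (LinearMap.exact_iff.mpr (by simp))
      (Submodule.injective_subtype _) (dC i).surjective_rangeRestrict
    rw [add_right_comm]
    exact hS.hasProjectiveDimensionLT_X₃ _ hk
      (hasProjectiveDimensionLT_of_ge (ModuleCat.of A (C (i + 1))) (e + 1) _ (by lia))

end Complex

/- `A = k[X]` is the Cohen–Macaulay coordinate ring of an irreducible affine variety over
the algebraically closed field `k`, `Z ⊆ Spec A` is closed.  `0 → C_l → ⋯ → C_0 → 0` is a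
homology complex of finitely generated `A`-modules of positive length `l`
(`dC i : C (i+1) → C i`, with `C i` trivial for `i > l`), with cycles `Z_0 = C_0` and
`Z_{j+1} = ker (dC j)`.  Assume (1) `Z` contains the support of the homology of `C_•`;
(2) each `C_i` embeds into a free module; (3) `C_i` has projective dimension `≤ e` for
`1 ≤ i ≤ l`; (4) `A` is normal and `l + e ≤ codim Z - 1`.  Then `C_•` has no homology in
positive degrees and `Z_j` has projective dimension `≤ l + e - j - 1` for `0 ≤ j ≤ l`. -/
theorem stmt15
    (k : Type) [Field k] [IsAlgClosed k]
    (A : Type) [CommRing A] [IsDomain A] [Algebra k A]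
    (hfg : Algebra.FiniteType k A)
    (hCM : IsCohenMacaulayRing A)
    (Z : Set (PrimeSpectrum A)) (hZ : IsClosed Z)
    (l : ℕ) (hl : 1 ≤ l)
    (C : ℕ → Type) [∀ i, AddCommGroup (C i)] [∀ i, Module A (C i)]
    (hfin : ∀ i, Module.Finite A (C i))
    (htriv : ∀ i, l < i → Subsingleton (C i))
    (dC : ∀ i, C (i + 1) →ₗ[A] C i)
    (hdd : ∀ i, (dC i).comp (dC (i + 1)) = 0)
    (hsupp0 : Module.support A (C 0 ⧸ LinearMap.range (dC 0)) ⊆ Z)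
    (hsupp : ∀ i, Module.support A
        (↥(LinearMap.ker (dC i)) ⧸
          (LinearMap.range (dC (i + 1))).comap (LinearMap.ker (dC i)).subtype) ⊆ Z)
    (hfree : ∀ i, ∃ (ι : Type) (f : C i →ₗ[A] (ι →₀ A)), Function.Injective f)
    (e : ℕ)
    (hpd : ∀ i, 1 ≤ i → i ≤ l → ProjDimLE A e (C i))
    (hnormal : IsIntegrallyClosed A)
    (hcodim : (l + e + 1 : ℕ∞) ≤ ⨅ q ∈ Z, Order.height q) :
    (∀ i, LinearMap.ker (dC i) = LinearMap.range (dC (i + 1))) ∧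
    ProjDimLE A (l + e - 1) (C 0) ∧
    (∀ j, j + 1 ≤ l → ProjDimLE A (l + e - j - 2) ↥(LinearMap.ker (dC j))) := by
  have := hCM.1
  have hreg (i : ℕ) (a : A) (ha : a ≠ 0) : IsSMulRegular (C i) a := by
    obtain ⟨ι, f, hf⟩ := hfree i
    exact isSMulRegular_of_injective_finsupp f hf ha
  have hht {m : ℕ} (hm : m + 1 ≤ l + e) {p : PrimeSpectrum A} (hp : p ∈ Z) :
      ((m + 2 : ℕ) : ℕ∞) ≤ Order.height p := by
    refine le_trans ?_ (le_iInf₂_iff.mp hcodim p hp)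
    exact_mod_cast (by lia : m + 2 ≤ l + e + 1)
  have hexact (i m : ℕ) (hm : m + 1 ≤ l + e) (h : CategoryTheory.HasProjectiveDimensionLE
      (ModuleCat.of A (LinearMap.range (dC (i + 1)))) m) :
      LinearMap.ker (dC i) = LinearMap.range (dC (i + 1)) :=
    ker_eq_range_of_hasProjectiveDimensionLE hCM (hreg _) _ _ (hdd i) m
      fun p hp ↦ hht hm (hsupp i hp)
  have hrange (i m : ℕ) (hi : i ≤ l) (hm : l - i + e ≤ m + 1) :
      CategoryTheory.HasProjectiveDimensionLE (ModuleCat.of A (LinearMap.range (dC i))) m := by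
    have := hasProjectiveDimensionLT_range dC l e (htriv _ l.lt_succ_self) (fun i _ ↦ hexact i)
      (fun i hi ↦ (projDimLE_iff e _).mp (hpd (i + 1) (by lia) hi)) (l - i) i (by lia)
    exact CategoryTheory.hasProjectiveDimensionLT_of_ge _ (l - i + e) _ hm
  have hker (i : ℕ) : LinearMap.ker (dC i) = LinearMap.range (dC (i + 1)) := by
    rcases lt_or_ge i l with hi | hi
    · exact hexact i (l + e - 1) (by lia) (hrange _ _ hi (by lia))
    · have := htriv (i + 1) (by lia)
      exact Subsingleton.elim _ _
  refine ⟨hker, ?_, fun j hj ↦ ?_⟩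
  · have := hrange 0 (l + e - 1) (Nat.zero_le l) (by lia)
    have htop := Submodule.eq_top_of_le_height hCM (hreg 0) _ (l + e - 1)
      fun p hp ↦ hht (by lia) (hsupp0 hp)
    exact (projDimLE_iff _ _).mpr <| ModuleCat.hasProjectiveDimensionLE_of_linearEquiv
      (M := ModuleCat.of A (LinearMap.range (dC 0))) (N := ModuleCat.of A (C 0))
      (LinearEquiv.ofTop _ htop) _
  · rw [projDimLE_iff, hker]
    exact hrange (j + 1) _ hj (by lia)
end
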